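/- The only rational solutions (x, y) of the equation y² = 6x⁶ - 7x³ + 2 are (x, y) = (1, 1) and (1, -1). -/

import Mathlib

theorem Int.not_isSquare_of_lt_of_lt {d n : ℤ} (hn : 0 ≤ n) (h : n * n < d)
    (h' : d < (n + 1) * (n + 1)) : ¬IsSquare d := by
  rintro ⟨r, rfl⟩
  have h1 := abs_lt_of_sq_lt_sq (show r ^ 2 < (n + 1) ^ 2 by nlinarith) (by omega)
  have h2 := abs_lt_of_sq_lt_sq (show n ^ 2 < |r| ^ 2 by rw [sq_abs]; nlinarith) (abs_nonneg r)
  rw [abs_of_nonneg hn] at h2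
  omega

/-- Every sublattice `{x + y√d : x ≡ k y mod m}` with `m ∣ k² - d` contains an element whose norm is
`j * m` with `j` in `J`, once this is known for the finitely many small `m`. -/
theorem exists_norm_eq_mul_of_dvd {d : ℤ} (hd : ¬IsSquare d) (J : Set ℤ)
    (base : ∀ m k : ℤ, m ≠ 0 → 3 * m ^ 2 ≤ 4 * |d| → 2 * |k| ≤ |m| → m ∣ k ^ 2 - d →
      ∃ x y j : ℤ, j ∈ J ∧ m ∣ x - k * y ∧ x ^ 2 - d * y ^ 2 = j * m)
    (m k : ℤ) (hm : m ≠ 0) (hk : m ∣ k ^ 2 - d) :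
    ∃ x y j : ℤ, j ∈ J ∧ m ∣ x - k * y ∧ x ^ 2 - d * y ^ 2 = j * m := by
  induction hn : m.natAbs using Nat.strong_induction_on generalizing m k with
  | _ n ih =>
  wlog hkm : 2 * |k| ≤ |m| generalizing k with H
  · have hred : ∃ k' : ℤ, 2 * |k'| ≤ |m| ∧ m ∣ k - k' := by
      have hpos : 0 < m.natAbs := Int.natAbs_pos.mpr hm
      have h1 := Int.le_bmod (x := k) hpos
      have h2 := Int.bmod_lt (x := k) hpos
      exact ⟨Int.bmod k m.natAbs, by simp only [Int.abs_eq_natAbs]; omega, Int.natAbs_dvd.1 Int.dvd_self_sub_bmod⟩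
    obtain ⟨k', hk', hdvd⟩ := hred
    have hk'2 : m ∣ k' ^ 2 - d := by
      have : k' ^ 2 - d = (k ^ 2 - d) - (k - k') * (k + k') := by ring
      rw [this]
      exact dvd_sub hk (hdvd.mul_right _)
    obtain ⟨x, y, j, hj, hx, hxy⟩ := H k' hk'2 hk'
    refine ⟨x, y, j, hj, ?_, hxy⟩
    have : x - k * y = (x - k' * y) - (k - k') * y := by ring
    rw [this]
    exact dvd_sub hx (hdvd.mul_right _)
  by_cases hsmall : 3 * m ^ 2 ≤ 4 * |d|
  · exact base m k hm hsmall hkm hk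
  obtain ⟨m', hm'⟩ := hk
  have hm'0 : m' ≠ 0 := by
    rintro rfl
    exact hd ⟨k, by linarith⟩
  have hlt : m'.natAbs < n := by
    subst hn
    have h1 : |m| * |m'| = |k ^ 2 - d| := by rw [hm', abs_mul]
    have h2 : |k ^ 2 - d| ≤ |k| ^ 2 + |d| := by
      rw [← abs_pow]; exact abs_sub _ _
    have h3 : 0 < |m| := abs_pos.mpr hm
    have h4 : |m| ^ 2 = m ^ 2 := sq_abs m
    zify
    by_contra! hle
    nlinarith [abs_nonneg k]
  obtain ⟨x, y, j, hj, hx, hxy⟩ := ih _ hlt m' (-k) hm'0 ⟨m, by linarith⟩ rfl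
  obtain ⟨Y, hY⟩ := hx
  have hX : k * x + d * y = m' * (k * Y - m * y) := by
    linear_combination k * hY - y * hm'
  refine ⟨k * Y - m * y, Y, j, hj, ⟨-y, by ring⟩, ?_⟩
  apply mul_left_cancel₀ (pow_ne_zero 2 hm'0)
  have h1 : m' * Y = x + k * y := by linarith
  calc m' ^ 2 * ((k * Y - m * y) ^ 2 - d * Y ^ 2)
      = (m' * (k * Y - m * y)) ^ 2 - d * (m' * Y) ^ 2 := by ring
    _ = (x ^ 2 - d * y ^ 2) * (k ^ 2 - d) := by rw [← hX, h1]; ring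
    _ = m' ^ 2 * (j * m) := by rw [hxy, hm']; ring

/-- If a primitive element of `ℤ[√d]` has norm a cube `m³`, then up to a factor of controlled norm
it is a cube. -/
theorem exists_cube_eq_mul_of_norm_eq_cube {d : ℤ} {J : Set ℤ}
    (hJ : ∀ m k : ℤ, m ≠ 0 → m ∣ k ^ 2 - d →
      ∃ x y j : ℤ, j ∈ J ∧ m ∣ x - k * y ∧ x ^ 2 - d * y ^ 2 = j * m)
    {h : ℤ√d} {m : ℤ} (hm : m ≠ 0) (hcop : IsCoprime h.re h.im) (hnorm : h.norm = m ^ 3) :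
    ∃ β κ : ℤ√d, β ^ 3 = κ * h ∧ ∃ j ∈ J, κ.norm = j ^ 3 := by
  obtain ⟨r, s⟩ := h
  simp only [Zsqrtd.norm_def] at hcop hnorm
  have hsm3 : IsCoprime s (m ^ 3) := by
    rw [← hnorm]
    have : r * r - d * s * s = r * r + s * (-d * s) := by ring
    rw [this]
    exact (IsCoprime.mul_right hcop.symm hcop.symm).add_mul_left_right _
  have hsm : IsCoprime s m := (IsCoprime.pow_right_iff (by norm_num)).1 hsm3
  obtain ⟨a, b, hab⟩ := hsm
  obtain ⟨x, y, j, hj, ⟨w, hw⟩, hxy⟩ := hJ m (r * a) hm (by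
    have h2 : (IsCoprime (s ^ 2) m) := (IsCoprime.pow_left ⟨a, b, hab⟩)
    refine h2.symm.dvd_of_dvd_mul_left ⟨m ^ 2 + r ^ 2 * (b ^ 2 * m - 2 * b), ?_⟩
    have hsa : a * s = 1 - b * m := by linarith
    linear_combination hnorm + r ^ 2 * (a * s + 1 - b * m) * hsa)
  set β : ℤ√d := ⟨x, y⟩ with hβ
  set h : ℤ√d := ⟨r, s⟩ with hh
  have key : (s : ℤ√d) * β = (y : ℤ√d) * h + (m : ℤ√d) * ((s * w - r * y * b : ℤ) : ℤ√d) := by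
    ext
    · simp [hβ, hh]
      linear_combination s * hw + r * y * hab
    · simp [hβ, hh]; ring
  have hmh : (m : ℤ√d) ^ 3 = h * star h := by
    rw [← Zsqrtd.norm_eq_mul_conj, Zsqrtd.norm_def, hnorm]; push_cast; rfl
  have h1 : h ∣ (s : ℤ√d) ^ 3 * β ^ 3 := by
    rw [← mul_pow, key]
    set W : ℤ√d := ((s * w - r * y * b : ℤ) : ℤ√d)
    have : ((y : ℤ√d) * h + (m : ℤ√d) * W) ^ 3 = h * ((y : ℤ√d) * ((y * h) ^ 2 +
        3 * (y * h) * (m * W) + 3 * (m * W) ^ 2)) + (m : ℤ√d) ^ 3 * W ^ 3 := by ring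
    rw [this, hmh]
    exact dvd_add (dvd_mul_right _ _) ((dvd_mul_right _ _).mul_right _)
  have h2 : h ∣ (m : ℤ√d) ^ 3 * β ^ 3 := by
    rw [hmh]; exact (dvd_mul_right _ _).mul_right _
  obtain ⟨u, v, huv⟩ : IsCoprime (s ^ 3) (m ^ 3) := (IsCoprime.pow ⟨a, b, hab⟩)
  have h3 : h ∣ β ^ 3 := by
    have : β ^ 3 = u * ((s : ℤ√d) ^ 3 * β ^ 3) + v * ((m : ℤ√d) ^ 3 * β ^ 3) := by
      have huv' : (u : ℤ√d) * (s : ℤ√d) ^ 3 + v * (m : ℤ√d) ^ 3 = 1 := by exact_mod_cast huv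
      linear_combination -(β ^ 3) * huv'
    rw [this]
    exact dvd_add (h1.mul_left _) (h2.mul_left _)
  obtain ⟨κ, hκ⟩ := h3
  refine ⟨β, κ, by rw [hκ, mul_comm], j, hj, ?_⟩
  have hn := congrArg Zsqrtd.norm hκ
  have hβn : β.norm = j * m := by rw [Zsqrtd.norm_def, ← hxy]; ring
  have hhn : h.norm = m ^ 3 := by rw [Zsqrtd.norm_def, ← hnorm]
  rw [Zsqrtd.norm_mul, hhn, pow_succ, pow_two, Zsqrtd.norm_mul, Zsqrtd.norm_mul, hβn] at hn
  apply mul_left_cancel₀ (pow_ne_zero 3 hm)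
  linarith

theorem exists_norm_two (m k : ℤ) (hm : m ≠ 0) (hk : m ∣ k ^ 2 - 2) :
    ∃ x y j : ℤ, j ∈ ({1, -1} : Set ℤ) ∧ m ∣ x - k * y ∧ x ^ 2 - 2 * y ^ 2 = j * m := by
  refine exists_norm_eq_mul_of_dvd
    (Int.not_isSquare_of_lt_of_lt (n := 1) (by norm_num) (by norm_num) (by norm_num)) _ ?_ m k hm hk
  intro m k hm h1 h2 h3
  have : m = 1 ∨ m = -1 := by
    have h1 : 3 * m ^ 2 ≤ 8 := by simpa using h1
    have : m < 2 := by nlinarith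
    have : -2 < m := by nlinarith
    omega
  rcases this with rfl | rfl
  · exact ⟨1, 0, 1, by simp⟩
  · exact ⟨1, 0, -1, by simp⟩

theorem exists_norm_neg_one (m k : ℤ) (hm : m ≠ 0) (hk : m ∣ k ^ 2 - (-1)) :
    ∃ x y j : ℤ, j ∈ ({1, -1} : Set ℤ) ∧ m ∣ x - k * y ∧ x ^ 2 - (-1) * y ^ 2 = j * m := by
  refine exists_norm_eq_mul_of_dvd (fun ⟨r, hr⟩ => by nlinarith) _ ?_ m k hm hk
  intro m k hm h1 h2 h3
  have : m = 1 ∨ m = -1 := by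
    have h1 : 3 * m ^ 2 ≤ 4 := by simpa using h1
    have : m < 2 := by nlinarith
    have : -2 < m := by nlinarith
    omega
  rcases this with rfl | rfl
  · exact ⟨1, 0, 1, by simp⟩
  · exact ⟨1, 0, -1, by simp⟩

theorem eq_of_three_mul_sq_le {m : ℤ} (hm : m ≠ 0) (h : 3 * m ^ 2 ≤ 24) :
    m = 1 ∨ m = -1 ∨ m = 2 ∨ m = -2 := by
  have : m < 3 := by nlinarith
  have : -3 < m := by nlinarith
  omega

theorem exists_norm_three (m k : ℤ) (hm : m ≠ 0) (hk : m ∣ k ^ 2 - 3) :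
    ∃ x y j : ℤ, j ∈ ({1, -1} : Set ℤ) ∧ m ∣ x - k * y ∧ x ^ 2 - 3 * y ^ 2 = j * m := by
  refine exists_norm_eq_mul_of_dvd
    (Int.not_isSquare_of_lt_of_lt (n := 1) (by norm_num) (by norm_num) (by norm_num)) _ ?_ m k hm hk
  intro m k hm h1 h2 h3
  rcases eq_of_three_mul_sq_le hm (by norm_num at h1; linarith) with rfl | rfl | rfl | rfl
  · exact ⟨1, 0, 1, by simp⟩
  · exact ⟨1, 0, -1, by simp⟩
  all_goals
    obtain rfl | rfl | rfl : k = 0 ∨ k = 1 ∨ k = -1 := by norm_num at h2; grind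
  · norm_num at h3
  · exact ⟨1, 1, -1, by simp⟩
  · exact ⟨1, 1, -1, by simp⟩
  · norm_num at h3
  · exact ⟨1, 1, 1, by simp⟩
  · exact ⟨1, 1, 1, by simp⟩

theorem exists_norm_six (m k : ℤ) (hm : m ≠ 0) (hk : m ∣ k ^ 2 - 6) :
    ∃ x y j : ℤ, j ∈ ({1, -1} : Set ℤ) ∧ m ∣ x - k * y ∧ x ^ 2 - 6 * y ^ 2 = j * m := by
  refine exists_norm_eq_mul_of_dvd
    (Int.not_isSquare_of_lt_of_lt (n := 2) (by norm_num) (by norm_num) (by norm_num)) _ ?_ m k hm hk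
  intro m k hm h1 h2 h3
  rcases eq_of_three_mul_sq_le hm (by norm_num at h1; linarith) with rfl | rfl | rfl | rfl
  · exact ⟨1, 0, 1, by simp⟩
  · exact ⟨1, 0, -1, by simp⟩
  all_goals
    obtain rfl | rfl | rfl : k = 0 ∨ k = 1 ∨ k = -1 := by norm_num at h2; grind
  · exact ⟨2, 1, -1, by simp⟩
  · norm_num at h3
  · norm_num at h3
  · exact ⟨2, 1, 1, by simp⟩
  · norm_num at h3
  · norm_num at h3

theorem exists_norm_neg_six (m k : ℤ) (hm : m ≠ 0) (hk : m ∣ k ^ 2 - (-6)) :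
    ∃ x y j : ℤ, j ∈ ({1, -1, 2, -2} : Set ℤ) ∧ m ∣ x - k * y ∧
      x ^ 2 - (-6) * y ^ 2 = j * m := by
  refine exists_norm_eq_mul_of_dvd (fun ⟨r, hr⟩ => by nlinarith) _ ?_ m k hm hk
  intro m k hm h1 h2 h3
  rcases eq_of_three_mul_sq_le hm (by norm_num at h1; linarith) with rfl | rfl | rfl | rfl
  · exact ⟨1, 0, 1, by simp⟩
  · exact ⟨1, 0, -1, by simp⟩
  all_goals
    obtain rfl | rfl | rfl : k = 0 ∨ k = 1 ∨ k = -1 := by norm_num at h2; grind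
  · exact ⟨2, 0, 2, by simp⟩
  · norm_num at h3
  · norm_num at h3
  · exact ⟨2, 0, -2, by simp⟩
  · norm_num at h3
  · norm_num at h3

theorem Pell.IsFundamental.exists_eq_pow_mul_cube {d : ℤ} {a : Pell.Solution₁ d}
    (ha : Pell.IsFundamental a) {u : ℤ√d} (hu : u.norm = 1) :
    ∃ (i : ℕ) (γ : ℤ√d), u = (a : ℤ√d) ^ i * γ ^ 3 := by
  have hu' : u ∈ unitary (ℤ√d) := Zsqrtd.norm_eq_one_iff_mem_unitary.1 hu
  have hz : ∀ n : ℤ, ∃ (i : ℕ) (γ : Pell.Solution₁ d), a ^ n = a ^ i * γ ^ 3 := fun n => by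
    refine ⟨(n % 3).toNat, a ^ (n / 3), ?_⟩
    rw [← zpow_natCast, ← zpow_natCast, ← zpow_mul, ← zpow_add,
      Int.toNat_of_nonneg (Int.emod_nonneg _ (by norm_num))]
    congr 1
    omega
  obtain ⟨n, hn⟩ := ha.eq_zpow_or_neg_zpow ⟨u, hu'⟩
  obtain ⟨i, γ, hγ⟩ := hz n
  rw [hγ] at hn
  rcases hn with hn | hn
  · exact ⟨i, γ, congrArg Subtype.val hn⟩
  · refine ⟨i, -γ, (congrArg Subtype.val hn).trans ?_⟩
    rw [Odd.neg_pow (by decide), mul_neg]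
    rfl

theorem isFundamental_two : Pell.IsFundamental (Pell.Solution₁.mk 3 2 rfl : Pell.Solution₁ 2) := by
  refine ⟨by simp, by simp, fun {a} ha => ?_⟩
  by_contra! hlt
  simp only [Pell.Solution₁.x_mk] at hlt
  have := a.prop
  have : a.x = 2 := by omega
  grind

theorem isFundamental_three : Pell.IsFundamental (Pell.Solution₁.mk 2 1 rfl : Pell.Solution₁ 3) := by
  refine ⟨by simp, by simp, fun {a} ha => ?_⟩
  simp only [Pell.Solution₁.x_mk]
  omega

theorem isFundamental_six : Pell.IsFundamental (Pell.Solution₁.mk 5 2 rfl : Pell.Solution₁ 6) := by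
  refine ⟨by simp, by simp, fun {a} ha => ?_⟩
  by_contra! hlt
  simp only [Pell.Solution₁.x_mk] at hlt
  have := a.prop
  have : a.x = 2 ∨ a.x = 3 ∨ a.x = 4 := by omega
  grind

theorem exists_eq_mul_cube_of_norm_eq_cube {d : ℤ} {J : Set ℤ}
    (hJ : ∀ m k : ℤ, m ≠ 0 → m ∣ k ^ 2 - d →
      ∃ x y j : ℤ, j ∈ J ∧ m ∣ x - k * y ∧ x ^ 2 - d * y ^ 2 = j * m)
    {θ : ℤ√d} (hJ' : ∀ κ : ℤ√d, ∀ j ∈ J, κ.norm = j ^ 3 →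
      ∃ (i : ℕ) (γ : ℤ√d), κ * θ ^ i * γ ^ 3 = 1)
    {h : ℤ√d} {m : ℤ} (hm : m ≠ 0) (hcop : IsCoprime h.re h.im) (hnorm : h.norm = m ^ 3) :
    ∃ (i : ℕ) (β : ℤ√d), h = θ ^ i * β ^ 3 := by
  obtain ⟨β, κ, hβ, j, hj, hκ⟩ := exists_cube_eq_mul_of_norm_eq_cube hJ hm hcop hnorm
  obtain ⟨i, γ, h1⟩ := hJ' κ j hj hκ
  exact ⟨i, γ * β, by linear_combination (-h) * h1 - θ ^ i * γ ^ 3 * hβ⟩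

theorem Pell.IsFundamental.exists_mul_pow_mul_cube_eq_one {d : ℤ} {a : Pell.Solution₁ d}
    (ha : Pell.IsFundamental a) {κ : ℤ√d} (hκ : κ.norm = 1) :
    ∃ (i : ℕ) (γ : ℤ√d), κ * (a : ℤ√d) ^ i * γ ^ 3 = 1 := by
  obtain ⟨i, γ, h⟩ := ha.exists_eq_pow_mul_cube ((Zsqrtd.norm_conj κ).trans hκ)
  refine ⟨i, γ, ?_⟩
  rw [mul_assoc, ← h, ← Zsqrtd.norm_eq_mul_conj, hκ, Int.cast_one]

theorem Zsqrtd.exists_eq_mul_cube_two {h : ℤ√2} {m : ℤ} (hm : m ≠ 0)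
    (hcop : IsCoprime h.re h.im) (hnorm : h.norm = m ^ 3) :
    ∃ (i : ℕ) (β : ℤ√2), h = ⟨3, 2⟩ ^ i * β ^ 3 := by
  refine exists_eq_mul_cube_of_norm_eq_cube exists_norm_two ?_ hm hcop hnorm
  rintro κ j (rfl | rfl) hκ
  · exact isFundamental_two.exists_mul_pow_mul_cube_eq_one (by simpa using hκ)
  · set ε : ℤ√2 := ⟨1, 1⟩ with hε
    have h1 : (κ * ε ^ 3).norm = 1 := by
      rw [Zsqrtd.norm_mul, hκ]; rfl
    obtain ⟨i, γ, h⟩ := isFundamental_two.exists_mul_pow_mul_cube_eq_one h1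
    refine ⟨i, ε * γ, ?_⟩
    rw [← h, Pell.Solution₁.coe_mk]
    ring

theorem Zsqrtd.norm_ne_neg_one {d : ℤ} (hd : 3 ∣ d) (κ : ℤ√d) : κ.norm ≠ -1 := by
  obtain ⟨e, rfl⟩ := hd
  intro h
  rw [Zsqrtd.norm_def] at h
  have h1 : κ.re * κ.re % 3 = 2 := by
    rw [show κ.re * κ.re = -1 + 3 * (e * κ.im * κ.im) by linarith]
    omega
  rw [Int.mul_emod] at h1
  have : κ.re % 3 = 0 ∨ κ.re % 3 = 1 ∨ κ.re % 3 = 2 := by omega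
  rcases this with h | h | h <;> simp [h] at h1

theorem Zsqrtd.exists_eq_mul_cube_three {h : ℤ√3} {m : ℤ} (hm : m ≠ 0)
    (hcop : IsCoprime h.re h.im) (hnorm : h.norm = m ^ 3) :
    ∃ (i : ℕ) (β : ℤ√3), h = ⟨2, 1⟩ ^ i * β ^ 3 := by
  refine exists_eq_mul_cube_of_norm_eq_cube exists_norm_three ?_ hm hcop hnorm
  rintro κ j (rfl | rfl) hκ
  · exact isFundamental_three.exists_mul_pow_mul_cube_eq_one (by simpa using hκ)
  · exact absurd hκ (Zsqrtd.norm_ne_neg_one (by norm_num) κ)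

theorem Zsqrtd.exists_eq_mul_cube_six {h : ℤ√6} {m : ℤ} (hm : m ≠ 0)
    (hcop : IsCoprime h.re h.im) (hnorm : h.norm = m ^ 3) :
    ∃ (i : ℕ) (β : ℤ√6), h = ⟨5, 2⟩ ^ i * β ^ 3 := by
  refine exists_eq_mul_cube_of_norm_eq_cube exists_norm_six ?_ hm hcop hnorm
  rintro κ j (rfl | rfl) hκ
  · exact isFundamental_six.exists_mul_pow_mul_cube_eq_one (by simpa using hκ)
  · exact absurd hκ (Zsqrtd.norm_ne_neg_one (by norm_num) κ)

theorem Zsqrtd.exists_eq_cube_neg_one {h : ℤ√(-1)} {m : ℤ} (hm : m ≠ 0)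
    (hcop : IsCoprime h.re h.im) (hnorm : h.norm = m ^ 3) :
    ∃ (i : ℕ) (β : ℤ√(-1)), h = 1 ^ i * β ^ 3 := by
  refine exists_eq_mul_cube_of_norm_eq_cube exists_norm_neg_one ?_ hm hcop hnorm
  rintro κ j (rfl | rfl) hκ
  · refine ⟨0, κ, ?_⟩
    obtain ⟨x, y⟩ := κ
    simp only [Zsqrtd.norm_def] at hκ
    have hx : -1 ≤ x ∧ x ≤ 1 := by constructor <;> nlinarith [mul_self_nonneg x, mul_self_nonneg y]
    have hy : -1 ≤ y ∧ y ≤ 1 := by constructor <;> nlinarith [mul_self_nonneg x, mul_self_nonneg y]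
    obtain ⟨h1, h2⟩ := hx
    obtain ⟨h3, h4⟩ := hy
    interval_cases x <;> interval_cases y <;> first | rfl | norm_num at hκ
  · have := Zsqrtd.norm_nonneg (by norm_num) κ
    norm_num [hκ] at this

theorem Zsqrtd.exists_eq_cube_neg_six {h : ℤ√(-6)} {m : ℤ} (hm : m ≠ 0)
    (hcop : IsCoprime h.re h.im) (hnorm : h.norm = m ^ 3) :
    ∃ (i : ℕ) (β : ℤ√(-6)), h = 1 ^ i * β ^ 3 := by
  refine exists_eq_mul_cube_of_norm_eq_cube exists_norm_neg_six ?_ hm hcop hnorm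
  intro κ j hj hκ
  refine ⟨0, κ, ?_⟩
  have hnn := Zsqrtd.norm_nonneg (by norm_num) κ
  obtain ⟨x, y⟩ := κ
  simp only [Zsqrtd.norm_def] at hκ hnn
  have hj3 : j ^ 3 ≤ 8 := by rcases hj with rfl | rfl | rfl | rfl <;> norm_num
  have hx : -3 < x ∧ x < 3 := by constructor <;> nlinarith [mul_self_nonneg x, mul_self_nonneg y]
  have hy : -2 < y ∧ y < 2 := by constructor <;> nlinarith [mul_self_nonneg x, mul_self_nonneg y]
  obtain ⟨h1, h2⟩ := hx
  obtain ⟨h3, h4⟩ := hy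
  rcases hj with rfl | rfl | rfl | rfl <;> interval_cases x <;> interval_cases y <;>
    first | rfl | norm_num at hκ

theorem Nat.exists_eq_pow_of_dvd_padicValNat {n k : ℕ} (hn : n ≠ 0)
    (h : ∀ p : ℕ, p.Prime → k ∣ padicValNat p n) : ∃ c, n = c ^ k := by
  refine ⟨n.factorization.prod fun p e => p ^ (e / k), ?_⟩
  conv_lhs => rw [← Nat.prod_factorization_pow_eq_self hn]
  rw [Finsupp.prod, Finsupp.prod, ← Finset.prod_pow]
  refine Finset.prod_congr rfl fun p hp => ?_
  rw [← pow_mul, Nat.div_mul_cancel]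
  rw [Nat.factorization_def _ (Nat.prime_of_mem_primeFactors hp)]
  exact h p (Nat.prime_of_mem_primeFactors hp)

theorem Rat.exists_eq_cube_of_dvd_padicValRat {q : ℚ} (hq : q ≠ 0)
    (h : ∀ p : ℕ, p.Prime → (3 : ℤ) ∣ padicValRat p q) : ∃ c, q = c ^ 3 := by
  have hd : (q.den : ℚ) ≠ 0 := by exact_mod_cast q.den_ne_zero
  have hM : q * (q.den : ℚ) ^ 3 = ((q.num * q.den ^ 2 : ℤ) : ℚ) := by
    push_cast
    nth_rewrite 1 [← Rat.num_div_den q]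
    field_simp
  have hM0 : q.num * q.den ^ 2 ≠ 0 := by simp [hq]
  obtain ⟨c, hc⟩ := Nat.exists_eq_pow_of_dvd_padicValNat (n := (q.num * q.den ^ 2).natAbs) (k := 3)
    (by simpa using hM0) fun p hp => by
      have := Fact.mk hp
      have h1 : padicValRat p (q * (q.den : ℚ) ^ 3) = padicValRat p q + 3 * padicValRat p q.den := by
        rw [padicValRat.mul hq (pow_ne_zero _ hd), padicValRat.pow]; norm_num
      rw [hM, padicValRat.of_int, padicValInt] at h1
      have := h p hp
      omega
  have hc' : ∃ C : ℤ, q.num * q.den ^ 2 = C ^ 3 := by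
    rcases Int.natAbs_eq (q.num * q.den ^ 2) with h | h
    · exact ⟨c, by rw [h, hc]; push_cast; rfl⟩
    · exact ⟨-c, by rw [h, hc]; push_cast; ring⟩
  obtain ⟨C, hC⟩ := hc'
  refine ⟨C / q.den, ?_⟩
  rw [div_pow, eq_div_iff (pow_ne_zero _ hd), hM, hC]
  push_cast; rfl

theorem Rat.exists_int_of_cube_eq_int {q : ℚ} {n : ℤ} (h : q ^ 3 = n) : ∃ m : ℤ, q = m := by
  have h1 := congrArg Rat.den h
  rw [Rat.den_pow, Rat.den_intCast] at h1
  exact ⟨q.num, (Rat.coe_int_num_of_den_eq_one (by simpa using h1)).symm⟩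

theorem Rat.exists_eq_mul_isCoprime (a b : ℚ) (h : a ≠ 0 ∨ b ≠ 0) :
    ∃ (q : ℚ) (r s : ℤ), q ≠ 0 ∧ IsCoprime r s ∧ a = q * r ∧ b = q * s := by
  set A : ℤ := a.num * b.den
  set B : ℤ := b.num * a.den
  have ha : (a.den : ℚ) ≠ 0 := by exact_mod_cast a.den_ne_zero
  have hb : (b.den : ℚ) ≠ 0 := by exact_mod_cast b.den_ne_zero
  have hA : a = A / (a.den * b.den) := by
    simp only [A]; push_cast; nth_rewrite 1 [← Rat.num_div_den a]; field_simp
  have hB : b = B / (a.den * b.den) := by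
    simp only [B]; push_cast; nth_rewrite 1 [← Rat.num_div_den b]; field_simp
  have hAB : 0 < A.gcd B := by
    rw [Int.gcd_pos_iff]
    rcases h with h | h
    · left; intro h0; rw [h0] at hA; simp at hA; exact h hA
    · right; intro h0; rw [h0] at hB; simp at hB; exact h hB
  obtain ⟨r, s, hrs, hr, hs⟩ := Int.exists_gcd_one hAB
  have hg : ((A.gcd B : ℕ) : ℚ) ≠ 0 := by exact_mod_cast hAB.ne'
  refine ⟨A.gcd B / (a.den * b.den), r, s, by positivity, Int.isCoprime_iff_gcd_eq_one.2 hrs, ?_, ?_⟩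
  · refine hA.trans ?_
    rw [show (A : ℚ) = r * (A.gcd B : ℕ) by exact_mod_cast hr]; ring
  · refine hB.trans ?_
    rw [show (B : ℚ) = s * (A.gcd B : ℕ) by exact_mod_cast hs]; ring

theorem PadicAlgCl.norm_ratCast (p : ℕ) [Fact p.Prime] (q : ℚ) :
    ‖(q : PadicAlgCl p)‖ = padicNorm p q := by
  rw [← Padic.eq_padicNorm, ← PadicAlgCl.norm_extends]
  simp

theorem PadicAlgCl.norm_ratCast_eq_zpow (p : ℕ) [Fact p.Prime] {q : ℚ} (hq : q ≠ 0) :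
    ‖(q : PadicAlgCl p)‖ = (p : ℝ) ^ (-padicValRat p q) := by
  rw [PadicAlgCl.norm_ratCast, padicNorm.eq_zpow_of_nonzero hq]
  push_cast; rfl

theorem PadicAlgCl.norm_intCast_le_one (p : ℕ) [Fact p.Prime] (n : ℤ) :
    ‖(n : PadicAlgCl p)‖ ≤ 1 := by
  have := PadicAlgCl.norm_ratCast p n
  rw [Rat.cast_intCast] at this
  rw [this]
  exact_mod_cast padicNorm.of_int n

theorem PadicAlgCl.norm_intCast_lt_one_iff (p : ℕ) [Fact p.Prime] (n : ℤ) :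
    ‖(n : PadicAlgCl p)‖ < 1 ↔ (p : ℤ) ∣ n := by
  have := PadicAlgCl.norm_ratCast p n
  rw [Rat.cast_intCast] at this
  rw [this, ← padicNorm.int_lt_one_iff]
  exact_mod_cast Iff.rfl

theorem PadicAlgCl.norm_sq_eq_zpow (p : ℕ) [Fact p.Prime] {z w : PadicAlgCl p} {n t : ℚ}
    (hz : z ≠ 0) (hw : w ≠ 0) (hn : z * w = n) (ht : z + w = t) :
    ∃ k : ℤ, ‖z‖ ^ 2 = (p : ℝ) ^ k := by
  have hp : (p : ℝ) ≠ 0 := by exact_mod_cast (Fact.out : p.Prime).ne_zero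
  have hn0 : n ≠ 0 := by
    rintro rfl
    exact mul_ne_zero hz hw (by simpa using hn)
  have hN := congrArg norm hn
  rw [norm_mul, norm_ratCast_eq_zpow p hn0] at hN
  by_cases heq : ‖z‖ = ‖w‖
  · exact ⟨_, by rw [← hN, ← heq, pow_two]⟩
  have hT := IsUltrametricDist.norm_add_eq_max_of_norm_ne_norm heq
  have ht0 : t ≠ 0 := by
    rintro rfl
    rw [ht, Rat.cast_zero, norm_zero] at hT
    exact hz (norm_le_zero_iff.1 (hT ▸ le_max_left _ _))
  rw [ht, norm_ratCast_eq_zpow p ht0] at hT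
  rcases max_choice ‖z‖ ‖w‖ with h | h <;> rw [h] at hT
  · exact ⟨-padicValRat p t * 2, by rw [← hT, zpow_mul]; rfl⟩
  · refine ⟨(-padicValRat p n - -padicValRat p t) * 2, ?_⟩
    rw [zpow_mul, zpow_sub₀ hp, hT, ← hN, mul_div_cancel_right₀ _ (norm_ne_zero_iff.2 hw)]
    rfl

theorem exists_eq_mul_cube_of_even {d : ℤ} {θ : ℤ√d} (hd : d ∣ 6)
    (hprim : ∀ (h : ℤ√d) (m : ℤ), m ≠ 0 → IsCoprime h.re h.im → h.norm = m ^ 3 →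
      ∃ (i : ℕ) (β : ℤ√d), h = θ ^ i * β ^ 3)
    (hloc : ∀ r s : ℤ, IsCoprime r s → ¬4 ∣ r ^ 2 - d * s ^ 2 ∧ ¬9 ∣ r ^ 2 - d * s ^ 2)
    {a b n : ℚ} (hn : a ^ 2 - d * b ^ 2 = n ^ 3) (hn0 : n ≠ 0)
    (h2 : Even (padicValRat 2 n)) (h3 : Even (padicValRat 3 n))
    (hnorm : ∀ (ℓ : ℕ) [Fact ℓ.Prime], 5 ≤ ℓ → ∀ ρ : PadicAlgCl ℓ, ρ ^ 2 = d →
      ∃ k : ℤ, ‖(a : PadicAlgCl ℓ) + b * ρ‖ ^ 4 = (ℓ : ℝ) ^ (3 * k)) :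
    ∃ (c : ℚ) (i : ℕ) (β : ℤ√d), a = c ^ 3 * (θ ^ i * β ^ 3).re ∧ b = c ^ 3 * (θ ^ i * β ^ 3).im := by
  obtain ⟨q, r, s, hq0, hrs, ha, hb⟩ := Rat.exists_eq_mul_isCoprime a b (by
    by_contra! h
    apply pow_ne_zero 3 hn0
    rw [← hn, h.1, h.2]; ring)
  set N : ℤ := r ^ 2 - d * s ^ 2 with hN
  have hqN : q ^ 2 * N = n ^ 3 := by
    rw [← hn, ha, hb, hN]; push_cast; ring
  have hN0 : (N : ℚ) ≠ 0 := by
    rintro h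
    apply pow_ne_zero 3 hn0
    rw [← hqN, h, mul_zero]
  have hval : ∀ p : ℕ, p.Prime → 2 * padicValRat p q + padicValInt p N = 3 * padicValRat p n := by
    intro p hp
    have := Fact.mk hp
    have := congrArg (padicValRat p) hqN
    rw [padicValRat.mul (pow_ne_zero _ hq0) hN0, padicValRat.pow, padicValRat.pow,
      padicValRat.of_int] at this
    exact_mod_cast this
  have hsmall : ∀ p : ℕ, p.Prime → ¬((p ^ 2 : ℕ) : ℤ) ∣ N → Even (padicValRat p n) →
      (3 : ℤ) ∣ padicValRat p q := by
    intro p hp hdvd heven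
    have := Fact.mk hp
    have h1 := hval p hp
    have h2 : padicValInt p N < 2 := by
      by_contra! hle
      exact hdvd (by
        push_cast
        exact (pow_dvd_pow _ hle).trans (padicValInt_dvd N))
    obtain ⟨e, he⟩ := heven
    omega
  obtain ⟨c, rfl⟩ := Rat.exists_eq_cube_of_dvd_padicValRat hq0 fun p hp => by
    by_cases hp2 : p = 2
    · subst hp2; exact hsmall 2 hp (hloc r s hrs).1 h2
    by_cases hp3 : p = 3
    · subst hp3; exact hsmall 3 hp (hloc r s hrs).2 h3
    have hp5 : 5 ≤ p := by
      have := hp.two_le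
      have : p ≠ 4 := by rintro rfl; norm_num at hp
      omega
    have := Fact.mk hp
    have hp1 : (1 : ℝ) < p := by exact_mod_cast hp.one_lt
    suffices H : ∃ ρ : PadicAlgCl p, ρ ^ 2 = d ∧ ‖(r : PadicAlgCl p) + s * ρ‖ = 1 by
      obtain ⟨ρ, hρ, h1⟩ := H
      obtain ⟨k, hk⟩ := hnorm p hp5 ρ hρ
      have : (a : PadicAlgCl p) + b * ρ = q * (r + s * ρ) := by
        rw [ha, hb]; push_cast; ring
      rw [this, norm_mul, h1, mul_one, PadicAlgCl.norm_ratCast_eq_zpow p hq0, ← zpow_natCast,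
        ← zpow_mul] at hk
      have := zpow_right_injective₀ (by positivity) hp1.ne' hk
      push_cast at this
      omega
    obtain ⟨ρ, hρ⟩ := IsAlgClosed.exists_pow_nat_eq (d : PadicAlgCl p) (n := 2) (by norm_num)
    have hρ1 : ‖ρ‖ ≤ 1 := by
      rw [← pow_le_one_iff_of_nonneg (norm_nonneg _) two_ne_zero, ← norm_pow, hρ]
      exact PadicAlgCl.norm_intCast_le_one p d
    by_contra! hne
    have hle : ∀ σ : PadicAlgCl p, ‖σ‖ ≤ 1 → ‖(r : PadicAlgCl p) + s * σ‖ ≤ 1 := by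
      intro σ hσ
      refine (IsUltrametricDist.norm_add_le_max _ _).trans (max_le ?_ ?_)
      · exact PadicAlgCl.norm_intCast_le_one p r
      · rw [norm_mul]
        exact mul_le_one₀ (PadicAlgCl.norm_intCast_le_one p s) (norm_nonneg _) hσ
    have h1 := lt_of_le_of_ne (hle ρ hρ1) (hne ρ hρ)
    have h2 := lt_of_le_of_ne (hle (-ρ) (by rwa [norm_neg])) (hne (-ρ) (by rw [neg_sq, hρ]))
    have h2r : ‖((2 * r : ℤ) : PadicAlgCl p)‖ < 1 := by
      rw [show ((2 * r : ℤ) : PadicAlgCl p) = (r + s * ρ) + (r + s * -ρ) by push_cast; ring]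
      exact (IsUltrametricDist.norm_add_le_max _ _).trans_lt (max_lt h1 h2)
    have h2s : ‖((4 * d * s ^ 2 : ℤ) : PadicAlgCl p)‖ < 1 := by
      rw [show ((4 * d * s ^ 2 : ℤ) : PadicAlgCl p) = ((r + s * ρ) - (r + s * -ρ)) ^ 2 by
        push_cast; rw [← hρ]; ring, norm_pow]
      refine pow_lt_one₀ (norm_nonneg _) ?_ two_ne_zero
      rw [sub_eq_add_neg]
      exact (IsUltrametricDist.norm_add_le_max _ _).trans_lt (max_lt h1 (by rwa [norm_neg]))
    rw [PadicAlgCl.norm_intCast_lt_one_iff] at h2r h2s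
    have hpZ : Prime (p : ℤ) := Nat.prime_iff_prime_int.1 hp
    have hp24 : ¬(p : ℤ) ∣ 24 := by
      intro h
      rw [show (24 : ℤ) = 2 ^ 3 * 3 by norm_num] at h
      rcases hpZ.dvd_or_dvd h with h | h
      · have := Int.le_of_dvd (by norm_num) (hpZ.dvd_of_dvd_pow h)
        omega
      · have := Int.le_of_dvd (by norm_num) h
        omega
    have hpr : (p : ℤ) ∣ r := (hpZ.dvd_or_dvd h2r).resolve_left fun h =>
      hp24 (h.trans (by norm_num))
    have hps : (p : ℤ) ∣ s := by
      have : (p : ℤ) ∣ 24 * s ^ 2 :=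
        h2s.trans (mul_dvd_mul_right (mul_dvd_mul_left 4 hd) (s ^ 2))
      exact hpZ.dvd_of_dvd_pow ((hpZ.dvd_or_dvd this).resolve_left hp24)
    exact hpZ.not_isUnit (hrs.isUnit_of_dvd' hpr hps)
  have hc : c ≠ 0 := by rintro rfl; simp at hq0
  have hmN : (n / c ^ 2) ^ 3 = N := by rw [div_pow, ← hqN]; field_simp
  obtain ⟨m, hm⟩ := Rat.exists_int_of_cube_eq_int hmN
  obtain ⟨i, β, h⟩ := hprim ⟨r, s⟩ m
    (by rintro rfl; apply div_ne_zero hn0 (pow_ne_zero 2 hc); rw [hm]; simp) hrs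
    (by
      rw [hm] at hmN
      rw [Zsqrtd.norm_def]
      have : m ^ 3 = N := by exact_mod_cast hmN
      rw [this, hN]; ring)
  exact ⟨c, i, β, by rw [ha, ← h], by rw [hb, ← h]⟩

/-- An element `a + b√d` of `ℚ(√d)` whose norm is a nonzero cube and whose valuations away from `6`
are all divisible by `3` is a cube up to a power of the unit `θ`. -/
theorem exists_eq_pow_mul_cube {d : ℤ} {θ : ℤ√d} (hd : d ∣ 6)
    (hprim : ∀ (h : ℤ√d) (m : ℤ), m ≠ 0 → IsCoprime h.re h.im → h.norm = m ^ 3 →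
      ∃ (i : ℕ) (β : ℤ√d), h = θ ^ i * β ^ 3)
    (hloc : ∀ r s : ℤ, IsCoprime r s → ¬4 ∣ r ^ 2 - d * s ^ 2 ∧ ¬9 ∣ r ^ 2 - d * s ^ 2)
    (hpar : ∀ r s : ℤ, IsCoprime r s → r ^ 2 - d * s ^ 2 ≠ 0 → ∃ e : ℤ√d, e.norm ≠ 0 ∧
      Even (padicValInt 2 (r ^ 2 - d * s ^ 2) + padicValInt 2 e.norm) ∧
      Even (padicValInt 3 (r ^ 2 - d * s ^ 2) + padicValInt 3 e.norm))
    {K : Type} [Field K] [CharZero K] {ρ : K} (hρ : ρ ^ 2 = d)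
    {a b n : ℚ} (hn : a ^ 2 - d * b ^ 2 = n ^ 3) (hn0 : n ≠ 0)
    (hnorm : ∀ (ℓ : ℕ) [Fact ℓ.Prime], 5 ≤ ℓ → ∀ ρ : PadicAlgCl ℓ, ρ ^ 2 = d →
      ∃ k : ℤ, ‖(a : PadicAlgCl ℓ) + b * ρ‖ ^ 4 = (ℓ : ℝ) ^ (3 * k)) :
    ∃ (i : ℕ) (z w : ℚ), a + b * ρ = (θ.re + θ.im * ρ) ^ i * (z + w * ρ) ^ 3 := by
  obtain ⟨q, r, s, hq0, hrs, ha, hb⟩ := Rat.exists_eq_mul_isCoprime a b (by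
    by_contra! h
    apply pow_ne_zero 3 hn0
    rw [← hn, h.1, h.2]; ring)
  have hqN : q ^ 2 * (r ^ 2 - d * s ^ 2 : ℤ) = n ^ 3 := by
    rw [← hn, ha, hb]; push_cast; ring
  have hN0 : r ^ 2 - d * s ^ 2 ≠ 0 := by
    intro h
    apply pow_ne_zero 3 hn0
    rw [← hqN, h, Int.cast_zero, mul_zero]
  obtain ⟨e, he0, he2, he3⟩ := hpar r s hrs hN0
  have heQ : (e.norm : ℚ) ≠ 0 := by exact_mod_cast he0
  have hval : ∀ p : ℕ, p.Prime →
      Even (padicValInt p (r ^ 2 - d * s ^ 2) + padicValInt p e.norm) →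
      Even (padicValRat p (n * e.norm)) := by
    intro p hp heven
    have := Fact.mk hp
    have := congrArg (padicValRat p) hqN
    rw [padicValRat.mul (pow_ne_zero _ hq0) (by exact_mod_cast hN0), padicValRat.pow,
      padicValRat.pow, padicValRat.of_int] at this
    rw [padicValRat.mul hn0 heQ, padicValRat.of_int, Int.even_iff]
    rw [Nat.even_iff] at heven
    push_cast at this
    omega
  set E := e ^ 3 with hE
  have lift_apply : ∀ {R : Type _} [Field R] (σ : R) (hσ : σ ^ 2 = d) (x : ℤ√d),
      Zsqrtd.lift ⟨σ, by rw [← pow_two, hσ]⟩ x = x.re + x.im * σ := fun σ hσ x => rfl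
  have hmul : ∀ {R : Type _} [Field R] [CharZero R] (σ : R), σ ^ 2 = d →
      ((a * E.re + d * b * E.im : ℚ) : R) + (a * E.im + b * E.re : ℚ) * σ =
        (a + b * σ) * (e.re + e.im * σ) ^ 3 := by
    intro R _ _ σ hσ
    rw [← lift_apply σ hσ, ← map_pow, ← hE, lift_apply σ hσ]
    push_cast
    linear_combination (-(b : R) * E.im) * hσ
  obtain ⟨c, i, β, h1, h2⟩ := exists_eq_mul_cube_of_even (a := a * E.re + d * b * E.im)
    (b := a * E.im + b * E.re) (n := n * e.norm) hd hprim hloc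
    (by
      have : (E.norm : ℚ) = (e.norm : ℚ) ^ 3 := by
        rw [hE, pow_succ, pow_two, Zsqrtd.norm_mul, Zsqrtd.norm_mul]; push_cast; ring
      rw [mul_pow, ← hn, ← this, Zsqrtd.norm_def]; push_cast; ring)
    (mul_ne_zero hn0 heQ) (hval 2 Nat.prime_two he2) (hval 3 Nat.prime_three he3)
    (by
      intro ℓ _ hℓ σ hσ
      obtain ⟨k, hk⟩ := hnorm ℓ hℓ σ hσ
      have hprod : ((e.re : PadicAlgCl ℓ) + e.im * σ) * (e.re - e.im * σ) = (e.norm : ℚ) := by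
        rw [Zsqrtd.norm_def]; push_cast; linear_combination (-(e.im : PadicAlgCl ℓ) ^ 2) * hσ
      have hne := hprod.trans_ne (by exact_mod_cast he0 : ((e.norm : ℚ) : PadicAlgCl ℓ) ≠ 0)
      obtain ⟨k', hk'⟩ := PadicAlgCl.norm_sq_eq_zpow ℓ (t := 2 * e.re)
        (left_ne_zero_of_mul hne) (right_ne_zero_of_mul hne) hprod (by push_cast; ring)
      refine ⟨k + 2 * k', ?_⟩
      have hℓ0 : (ℓ : ℝ) ≠ 0 := by positivity
      rw [hmul σ hσ, norm_mul, mul_pow, hk, norm_pow, ← pow_mul,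
        show 3 * 4 = 2 * 6 by norm_num, pow_mul, hk', ← zpow_natCast, ← zpow_mul,
        ← zpow_add₀ hℓ0]
      congr 1
      push_cast; ring)
  have key := hmul ρ hρ
  rw [h1, h2] at key
  set φ := Zsqrtd.lift (⟨ρ, by rw [← pow_two, hρ]⟩ : {r : K // r * r = ↑d}) with hφ
  have hφa : ∀ x : ℤ√d, φ x = x.re + x.im * ρ := lift_apply ρ hρ
  have hee : φ e * φ (star e) = (e.norm : K) := by
    rw [← map_mul, ← Zsqrtd.norm_eq_mul_conj, map_intCast]
  have heK : (e.norm : K) ≠ 0 := by exact_mod_cast he0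
  refine ⟨i, c / e.norm * (β * star e).re, c / e.norm * (β * star e).im, ?_⟩
  have hzw : ((c / e.norm * (β * star e).re : ℚ) : K) + (c / e.norm * (β * star e).im : ℚ) * ρ =
      c / e.norm * (φ β * φ (star e)) := by
    rw [← map_mul, hφa]; push_cast; ring
  have key2 : (c : K) ^ 3 * (φ θ ^ i * φ β ^ 3) = (a + b * ρ) * φ e ^ 3 := by
    rw [hφa e, ← key, ← map_pow, ← map_pow, ← map_mul, hφa]; push_cast; ring
  rw [hzw, ← hφa θ, mul_pow, div_pow, mul_pow]
  field_simp
  rw [← hee]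
  linear_combination (-φ (star e) ^ 3) * key2

theorem IsCoprime.not_sq_dvd_sub {p d r s : ℤ} (hp : Prime p) (hrs : IsCoprime r s)
    (h : p ^ 2 ∣ r ^ 2 - d * s ^ 2 → p ^ 2 ∣ p * r ∧ p ^ 2 ∣ p * s) : ¬p ^ 2 ∣ r ^ 2 - d * s ^ 2 := by
  intro hdvd
  obtain ⟨hr, hs⟩ := h hdvd
  rw [pow_two, mul_dvd_mul_iff_left hp.ne_zero] at hr hs
  exact hp.not_isUnit (hrs.isUnit_of_dvd' hr hs)

theorem IsCoprime.not_dvd_norm {d r s : ℤ} (hrs : IsCoprime r s)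
    (h4 : ∀ r s : ZMod 4, r ^ 2 - d * s ^ 2 = 0 → 2 * r = 0 ∧ 2 * s = 0)
    (h9 : ∀ r s : ZMod 9, r ^ 2 - d * s ^ 2 = 0 → 3 * r = 0 ∧ 3 * s = 0) :
    ¬4 ∣ r ^ 2 - d * s ^ 2 ∧ ¬9 ∣ r ^ 2 - d * s ^ 2 := by
  constructor
  · refine IsCoprime.not_sq_dvd_sub Int.prime_two hrs fun h => ?_
    have := h4 r s (by exact_mod_cast (ZMod.intCast_zmod_eq_zero_iff_dvd _ 4).2 (by simpa using h))
    exact ⟨(ZMod.intCast_zmod_eq_zero_iff_dvd _ 4).1 (by exact_mod_cast this.1),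
      (ZMod.intCast_zmod_eq_zero_iff_dvd _ 4).1 (by exact_mod_cast this.2)⟩
  · refine IsCoprime.not_sq_dvd_sub Int.prime_three hrs fun h => ?_
    have := h9 r s (by exact_mod_cast (ZMod.intCast_zmod_eq_zero_iff_dvd _ 9).2 (by simpa using h))
    exact ⟨(ZMod.intCast_zmod_eq_zero_iff_dvd _ 9).1 (by exact_mod_cast this.1),
      (ZMod.intCast_zmod_eq_zero_iff_dvd _ 9).1 (by exact_mod_cast this.2)⟩

theorem even_padicValInt_add {p : ℕ} [Fact p.Prime] {m n : ℤ} (hm : ¬(p ^ 2 : ℤ) ∣ m)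
    (hn : ¬(p ^ 2 : ℤ) ∣ n) (h : (p : ℤ) ∣ m ↔ (p : ℤ) ∣ n) :
    Even (padicValInt p m + padicValInt p n) := by
  have hlt : ∀ {k : ℤ}, ¬(p ^ 2 : ℤ) ∣ k → padicValInt p k < 2 := fun {k} hk => by
    by_contra! hle
    exact hk ((pow_dvd_pow _ hle).trans (padicValInt_dvd k))
  have hpos : ∀ {k : ℤ}, ¬(p ^ 2 : ℤ) ∣ k → ((p : ℤ) ∣ k ↔ padicValInt p k ≠ 0) := fun {k} hk => by
    rw [Ne, padicValInt.eq_zero_iff]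
    have : k ≠ 0 := by rintro rfl; exact hk (dvd_zero _)
    have := (Fact.out : p.Prime).ne_one
    tauto
  rw [hpos hm, hpos hn] at h
  have := hlt hm
  have := hlt hn
  rw [Nat.even_iff]
  omega

theorem exists_even_padicValInt {d N : ℤ} (h4 : ¬4 ∣ N) (h9 : ¬9 ∣ N)
    (h : ∃ e : ℤ√d, ¬4 ∣ e.norm ∧ ¬9 ∣ e.norm ∧ (2 ∣ N ↔ 2 ∣ e.norm) ∧ (3 ∣ N ↔ 3 ∣ e.norm)) :
    ∃ e : ℤ√d, e.norm ≠ 0 ∧ Even (padicValInt 2 N + padicValInt 2 e.norm) ∧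
      Even (padicValInt 3 N + padicValInt 3 e.norm) := by
  obtain ⟨e, h4', h9', h2, h3⟩ := h
  exact ⟨e, by intro h; simp [h] at h4', even_padicValInt_add (by simpa) (by simpa) (by simpa),
    even_padicValInt_add (by simpa) (by simpa) (by simpa)⟩

theorem not_three_dvd_of_isCoprime {d r s : ℤ} (hrs : IsCoprime r s)
    (h3 : ∀ r s : ZMod 3, r ^ 2 - d * s ^ 2 = 0 → r = 0 ∧ s = 0) : ¬3 ∣ r ^ 2 - d * s ^ 2 := by
  intro h
  have := h3 r s (by exact_mod_cast (ZMod.intCast_zmod_eq_zero_iff_dvd _ 3).2 (by simpa using h))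
  exact Int.prime_three.not_isUnit (hrs.isUnit_of_dvd'
    ((ZMod.intCast_zmod_eq_zero_iff_dvd _ 3).1 this.1)
    ((ZMod.intCast_zmod_eq_zero_iff_dvd _ 3).1 this.2))

section

variable {K : Type} [Field K] [CharZero K] {ρ : K} {a b n : ℚ}

theorem exists_eq_pow_mul_cube_two (hρ : ρ ^ 2 = (2 : ℤ))
    (hn : a ^ 2 - (2 : ℤ) * b ^ 2 = n ^ 3) (hn0 : n ≠ 0)
    (hnorm : ∀ (ℓ : ℕ) [Fact ℓ.Prime], 5 ≤ ℓ → ∀ ρ : PadicAlgCl ℓ, ρ ^ 2 = (2 : ℤ) →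
      ∃ k : ℤ, ‖(a : PadicAlgCl ℓ) + b * ρ‖ ^ 4 = (ℓ : ℝ) ^ (3 * k)) :
    ∃ (i : ℕ) (z w : ℚ), a + b * ρ = (3 + 2 * ρ) ^ i * (z + w * ρ) ^ 3 := by
  have hloc : ∀ r s : ℤ, IsCoprime r s → ¬4 ∣ r ^ 2 - 2 * s ^ 2 ∧ ¬9 ∣ r ^ 2 - 2 * s ^ 2 :=
    fun r s h => h.not_dvd_norm (by decide) (by decide)
  refine (exists_eq_pow_mul_cube (θ := ⟨3, 2⟩) (by norm_num)
    (fun h m => Zsqrtd.exists_eq_mul_cube_two) hloc (fun r s h h0 => ?_) hρ hn hn0 hnorm).imp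
    fun i hi => by simpa using hi
  refine exists_even_padicValInt (hloc r s h).1 (hloc r s h).2 ?_
  have h3 := not_three_dvd_of_isCoprime h (d := 2) (by decide)
  by_cases h2 : 2 ∣ r ^ 2 - 2 * s ^ 2
  · exact ⟨⟨0, 1⟩, by simp [Zsqrtd.norm_def, h2, h3]⟩
  · exact ⟨1, by simp [h2, h3]⟩

theorem exists_eq_pow_mul_cube_three (hρ : ρ ^ 2 = (3 : ℤ))
    (hn : a ^ 2 - (3 : ℤ) * b ^ 2 = n ^ 3) (hn0 : n ≠ 0)
    (hnorm : ∀ (ℓ : ℕ) [Fact ℓ.Prime], 5 ≤ ℓ → ∀ ρ : PadicAlgCl ℓ, ρ ^ 2 = (3 : ℤ) →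
      ∃ k : ℤ, ‖(a : PadicAlgCl ℓ) + b * ρ‖ ^ 4 = (ℓ : ℝ) ^ (3 * k)) :
    ∃ (i : ℕ) (z w : ℚ), a + b * ρ = (2 + ρ) ^ i * (z + w * ρ) ^ 3 := by
  have hloc : ∀ r s : ℤ, IsCoprime r s → ¬4 ∣ r ^ 2 - 3 * s ^ 2 ∧ ¬9 ∣ r ^ 2 - 3 * s ^ 2 :=
    fun r s h => h.not_dvd_norm (by decide) (by decide)
  refine (exists_eq_pow_mul_cube (θ := ⟨2, 1⟩) (by norm_num)
    (fun h m => Zsqrtd.exists_eq_mul_cube_three) hloc (fun r s h h0 => ?_) hρ hn hn0 hnorm).imp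
    fun i hi => by simpa using hi
  refine exists_even_padicValInt (hloc r s h).1 (hloc r s h).2 ?_
  by_cases h2 : 2 ∣ r ^ 2 - 3 * s ^ 2 <;> by_cases h3 : 3 ∣ r ^ 2 - 3 * s ^ 2
  · exact ⟨⟨3, 1⟩, by simp [Zsqrtd.norm_def, h2, h3]⟩
  · exact ⟨⟨1, 1⟩, by simp [Zsqrtd.norm_def, h2, h3]⟩
  · exact ⟨⟨0, 1⟩, by simp [Zsqrtd.norm_def, h2, h3]⟩
  · exact ⟨1, by simp [h2, h3]⟩

theorem exists_eq_cube_neg_one (hρ : ρ ^ 2 = (-1 : ℤ))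
    (hn : a ^ 2 - (-1 : ℤ) * b ^ 2 = n ^ 3) (hn0 : n ≠ 0)
    (hnorm : ∀ (ℓ : ℕ) [Fact ℓ.Prime], 5 ≤ ℓ → ∀ ρ : PadicAlgCl ℓ, ρ ^ 2 = (-1 : ℤ) →
      ∃ k : ℤ, ‖(a : PadicAlgCl ℓ) + b * ρ‖ ^ 4 = (ℓ : ℝ) ^ (3 * k)) :
    ∃ z w : ℚ, a + b * ρ = (z + w * ρ) ^ 3 := by
  have hloc : ∀ r s : ℤ, IsCoprime r s → ¬4 ∣ r ^ 2 - (-1) * s ^ 2 ∧ ¬9 ∣ r ^ 2 - (-1) * s ^ 2 :=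
    fun r s h => h.not_dvd_norm (by decide) (by decide)
  suffices hpar : _ from (exists_eq_pow_mul_cube (θ := 1) (by norm_num)
    (fun h m => Zsqrtd.exists_eq_cube_neg_one) hloc hpar hρ hn hn0 hnorm).elim
    fun i hi => by simpa using hi
  intro r s h h0
  refine exists_even_padicValInt (hloc r s h).1 (hloc r s h).2 ?_
  have h3 := not_three_dvd_of_isCoprime h (d := -1) (by decide)
  by_cases h2 : 2 ∣ r ^ 2 - (-1) * s ^ 2
  · exact ⟨⟨1, 1⟩, by simp only [h2, h3, Zsqrtd.norm_def]; norm_num⟩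
  · exact ⟨1, by simp only [h2, h3, Zsqrtd.norm_one]; norm_num⟩

theorem exists_eq_cube_neg_six (hρ : ρ ^ 2 = (-6 : ℤ))
    (hn : a ^ 2 - (-6 : ℤ) * b ^ 2 = n ^ 3) (hn0 : n ≠ 0)
    (hnorm : ∀ (ℓ : ℕ) [Fact ℓ.Prime], 5 ≤ ℓ → ∀ ρ : PadicAlgCl ℓ, ρ ^ 2 = (-6 : ℤ) →
      ∃ k : ℤ, ‖(a : PadicAlgCl ℓ) + b * ρ‖ ^ 4 = (ℓ : ℝ) ^ (3 * k)) :
    ∃ z w : ℚ, a + b * ρ = (z + w * ρ) ^ 3 := by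
  have hloc : ∀ r s : ℤ, IsCoprime r s → ¬4 ∣ r ^ 2 - (-6) * s ^ 2 ∧ ¬9 ∣ r ^ 2 - (-6) * s ^ 2 :=
    fun r s h => h.not_dvd_norm (by decide) (by decide)
  suffices hpar : _ from (exists_eq_pow_mul_cube (θ := 1) (by norm_num)
    (fun h m => Zsqrtd.exists_eq_cube_neg_six) hloc hpar hρ hn hn0 hnorm).elim
    fun i hi => by simpa using hi
  intro r s h h0
  refine exists_even_padicValInt (hloc r s h).1 (hloc r s h).2 ?_
  by_cases h2 : 2 ∣ r ^ 2 - (-6) * s ^ 2 <;> by_cases h3 : 3 ∣ r ^ 2 - (-6) * s ^ 2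
  · exact ⟨⟨0, 1⟩, by simp only [h2, h3, Zsqrtd.norm_def]; norm_num⟩
  · exact ⟨⟨2, 1⟩, by simp only [h2, h3, Zsqrtd.norm_def]; norm_num⟩
  · exact ⟨⟨3, 1⟩, by simp only [h2, h3, Zsqrtd.norm_def]; norm_num⟩
  · exact ⟨1, by simp only [h2, h3, Zsqrtd.norm_one]; norm_num⟩

end

theorem Rat.sq_ne_intCast {d : ℤ} (n : ℤ) (hn : 0 ≤ n) (h : n * n < d)
    (h' : d < (n + 1) * (n + 1)) (r : ℚ) : r ^ 2 ≠ d := fun hr =>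
  Int.not_isSquare_of_lt_of_lt hn h h' (Rat.isSquare_intCast_iff.1 ⟨r, by rw [← hr, pow_two]⟩)

namespace QuadraticAlgebra

variable {K : Type*} [Field K] {a b : K} [Fact (∀ r, r ^ 2 ≠ a + b * r)]

@[simp]
theorem re_ofNat_field (n : ℕ) [n.AtLeastTwo] :
    (ofNat(n) : QuadraticAlgebra K a b).re = ofNat(n) := rfl

@[simp]
theorem im_ofNat_field (n : ℕ) [n.AtLeastTwo] :
    (ofNat(n) : QuadraticAlgebra K a b).im = 0 := rfl

end QuadraticAlgebra

instance fact_sq_ne_six : Fact (∀ r : ℚ, r ^ 2 ≠ 6 + 0 * r) :=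
  ⟨fun r => by simpa using Rat.sq_ne_intCast (d := 6) 2 (by norm_num) (by norm_num) (by norm_num) r⟩

/-- The real quadratic field `ℚ(√6)`. -/
abbrev RatSqrtSix : Type := QuadraticAlgebra ℚ 6 0

namespace RatSqrtSix

/-- The square root of `6` in `ℚ(√6)`. -/
def sqrtSix : RatSqrtSix := ⟨0, 1⟩

theorem sqrtSix_sq : sqrtSix ^ 2 = 6 := by
  ext <;> simp [sqrtSix, pow_two]

theorem eq_add_mul_sqrtSix (x : RatSqrtSix) : x = x.re + x.im * sqrtSix := by
  ext <;> simp [sqrtSix]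

instance : CharZero RatSqrtSix :=
  charZero_of_injective_algebraMap (algebraMap ℚ RatSqrtSix).injective

theorem sq_ne_of_forall_rat {d : ℚ} (h1 : ∀ r : ℚ, r ^ 2 ≠ d) (h2 : ∀ r : ℚ, 6 * r ^ 2 ≠ d)
    (x : RatSqrtSix) : x ^ 2 ≠ d := by
  intro h
  have hre := congrArg QuadraticAlgebra.re h
  have him := congrArg QuadraticAlgebra.im h
  simp only [pow_two, QuadraticAlgebra.re_mul, QuadraticAlgebra.im_mul, zero_mul, add_zero,
    QuadraticAlgebra.re_ratCast, QuadraticAlgebra.im_ratCast, Rat.cast_id] at hre him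
  have : x.re * x.im = 0 := by linarith
  rcases mul_eq_zero.1 this with h0 | h0
  · exact h2 x.im (by rw [← hre, h0]; ring)
  · exact h1 x.re (by rw [← hre, h0]; ring)

instance fact_sq_ne_two : Fact (∀ r : RatSqrtSix, r ^ 2 ≠ 2 + 0 * r) := by
  refine ⟨fun r => ?_⟩
  have := sq_ne_of_forall_rat (d := 2)
    (by simpa using Rat.sq_ne_intCast (d := 2) 1 (by norm_num) (by norm_num) (by norm_num))
    (fun r h => Rat.sq_ne_intCast (d := 12) 3 (by norm_num) (by norm_num) (by norm_num) (6 * r)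
      (by push_cast; linear_combination 6 * h)) r
  simpa using this

instance fact_sq_ne_neg_six : Fact (∀ r : RatSqrtSix, r ^ 2 ≠ -6 + 0 * r) := by
  refine ⟨fun r => ?_⟩
  have := sq_ne_of_forall_rat (d := -6) (fun r => by nlinarith [sq_nonneg r])
    (fun r => by nlinarith [sq_nonneg r]) r
  simpa using this

/-- The norm from `ℚ(√6)` to `ℚ`. -/
def nrm (x : RatSqrtSix) : ℚ := x.re ^ 2 - 6 * x.im ^ 2

theorem nrm_mul (x y : RatSqrtSix) : nrm (x * y) = nrm x * nrm y := by
  simp only [nrm, QuadraticAlgebra.re_mul, QuadraticAlgebra.im_mul]; ring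

theorem nrm_pow (x : RatSqrtSix) (n : ℕ) : nrm (x ^ n) = nrm x ^ n := by
  induction n with
  | zero =>
    rw [pow_zero, pow_zero]
    exact (by norm_num : (1 : ℚ) ^ 2 - 6 * 0 ^ 2 = 1)
  | succ n ih => rw [pow_succ, nrm_mul, ih, pow_succ]

theorem nrm_ne_zero {x : RatSqrtSix} (hx : x ≠ 0) : nrm x ≠ 0 := by
  have := mt QuadraticAlgebra.norm_eq_zero_iff_eq_zero.1 hx
  contrapose! this
  rw [nrm] at this
  rw [QuadraticAlgebra.norm_def]; linear_combination this

/-- The embedding of `ℚ(√6)` determined by a square root of `6`. -/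
noncomputable def embed {L : Type*} [Field L] [CharZero L] {σ : L} (hσ : σ ^ 2 = 6) :
    RatSqrtSix →+* L :=
  (QuadraticAlgebra.lift ⟨σ, by
    rw [← pow_two, hσ, zero_smul, add_zero, Algebra.smul_def, mul_one, map_ofNat]⟩ :
    RatSqrtSix →ₐ[ℚ] L)

theorem embed_apply {L : Type*} [Field L] [CharZero L] {σ : L} (hσ : σ ^ 2 = 6) (x : RatSqrtSix) :
    embed hσ x = x.re + x.im * σ := by
  simp [embed, QuadraticAlgebra.lift, Algebra.smul_def]

theorem norm_embed_sq_eq_zpow {p : ℕ} [Fact p.Prime] {σ : PadicAlgCl p} (hσ : σ ^ 2 = 6)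
    {x : RatSqrtSix} (hx : x ≠ 0) : ∃ k : ℤ, ‖embed hσ x‖ ^ 2 = (p : ℝ) ^ k := by
  have hmul : embed hσ x * (x.re - x.im * σ) = (nrm x : ℚ) := by
    rw [embed_apply, nrm]; push_cast; linear_combination (-(x.im : PadicAlgCl p) ^ 2) * hσ
  have hne := hmul.trans_ne (Rat.cast_ne_zero.2 (nrm_ne_zero hx))
  exact PadicAlgCl.norm_sq_eq_zpow p (left_ne_zero_of_mul hne) (right_ne_zero_of_mul hne) hmul
    (t := 2 * x.re) (by rw [embed_apply]; push_cast; ring)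

theorem norm_eq_one_of_sq_eq {p : ℕ} [Fact p.Prime] {σ : PadicAlgCl p} {n : ℤ} (h : σ ^ 2 = n) 
    (hn : ¬(p : ℤ) ∣ n) : ‖σ‖ = 1 := by
  rw [← pow_eq_one_iff_of_nonneg (norm_nonneg σ) two_ne_zero, ← norm_pow, h]
  exact le_antisymm (PadicAlgCl.norm_intCast_le_one p n)
    (not_lt.1 (mt (PadicAlgCl.norm_intCast_lt_one_iff p n).1 hn))

theorem norm_embed_eq_one {p : ℕ} [Fact p.Prime] {σ : PadicAlgCl p} (hσ : σ ^ 2 = 6)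
    (r s : ℤ) (h : ¬(p : ℤ) ∣ r ^ 2 - 6 * s ^ 2) : ‖embed hσ (r + s * sqrtSix)‖ = 1 := by
  have hle : ∀ s : ℤ, ‖(r + s * σ : PadicAlgCl p)‖ ≤ 1 := fun s => by
    refine (IsUltrametricDist.norm_add_le_max _ _).trans (max_le (PadicAlgCl.norm_intCast_le_one p r) ?_)
    rw [norm_mul]
    refine mul_le_one₀ (PadicAlgCl.norm_intCast_le_one p s) (norm_nonneg _) ?_
    rw [← pow_le_one_iff_of_nonneg (norm_nonneg σ) two_ne_zero, ← norm_pow, hσ]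
    exact_mod_cast PadicAlgCl.norm_intCast_le_one p 6
  have hmul : (r + s * σ : PadicAlgCl p) * (r + (-s : ℤ) * σ) = (r ^ 2 - 6 * s ^ 2 : ℤ) := by
    push_cast; linear_combination (-(s : PadicAlgCl p) ^ 2) * hσ
  have hnorm : ‖((r ^ 2 - 6 * s ^ 2 : ℤ) : PadicAlgCl p)‖ = 1 :=
    le_antisymm (PadicAlgCl.norm_intCast_le_one p _)
      (not_lt.1 (mt (PadicAlgCl.norm_intCast_lt_one_iff p _).1 h))
  rw [← hmul, norm_mul] at hnorm
  have : embed hσ (r + s * sqrtSix) = r + s * σ := by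
    rw [map_add, map_mul, map_intCast, map_intCast, embed_apply]; simp [sqrtSix]
  rw [this]
  nlinarith [hle s, hle (-s), norm_nonneg (r + s * σ : PadicAlgCl p),
    norm_nonneg (r + (-s : ℤ) * σ : PadicAlgCl p)]

theorem norm_pow_four_eq_zpow {p : ℕ} [Fact p.Prime] {y ρ : PadicAlgCl p} (hρ : ‖2 * ρ‖ = 1)
    {c : ℝ} {k : ℤ} (hc : c ^ 2 = (p : ℝ) ^ k) (h : ‖y ^ 2 - ρ ^ 2‖ = c ^ 3) :
    ∃ j : ℤ, ‖y + ρ‖ ^ 4 = (p : ℝ) ^ (3 * j) := by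
  have hmul : ‖y + ρ‖ * ‖y - ρ‖ = c ^ 3 := by rw [← norm_mul, ← h]; ring_nf
  by_cases heq : ‖y + ρ‖ = ‖y - ρ‖
  · refine ⟨k, ?_⟩
    rw [mul_comm, zpow_mul, ← hc]
    rw [← heq] at hmul
    exact_mod_cast (by linear_combination (‖y + ρ‖ ^ 2 + c ^ 3) * hmul : ‖y + ρ‖ ^ 4 = (c ^ 2) ^ 3)
  · have hmax := IsUltrametricDist.norm_add_eq_max_of_norm_ne_norm (x := y + ρ) (y := -(y - ρ))
      (by rwa [norm_neg])
    rw [show y + ρ + -(y - ρ) = 2 * ρ by ring, hρ, norm_neg] at hmax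
    rcases max_choice ‖y + ρ‖ ‖y - ρ‖ with h1 | h1
    · exact ⟨0, by rw [← h1, ← hmax]; simp⟩
    · refine ⟨2 * k, ?_⟩
      rw [← h1, ← hmax, mul_one] at hmul
      rw [hmul, show 3 * (2 * k) = k * 6 by ring, zpow_mul, ← hc]
      norm_cast
      ring

theorem norm_embed_add_pow_four {p : ℕ} [Fact p.Prime] {σ ρ : PadicAlgCl p} (hσ : σ ^ 2 = 6)
    {e r s : ℤ} (hρ : ρ ^ 2 = e) (he : ¬(p : ℤ) ∣ 4 * e) (hrs : ¬(p : ℤ) ∣ r ^ 2 - 6 * s ^ 2)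
    {x y : RatSqrtSix} (hx : x ≠ 0) (h : y ^ 2 - e = (r + s * sqrtSix) * x ^ 3) :
    ∃ j : ℤ, ‖embed hσ y + ρ‖ ^ 4 = (p : ℝ) ^ (3 * j) := by
  obtain ⟨k, hk⟩ := norm_embed_sq_eq_zpow hσ hx
  refine norm_pow_four_eq_zpow (norm_eq_one_of_sq_eq (n := 4 * e) ?_ he) hk ?_
  · rw [mul_pow, hρ]; push_cast; norm_num
  · rw [hρ, ← map_intCast (embed hσ) e, ← map_pow, ← map_sub, h, map_mul, norm_mul,
      norm_embed_eq_one hσ r s hrs, one_mul, map_pow, norm_pow]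

/-- The local condition on `(y + √e) * (ȳ ± √e)` needed to extract cube roots. -/
theorem norm_add_mul_add_pow_four {p : ℕ} [Fact p.Prime] {σ ρ τ : PadicAlgCl p} (hσ : σ ^ 2 = 6)
    {e r s : ℤ} (hρ : ρ ^ 2 = e) (hτ : τ ^ 2 = e) (he : ¬(p : ℤ) ∣ 4 * e)
    (hrs : ¬(p : ℤ) ∣ r ^ 2 - 6 * s ^ 2)
    {x y : RatSqrtSix} (hx : x ≠ 0) (h : y ^ 2 - e = (r + s * sqrtSix) * x ^ 3) :
    ∃ j : ℤ, ‖(y.re + y.im * σ + ρ) * (y.re - y.im * σ + τ)‖ ^ 4 = (p : ℝ) ^ (3 * j) := by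
  have hσ' : (-σ) ^ 2 = 6 := by rw [neg_sq, hσ]
  obtain ⟨j, hj⟩ := norm_embed_add_pow_four hσ hρ he hrs hx h
  obtain ⟨k, hk⟩ := norm_embed_add_pow_four hσ' hτ he hrs hx h
  have hp : (p : ℝ) ≠ 0 := by exact_mod_cast (Fact.out : p.Prime).ne_zero
  refine ⟨j + k, ?_⟩
  rw [embed_apply] at hj hk
  rw [mul_neg, ← sub_eq_add_neg] at hk
  rw [norm_mul, mul_pow, hj, hk, mul_add, zpow_add₀ hp]

end RatSqrtSix

namespace WeierstrassCurve.Affine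

variable {F : Type*} [Field F]

/-- The curve `y² = x³ + D`. -/
abbrev mordell (D : F) : WeierstrassCurve.Affine F := ⟨0, 0, 0, 0, D⟩

theorem mordell_nonsingular_iff [CharZero F] {D x y : F} (hD : D ≠ 0) :
    (mordell D).Nonsingular x y ↔ y ^ 2 = x ^ 3 + D := by
  rw [← equation_iff_nonsingular_of_Δ_ne_zero, equation_iff]
  · simp
  · simp [WeierstrassCurve.Δ, WeierstrassCurve.b₂, WeierstrassCurve.b₄, WeierstrassCurve.b₆,
      WeierstrassCurve.b₈, hD]

variable [DecidableEq F] {D : F}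

/-- Three points on `y² = x³ + D` with sum zero lie on a line `y = ℓ x + m`. -/
theorem mordell_exists_line {x₁ y₁ x₂ y₂ : F} {h₁ : (mordell D).Nonsingular x₁ y₁}
    {h₂ : (mordell D).Nonsingular x₂ y₂} (h : Point.some x₁ y₁ h₁ + Point.some x₂ y₂ h₂ ≠ 0) :
    ∃ (ℓ m x₃ y₃ : F) (h₃ : (mordell D).Nonsingular x₃ y₃),
      Point.some x₁ y₁ h₁ + Point.some x₂ y₂ h₂ = -Point.some x₃ y₃ h₃ ∧
      (y₁ = ℓ * x₁ + m ∧ y₂ = ℓ * x₂ + m ∧ y₃ = ℓ * x₃ + m) ∧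
      x₁ + x₂ + x₃ = ℓ ^ 2 ∧ x₁ * x₂ + x₁ * x₃ + x₂ * x₃ = -2 * ℓ * m ∧
      x₁ * x₂ * x₃ = m ^ 2 - D := by
  have hxy : ¬(x₁ = x₂ ∧ y₁ = (mordell D).negY x₂ y₂) := fun hxy =>
    h (Point.add_of_Y_eq hxy.1 hxy.2)
  set ℓ := (mordell D).slope x₁ x₂ y₁ y₂ with hℓ
  have hX : (mordell D).addX x₁ x₂ ℓ = ℓ ^ 2 - x₁ - x₂ := by simp [addX]
  have key := addPolynomial_slope h₁.1 h₂.1 hxy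
  rw [← hℓ, addPolynomial, linePolynomial, polynomial, hX] at key
  have key0 := congrArg (Polynomial.eval 0) key
  have key1 := congrArg (Polynomial.eval 1) key
  have hy₂ : y₂ = ℓ * x₂ + (y₁ - ℓ * x₁) := by
    by_cases hx : x₁ = x₂
    · have := Y_eq_of_Y_ne h₁.1 h₂.1 hx (fun h => hxy ⟨hx, h⟩)
      rw [this, hx]; ring
    · rw [hℓ, slope_of_X_ne hx]
      field_simp [sub_ne_zero.2 hx]
      ring
  refine ⟨ℓ, y₁ - ℓ * x₁, ℓ ^ 2 - x₁ - x₂, ℓ * (ℓ ^ 2 - x₁ - x₂ - x₁) + y₁, ?_, ?_, ⟨by ring, hy₂, by ring⟩,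
    by ring, ?_, ?_⟩
  · rw [← hX]
    exact nonsingular_negAdd h₁ h₂ hxy
  · rw [Point.add_some hxy, Point.neg_some, Point.some.injEq]
    refine ⟨hX, ?_⟩
    rw [addY, negAddY, hX]
  · simp at key0 key1
    linear_combination key1 - key0
  · simp at key0
    linear_combination -key0

end WeierstrassCurve.Affine

open QuadraticAlgebra

namespace RatSqrtSix

/-- The unit `5 + 2√6`. -/
def eta : RatSqrtSix := 5 + 2 * sqrtSix

theorem eta_mul : eta * (5 - 2 * sqrtSix) = 1 := by
  rw [eta]; linear_combination (-4) * sqrtSix_sq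

theorem eta_ne_zero : eta ≠ 0 := left_ne_zero_of_mul_eq_one eta_mul

theorem not_dvd_of_dvd_six_pow {p : ℕ} [Fact p.Prime] (hp : 5 ≤ p) {n : ℤ} (k : ℕ) (hn : n ∣ 6 ^ k) :
    ¬(p : ℤ) ∣ n := by
  intro h
  have h6 : p ∣ 6 := by
    exact_mod_cast (Nat.prime_iff_prime_int.1 (Fact.out : p.Prime)).dvd_of_dvd_pow (h.trans hn)
  have := Nat.le_of_dvd (by norm_num) h6
  interval_cases p <;> revert h6 <;> first | decide | skip
  exact absurd (Fact.out : Nat.Prime 6) (by norm_num)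

theorem class_identity {K : Type*} [Field K] [CharZero K] {s t : K} (hs : s ^ 2 = 6)
    (ht : t ^ 2 = 2) (a b e : K) :
    (e * (a + b * s + t)) ^ 2 * ((a ^ 2 + 6 * b ^ 2 - 2) ^ 2 - 6 * (2 * a * b) ^ 2) =
      (a ^ 2 - 6 * b ^ 2 + 2 + 2 * a * t) * (a ^ 2 - 6 * b ^ 2 - 2 + -4 * b * (s * t / 2)) *
        (e ^ 2 * ((a + b * s) ^ 2 - 2)) := by
  have h1 : a ^ 2 - 6 * b ^ 2 + 2 + 2 * a * t = (a + b * s + t) * (a - b * s + t) := by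
    linear_combination b ^ 2 * hs - ht
  have h2 : a ^ 2 - 6 * b ^ 2 - 2 + -4 * b * (s * t / 2) = (a + b * s + t) * (a - b * s - t) := by
    linear_combination b ^ 2 * hs + ht
  have h3 : (a ^ 2 + 6 * b ^ 2 - 2) ^ 2 - 6 * (2 * a * b) ^ 2 =
      ((a + b * s) ^ 2 - 2) * ((a - b * s) ^ 2 - t ^ 2) := by
    rw [ht, ← hs]; ring
  rw [h1, h2, h3]
  ring

theorem exists_eq_unit_mul_cube {K : Type} [Field K] [CharZero K] (φ : RatSqrtSix →+* K) {t : K}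
    (ht : t ^ 2 = 2) {x y : RatSqrtSix} (hx : x ≠ 0) (h : y ^ 2 = x ^ 3 + 2 * eta ^ 2)
    (hne : φ y + φ eta * t ≠ 0) :
    ∃ (i j : ℕ) (z : K), φ y + φ eta * t =
      (3 + 2 * t) ^ i * (2 + φ sqrtSix * t / 2) ^ j * z ^ 3 := by
  have hs : φ sqrtSix ^ 2 = 6 := by
    rw [← map_pow, sqrtSix_sq, map_ofNat]
  obtain ⟨v, hv⟩ : ∃ v, v = y * (5 - 2 * sqrtSix) := ⟨_, rfl⟩
  have hy : y = eta * v := by rw [hv]; linear_combination (-y) * eta_mul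
  have hv2 : v ^ 2 - (2 : ℤ) = ((49 : ℤ) + (-20 : ℤ) * sqrtSix) * x ^ 3 := by
    rw [hv, mul_pow, h]
    have h1 : (5 - 2 * sqrtSix) ^ 2 = 49 - 20 * sqrtSix := by
      linear_combination 4 * sqrtSix_sq
    push_cast
    linear_combination x ^ 3 * h1 + 2 * (eta * (5 - 2 * sqrtSix) + 1) * eta_mul
  set a := v.re with ha
  set b := v.im with hb
  have hnrm : (a ^ 2 + 6 * b ^ 2 - 2) ^ 2 - 6 * (2 * a * b) ^ 2 = nrm x ^ 3 := by
    have := congrArg nrm hv2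
    rw [nrm_mul, nrm_pow, pow_two] at this
    have hu : nrm ((49 : ℤ) + (-20 : ℤ) * sqrtSix) = 1 := by
      simp [nrm, sqrtSix]; norm_num
    rw [← one_mul (nrm x ^ 3), ← hu, ← this, nrm]
    simp [← ha, ← hb]
    ring
  have h8 : (4 * 2 : ℤ) ∣ 6 ^ 3 := by norm_num
  have h1' : (49 ^ 2 - 6 * (-20) ^ 2 : ℤ) ∣ 6 ^ 1 := by norm_num
  obtain ⟨i, z, w, h1⟩ := exists_eq_pow_mul_cube_two (a := a ^ 2 - 6 * b ^ 2 + 2) (b := 2 * a)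
    (n := nrm x) (ρ := t) (by simpa using ht)
    (by rw [← hnrm]; push_cast; ring) (nrm_ne_zero hx) (by
      intro ℓ _ hℓ ρ hρ
      obtain ⟨σ, hσ⟩ := IsAlgClosed.exists_pow_nat_eq (6 : PadicAlgCl ℓ) two_pos
      convert norm_add_mul_add_pow_four hσ hρ hρ (not_dvd_of_dvd_six_pow hℓ _ h8)
        (not_dvd_of_dvd_six_pow hℓ _ h1') hx hv2 using 5
      push_cast
      linear_combination b ^ 2 * hσ - hρ)
  obtain ⟨j, z', w', h2⟩ := exists_eq_pow_mul_cube_three (a := a ^ 2 - 6 * b ^ 2 - 2) (b := -4 * b)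
    (n := nrm x) (ρ := φ sqrtSix * t / 2) (by rw [div_pow, mul_pow, hs, ht]; norm_num)
    (by rw [← hnrm]; push_cast; ring) (nrm_ne_zero hx) (by
      intro ℓ _ hℓ ρ hρ
      obtain ⟨σ, hσ⟩ := IsAlgClosed.exists_pow_nat_eq (2 : PadicAlgCl ℓ) two_pos
      have hσ0 : (σ * ρ) ^ 2 = 6 := by rw [mul_pow, hσ, hρ]; norm_num
      have := norm_add_mul_add_pow_four (e := 2) (ρ := σ) (τ := -σ) hσ0 (by rw [hσ]; norm_num)
        (by rw [neg_sq, hσ]; norm_num) (not_dvd_of_dvd_six_pow hℓ _ h8)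
        (not_dvd_of_dvd_six_pow hℓ _ h1') hx hv2
      convert this using 5
      push_cast
      linear_combination b ^ 2 * hσ0 + (1 + 2 * b * ρ) * hσ)
  obtain ⟨X, hX⟩ : ∃ X, X = φ y + φ eta * t :=
    ⟨_, rfl⟩
  obtain ⟨n, hn⟩ : ∃ n, n = ((nrm x : ℚ) : K) := ⟨_, rfl⟩
  obtain ⟨x', hx'⟩ : ∃ x', x' = φ x := ⟨_, rfl⟩
  obtain ⟨g, hg⟩ : ∃ g, g = ((a ^ 2 - 6 * b ^ 2 + 2 : ℚ) + (2 * a : ℚ) * t) *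
    ((a ^ 2 - 6 * b ^ 2 - 2 : ℚ) + (-4 * b : ℚ) * (φ sqrtSix * t / 2)) := ⟨_, rfl⟩
  have key : X ^ 2 * n ^ 3 = g * x' ^ 3 := by
    have hv' := congrArg (φ) (eq_add_mul_sqrtSix v)
    have hX' : X = φ eta * (φ v + t) := by
      rw [hX, hy, map_mul]; ring
    have hx3 : x' ^ 3 = φ eta ^ 2 *
        (φ v ^ 2 - 2) := by
      rw [hx', ← map_pow, ← map_pow, ← map_pow, ← map_ofNat φ 2,
        ← map_sub, ← map_mul]
      congr 1
      rw [hy] at h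
      linear_combination -h
    have hn3 : n ^ 3 = ((a : K) ^ 2 + 6 * b ^ 2 - 2) ^ 2 - 6 * (2 * a * b) ^ 2 := by
      have := congrArg (Rat.cast : ℚ → K) hnrm
      push_cast at this
      rw [hn, this]
    rw [map_add, map_mul, map_ratCast, map_ratCast, ← ha, ← hb] at hv'
    rw [hg, hX', hx3, hn3, hv']
    push_cast
    exact class_identity hs ht _ _ _
  have hX0 : X ≠ 0 := hX ▸ hne
  have hn0 : n ≠ 0 := hn ▸ Rat.cast_ne_zero.2 (nrm_ne_zero hx)
  have hg0 : g * x' ^ 3 ≠ 0 := key ▸ mul_ne_zero (pow_ne_zero 2 hX0) (pow_ne_zero 3 hn0)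
  rw [hg, h1, h2] at key hg0
  rw [← hX]
  generalize 3 + 2 * t = θ, 2 + φ sqrtSix * t / 2 = μ,
    (z : K) + w * t = c, (z' : K) + w' * (φ sqrtSix * t / 2) = d at *
  refine ⟨2 * i, 2 * j, X * n / (θ ^ i * μ ^ j * (c * d * x')), ?_⟩
  rw [show θ ^ i * c ^ 3 * (μ ^ j * d ^ 3) * x' ^ 3 = θ ^ i * μ ^ j * (c * d * x') ^ 3 by ring]
    at key hg0
  have h3 := left_ne_zero_of_mul hg0
  have h4 := pow_ne_zero_iff three_ne_zero |>.1 (right_ne_zero_of_mul hg0)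
  rw [pow_mul', pow_mul', ← mul_pow, div_pow, mul_div_assoc', eq_div_iff (pow_ne_zero 3 (mul_ne_zero h3 h4))]
  linear_combination (-X * (θ ^ i * μ ^ j) ^ 2) * key


theorem class_identity' {K : Type*} [Field K] [CharZero K] {s t : K} (hs : s ^ 2 = 6)
    (ht : t ^ 2 = -6) (a b : K) :
    (9 * (a + b * s + t)) ^ 2 * ((a ^ 2 + 6 * b ^ 2 + 6) ^ 2 - 6 * (2 * a * b) ^ 2) =
      (9 * (a ^ 2 - 6 * b ^ 2 + 6) + -108 * b * (t / s)) *
        (9 * (a ^ 2 - 6 * b ^ 2 - 6) + 18 * a * t) * ((a + b * s) ^ 2 + 6) := by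
  have hs0 : s ≠ 0 := by rintro rfl; norm_num at hs
  have h0 : t / s = s * t / 6 := by
    rw [div_eq_div_iff hs0 (by norm_num)]; linear_combination (-t) * hs
  have h1 : 9 * (a ^ 2 - 6 * b ^ 2 + 6) + -108 * b * (t / s) =
      9 * ((a + b * s + t) * (a - b * s - t)) := by
    rw [h0]; linear_combination 9 * b ^ 2 * hs + 9 * ht
  have h2 : 9 * (a ^ 2 - 6 * b ^ 2 - 6) + 18 * a * t = 9 * ((a + b * s + t) * (a - b * s + t)) := by
    linear_combination 9 * b ^ 2 * hs - 9 * ht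
  have h3 : (a ^ 2 + 6 * b ^ 2 + 6) ^ 2 - 6 * (2 * a * b) ^ 2 =
      ((a + b * s) ^ 2 + 6) * ((a - b * s) ^ 2 - t ^ 2) := by
    rw [ht, ← hs]; ring
  rw [h1, h2, h3]
  ring

theorem norm_ratCast_mul_eq {p : ℕ} [Fact p.Prime] (hp : 5 ≤ p) (z : PadicAlgCl p) :
    ‖9 * z‖ = ‖z‖ := by
  have : ‖(9 : PadicAlgCl p)‖ = 1 := by
    refine norm_eq_one_of_sq_eq (n := 81) (by norm_num) (not_dvd_of_dvd_six_pow hp 4 (by norm_num))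
  rw [norm_mul, this, one_mul]

theorem exists_three_mul_eta_mul_eq_cube {K : Type} [Field K] [CharZero K] (φ : RatSqrtSix →+* K)
    {t : K} (ht : t ^ 2 = -6) {q y : RatSqrtSix} (hq : q ≠ 0) (h : y ^ 2 + 6 = 3 * eta * q⁻¹ ^ 3)
    (hne : φ y + t ≠ 0) : ∃ z : K, 3 * φ eta * (φ y + t) = z ^ 3 := by
  have hs : φ sqrtSix ^ 2 = 6 := by
    rw [← map_pow, sqrtSix_sq, map_ofNat]
  have hs0 : φ sqrtSix ≠ 0 := by intro h; rw [h] at hs; norm_num at hs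
  have hv2 : y ^ 2 - (-6 : ℤ) = ((15 : ℤ) + (6 : ℤ) * sqrtSix) * q⁻¹ ^ 3 := by
    push_cast; rw [sub_neg_eq_add, h, eta]; ring
  set a := y.re with ha
  set b := y.im with hb
  have hn0 := nrm_ne_zero hq
  have hqi : nrm q⁻¹ = (nrm q)⁻¹ := by
    refine eq_inv_of_mul_eq_one_left ?_
    rw [← nrm_mul, inv_mul_cancel₀ hq]
    simpa using nrm_pow 1 0
  have hnrm : (a ^ 2 + 6 * b ^ 2 + 6) ^ 2 - 6 * (2 * a * b) ^ 2 = 9 * (nrm q)⁻¹ ^ 3 := by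
    have := congrArg nrm hv2
    rw [nrm_mul, nrm_pow, pow_two, hqi] at this
    have hu : nrm ((15 : ℤ) + (6 : ℤ) * sqrtSix) = 9 := by
      simp [nrm, sqrtSix]; norm_num
    rw [← hu, ← this, nrm]
    simp [← ha, ← hb]
    ring
  have h24 : (4 * (-6) : ℤ) ∣ 6 ^ 3 := by norm_num
  have h9 : (15 ^ 2 - 6 * 6 ^ 2 : ℤ) ∣ 6 ^ 2 := by norm_num
  have hm0 : 9 * (nrm q)⁻¹ ≠ 0 := mul_ne_zero (by norm_num) (inv_ne_zero hn0)
  obtain ⟨z, w, h1⟩ := exists_eq_cube_neg_one (a := 9 * (a ^ 2 - 6 * b ^ 2 + 6)) (b := -108 * b)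
    (n := 9 * (nrm q)⁻¹) (ρ := t / φ sqrtSix) (by rw [div_pow, ht, hs]; norm_num)
    (by push_cast; linear_combination 81 * hnrm) hm0 (by
      intro ℓ _ hℓ ρ hρ
      obtain ⟨σ, hσ⟩ := IsAlgClosed.exists_pow_nat_eq (6 : PadicAlgCl ℓ) two_pos
      have hσρ : (σ * ρ) ^ 2 = (-6 : ℤ) := by rw [mul_pow, hσ, hρ]; norm_num
      have := norm_add_mul_add_pow_four (e := -6) (ρ := σ * ρ) (τ := -(σ * ρ)) hσ hσρ
        (by rw [neg_sq, hσρ]) (not_dvd_of_dvd_six_pow hℓ _ h24)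
        (not_dvd_of_dvd_six_pow hℓ _ h9) (inv_ne_zero hq) hv2
      rw [← norm_ratCast_mul_eq hℓ] at this
      convert this using 5
      push_cast at hρ ⊢
      linear_combination (9 * b ^ 2 + 9 * ρ ^ 2 + 18 * b * ρ) * hσ + 54 * hρ)
  obtain ⟨z', w', h2⟩ := exists_eq_cube_neg_six (a := 9 * (a ^ 2 - 6 * b ^ 2 - 6)) (b := 18 * a)
    (n := 9 * (nrm q)⁻¹) (ρ := t) (by simpa using ht)
    (by push_cast; linear_combination 81 * hnrm) hm0 (by
      intro ℓ _ hℓ ρ hρ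
      obtain ⟨σ, hσ⟩ := IsAlgClosed.exists_pow_nat_eq (6 : PadicAlgCl ℓ) two_pos
      have := norm_add_mul_add_pow_four hσ hρ hρ (not_dvd_of_dvd_six_pow hℓ _ h24)
        (not_dvd_of_dvd_six_pow hℓ _ h9) (inv_ne_zero hq) hv2
      rw [← norm_ratCast_mul_eq hℓ] at this
      convert this using 5
      push_cast at hρ ⊢
      linear_combination 9 * b ^ 2 * hσ - 9 * hρ)
  obtain ⟨n, hn⟩ : ∃ n, n = ((nrm q : ℚ) : K) := ⟨_, rfl⟩
  have hn0' : n ≠ 0 := hn ▸ Rat.cast_ne_zero.2 hn0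
  have hy := congrArg φ (eq_add_mul_sqrtSix y)
  rw [map_add, map_mul, map_ratCast, map_ratCast, ← ha, ← hb] at hy
  have hq0 : φ q ≠ 0 := (map_ne_zero φ).2 hq
  have hy2 : φ y ^ 2 + 6 = 3 * φ eta * (φ q)⁻¹ ^ 3 := by
    have := congrArg φ h
    rwa [map_add, map_pow, map_mul, map_mul, map_pow, map_inv₀, map_ofNat, map_ofNat] at this
  have key := class_identity' hs ht (a : K) b
  have hnK := congrArg (Rat.cast : ℚ → K) hnrm
  push_cast at hnK h1 h2
  rw [h1, h2, hnK, ← hy, hy2, ← hn] at key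
  generalize (z : K) + w * (t / φ sqrtSix) = c, (z' : K) + w' * t = d at *
  generalize φ y + t = X, φ eta = e, φ q = r at *
  have key' : 729 * X ^ 2 * r ^ 3 = 3 * e * (n * c * d) ^ 3 := by
    field_simp at key
    linear_combination key
  have hne' := key' ▸ (mul_ne_zero (mul_ne_zero (by norm_num) (pow_ne_zero 2 hne)) (pow_ne_zero 3 hq0) :
    729 * X ^ 2 * r ^ 3 ≠ 0)
  refine ⟨9 * X * r / (n * c * d), ?_⟩
  rw [div_pow, eq_div_iff (right_ne_zero_of_mul hne')]
  linear_combination (-X) * key'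

end RatSqrtSix

theorem padicNorm_three_three : padicNorm 3 3 = 3⁻¹ := by
  exact_mod_cast padicNorm.padicNorm_p_of_prime (p := 3)

namespace RatSqrtSix

/-- The normalised absolute value of `ℚ(√6)` at the prime above `3`. -/
def av (x : RatSqrtSix) : ℚ := padicNorm 3 (nrm x)

theorem av_mul (x y : RatSqrtSix) : av (x * y) = av x * av y := by
  rw [av, nrm_mul, padicNorm.mul, av, av]

theorem av_pow (x : RatSqrtSix) (n : ℕ) : av (x ^ n) = av x ^ n := by
  induction n with
  | zero => rw [pow_zero, pow_zero, av, ← pow_zero 0, nrm_pow, pow_zero]; simp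
  | succ n ih => rw [pow_succ, av_mul, ih, pow_succ]

theorem av_zero : av 0 = 0 := by
  simp [av, nrm]

theorem av_neg (x : RatSqrtSix) : av (-x) = av x := by
  simp [av, nrm]

theorem av_nonneg (x : RatSqrtSix) : 0 ≤ av x := padicNorm.nonneg _

theorem av_pos {x : RatSqrtSix} (hx : x ≠ 0) : 0 < av x :=
  lt_of_le_of_ne (av_nonneg x) (padicNorm.nonzero (nrm_ne_zero hx)).symm

theorem av_eq_zero_iff {x : RatSqrtSix} : av x = 0 ↔ x = 0 :=
  ⟨fun h => by_contra fun hx => (av_pos hx).ne' h, fun h => h ▸ av_zero⟩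

theorem av_div (x y : RatSqrtSix) : av (x / y) = av x / av y := by
  rcases eq_or_ne y 0 with rfl | hy
  · simp [av_zero]
  · rw [eq_div_iff (av_pos hy).ne', ← av_mul, div_mul_cancel₀ x hy]

theorem exists_av_eq_zpow {x : RatSqrtSix} (hx : x ≠ 0) : ∃ k : ℤ, av x = 3 ^ k := by
  obtain ⟨k, hk⟩ := padicNorm.values_discrete (p := 3) (nrm_ne_zero hx)
  exact ⟨-k, by rw [av, hk]; norm_num⟩

theorem av_eq_max (x : RatSqrtSix) : av x = max (padicNorm 3 x.re ^ 2) (padicNorm 3 x.im ^ 2 / 3) := by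
  have h6 : padicNorm 3 (-6 * x.im ^ 2) = padicNorm 3 x.im ^ 2 / 3 := by
    have h2 : padicNorm 3 2 = 1 := by exact_mod_cast padicNorm.nat_eq_one_iff (p := 3) 2 |>.2 (by norm_num)
    rw [show -6 * x.im ^ 2 = -(2 * 3 * x.im ^ 2) by ring, padicNorm.neg, padicNorm.mul,
      padicNorm.mul, h2, padicNorm_three_three, pow_two, padicNorm.mul]
    ring
  have h1 : padicNorm 3 (x.re ^ 2) = padicNorm 3 x.re ^ 2 := by rw [pow_two, padicNorm.mul, pow_two]
  rw [av, nrm, sub_eq_add_neg, ← neg_mul, ← h6, ← h1]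
  by_cases hre : x.re = 0
  · rw [hre, zero_pow two_ne_zero, zero_add, padicNorm.zero, max_eq_right (padicNorm.nonneg _)]
  by_cases him : x.im = 0
  · rw [him, zero_pow two_ne_zero, mul_zero, add_zero, padicNorm.zero,
      max_eq_left (padicNorm.nonneg _)]
  refine padicNorm.add_eq_max_of_ne fun h => ?_
  obtain ⟨j, hj⟩ := padicNorm.values_discrete (p := 3) hre
  obtain ⟨k, hk⟩ := padicNorm.values_discrete (p := 3) him
  rw [h6, h1, hj, hk, ← zpow_natCast, ← zpow_mul, ← zpow_natCast, ← zpow_mul, div_eq_mul_inv,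
    ← zpow_neg_one] at h
  push_cast at h
  rw [← zpow_add₀ (by norm_num)] at h
  have := zpow_right_injective₀ (by norm_num : (0 : ℚ) < 3) (by norm_num) h
  omega

theorem av_ratCast (q : ℚ) : av q = padicNorm 3 q ^ 2 := by
  rw [av_eq_max, QuadraticAlgebra.re_ratCast, QuadraticAlgebra.im_ratCast, padicNorm.zero, Rat.cast_id]
  simp [sq_nonneg]

theorem av_add_le_max (x y : RatSqrtSix) : av (x + y) ≤ max (av x) (av y) := by
  rw [av_eq_max, av_eq_max x, av_eq_max y]
  have key : ∀ a b : ℚ, padicNorm 3 (a + b) ^ 2 ≤ max (padicNorm 3 a ^ 2) (padicNorm 3 b ^ 2) := by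
    intro a b
    have := padicNorm.nonarchimedean (p := 3) (q := a) (r := b)
    rcases le_max_iff.1 this with h | h
    · exact le_max_of_le_left (pow_le_pow_left₀ (padicNorm.nonneg _) h 2)
    · exact le_max_of_le_right (pow_le_pow_left₀ (padicNorm.nonneg _) h 2)
  have h1 := key x.re y.re
  have h2 := key x.im y.im
  rw [QuadraticAlgebra.re_add, QuadraticAlgebra.im_add]
  rw [le_max_iff] at h1 h2
  refine max_le ?_ ?_ <;> simp only [le_max_iff]
  · exact h1.imp Or.inl Or.inl
  · rcases h2 with h | h
    · exact Or.inl (Or.inr (by gcongr))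
    · exact Or.inr (Or.inr (by gcongr))

theorem av_add_le {x y : RatSqrtSix} {c : ℚ} (hx : av x ≤ c) (hy : av y ≤ c) : av (x + y) ≤ c :=
  (av_add_le_max x y).trans (max_le hx hy)

theorem av_sub_le {x y : RatSqrtSix} {c : ℚ} (hx : av x ≤ c) (hy : av y ≤ c) : av (x - y) ≤ c := by
  rw [sub_eq_add_neg]; exact av_add_le hx (by rwa [av_neg])

theorem av_add_lt {x y : RatSqrtSix} {c : ℚ} (hx : av x < c) (hy : av y < c) : av (x + y) < c :=
  (av_add_le_max x y).trans_lt (max_lt hx hy)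

theorem av_sub_lt {x y : RatSqrtSix} {c : ℚ} (hx : av x < c) (hy : av y < c) : av (x - y) < c := by
  rw [sub_eq_add_neg]; exact av_add_lt hx (by rwa [av_neg])

theorem av_eq_of_av_sub_lt {x y : RatSqrtSix} (h : av (x - y) < av x) : av y = av x := by
  refine le_antisymm ?_ (le_of_not_gt fun hlt => ?_)
  · simpa using av_sub_le le_rfl h.le
  · simpa using av_add_lt h hlt

theorem av_add_eq_left {x y : RatSqrtSix} (h : av y < av x) : av (x + y) = av x :=
  av_eq_of_av_sub_lt (by simpa [av_neg] using h)

theorem av_sub_comm (x y : RatSqrtSix) : av (x - y) = av (y - x) := by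
  rw [← neg_sub, av_neg]

theorem av_two : av 2 = 1 := by
  have := av_ratCast 2
  have h2 : padicNorm 3 2 = 1 := by
    exact_mod_cast padicNorm.nat_eq_one_iff (p := 3) 2 |>.2 (by norm_num)
  rw [h2] at this
  exact_mod_cast this

theorem av_three : av 3 = 1 / 9 := by
  have := av_ratCast 3
  rw [padicNorm_three_three] at this
  norm_num at this ⊢
  exact_mod_cast this

theorem av_sqrtSix : av sqrtSix = 1 / 3 := by
  rw [av_eq_max]; simp [sqrtSix]

theorem av_intCast_le_one (n : ℤ) : av n ≤ 1 := by
  have := av_ratCast n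
  rw [Rat.cast_intCast] at this
  rw [this]
  exact pow_le_one₀ (padicNorm.nonneg _) (padicNorm.of_int n)

theorem av_le_of_lt {x : RatSqrtSix} {k : ℤ} (h : av x < 3 ^ (k + 1)) : av x ≤ 3 ^ k := by
  rcases eq_or_ne x 0 with rfl | hx
  · rw [av_zero]; positivity
  obtain ⟨j, hj⟩ := exists_av_eq_zpow hx
  rw [hj] at h ⊢
  rw [zpow_lt_zpow_iff_right₀ (by norm_num)] at h
  exact zpow_le_zpow_right₀ (by norm_num) (by lia)


theorem exists_av_ratCast_eq_zpow {q : ℚ} (hq : q ≠ 0) : ∃ k : ℤ, av q = 9 ^ k := by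
  obtain ⟨k, hk⟩ := padicNorm.values_discrete (p := 3) hq
  refine ⟨-k, ?_⟩
  rw [av_ratCast, hk, ← zpow_natCast, ← zpow_mul, mul_comm, zpow_mul]
  norm_num

theorem av_ratCast_le_of_lt {q : ℚ} {k : ℤ} (h : av q < 9 ^ (k + 1)) : av q ≤ 9 ^ k := by
  rcases eq_or_ne q 0 with rfl | hq
  · rw [Rat.cast_zero, av_zero]; positivity
  obtain ⟨j, hj⟩ := exists_av_ratCast_eq_zpow hq
  rw [hj] at h ⊢
  rw [zpow_lt_zpow_iff_right₀ (by norm_num)] at h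
  exact zpow_le_zpow_right₀ (by norm_num) (by lia)

theorem av_re_le (x : RatSqrtSix) : av x.re ≤ av x := by
  rw [av_ratCast, av_eq_max]; exact le_max_left _ _

theorem av_im_le (x : RatSqrtSix) : av x.im ≤ 3 * av x := by
  have := le_max_right (padicNorm 3 x.re ^ 2) (padicNorm 3 x.im ^ 2 / 3)
  rw [av_ratCast]; rw [← av_eq_max] at this; linarith

theorem av_one : av 1 = 1 := by simpa using av_pow 1 0

theorem av_intCast_eq_one {a : ℤ} (ha : ¬(3 : ℤ) ∣ a) : av a = 1 := by
  have := av_ratCast a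
  rw [Rat.cast_intCast] at this
  rw [this, (padicNorm.int_eq_one_iff (p := 3) a).2 (by exact_mod_cast ha), one_pow]

theorem av_int_add_mul_le_one (a b : ℤ) : av (a + b * sqrtSix) ≤ 1 := by
  refine av_add_le (av_intCast_le_one a) ?_
  rw [av_mul, av_sqrtSix]
  linarith [av_intCast_le_one b]

theorem av_int_add_mul_eq_one {a : ℤ} (ha : ¬(3 : ℤ) ∣ a) (b : ℤ) : av (a + b * sqrtSix) = 1 := by
  rw [av_add_eq_left, av_intCast_eq_one ha]
  rw [av_intCast_eq_one ha, av_mul, av_sqrtSix]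
  linarith [av_intCast_le_one b]

theorem av_eta : av eta = 1 := by
  have := av_int_add_mul_eq_one (a := 5) (by norm_num) 2
  exact_mod_cast this

theorem av_im_le_one {x : RatSqrtSix} (hx : av x ≤ 1) : av x.im ≤ 1 := by
  simpa using av_ratCast_le_of_lt (q := x.im) (k := 0) (by norm_num; linarith [av_im_le x])

theorem av_im_cube_le {x : RatSqrtSix} (hx : av x ≤ 1) : av (x ^ 3).im ≤ 1 / 9 := by
  have h : (((x ^ 3).im : ℚ) : RatSqrtSix) =
      3 * (x.re ^ 2 * x.im + 2 * x.im ^ 3) := by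
    rw [pow_succ, pow_two]
    simp only [QuadraticAlgebra.re_mul, QuadraticAlgebra.im_mul]
    push_cast
    ring
  have h1 := (av_re_le x).trans hx
  have h2 := av_im_le_one hx
  rw [h, av_mul, av_three]
  have : av (x.re ^ 2 * x.im + 2 * x.im ^ 3) ≤ 1 := by
    refine av_add_le ?_ ?_
    · rw [av_mul, av_pow]
      exact mul_le_one₀ (pow_le_one₀ (av_nonneg _) h1) (av_nonneg _) h2
    · rw [av_mul, av_pow, av_two, one_mul]
      exact pow_le_one₀ (av_nonneg _) h2
  linarith

theorem zpow_three_mul_ne {a : ℚ} {x : RatSqrtSix} (hx : x ≠ 0) {n : ℤ} (ha : a = 3 ^ n)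
    (hn : ¬(3 : ℤ) ∣ n) : av x ^ 3 ≠ a := by
  obtain ⟨k, hk⟩ := exists_av_eq_zpow hx
  rw [ha, hk, ← zpow_natCast, ← zpow_mul]
  intro h
  have := zpow_right_injective₀ (by norm_num : (0 : ℚ) < 3) (by norm_num) h
  push_cast at this
  omega

theorem av_le_div_three_of_lt {x y : RatSqrtSix} (h : av x < av y) : av x ≤ av y / 3 := by
  have hy : y ≠ 0 := by rintro rfl; rw [av_zero] at h; exact absurd h (av_nonneg x).not_gt
  obtain ⟨k, hk⟩ := exists_av_eq_zpow hy
  rw [hk] at h ⊢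
  refine (av_le_of_lt (k := k - 1) (by simpa using h)).trans_eq ?_
  rw [zpow_sub_one₀ (by norm_num)]; rfl

theorem av_natCast_mul_le (n : ℕ) (x : RatSqrtSix) : av (n * x) ≤ av x := by
  rw [av_mul]
  exact mul_le_of_le_one_left (av_nonneg _) (by exact_mod_cast av_intCast_le_one n)

/-- No element of the form `(1 + √2) * z ^ 3` has `√2`-coordinate equal to `eta`. -/
theorem cubic_form_ne_eta (p q : RatSqrtSix) :
    p ^ 3 + 3 * p ^ 2 * q + 6 * p * q ^ 2 + 2 * q ^ 3 ≠ eta := by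
  intro h
  obtain ⟨m, rfl⟩ : ∃ m, p = q + m := ⟨p - q, by ring⟩
  have hm0 := av_nonneg m
  have hq0 := av_nonneg q
  rcases lt_or_ge (av m) (av q) with hlt | hle
  · have hle := av_le_div_three_of_lt hlt
    have hqpos : 0 < av q := hm0.trans_lt hlt
    have h12 : av (3 * (2 ^ 2 * q ^ 3)) = av q ^ 3 / 9 := by
      rw [av_mul, av_mul, av_pow, av_pow, av_two, av_three]; ring
    have hrest : av (m ^ 3 + 3 * ((2 * q * m) * m + (5 * q ^ 2 * m))) < av q ^ 3 / 9 := by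
      refine av_add_lt ?_ ?_
      · rw [av_pow]
        have := pow_le_pow_left₀ hm0 hle 3
        have : 0 < av q ^ 3 := by positivity
        nlinarith
      · rw [av_mul, av_three]
        have : av ((2 * q * m) * m + (5 * q ^ 2 * m)) ≤ av q ^ 3 / 3 := by
          refine av_add_le ?_ ?_
          · rw [av_mul, av_mul, av_mul, av_two, one_mul]
            calc av q * av m * av m ≤ av q * (av q / 3) * av q := by gcongr
              _ = _ := by ring
          · rw [mul_assoc]
            refine (av_natCast_mul_le 5 _).trans ?_
            rw [av_mul, av_pow]
            calc av q ^ 2 * av m ≤ av q ^ 2 * (av q / 3) := by gcongr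
              _ = _ := by ring
        have : 0 < av q ^ 3 := by positivity
        linarith
    have := av_add_eq_left (h12 ▸ hrest)
    rw [h12, show 3 * (2 ^ 2 * q ^ 3) + (m ^ 3 + 3 * ((2 * q * m) * m + (5 * q ^ 2 * m))) = eta by
      rw [← h]; ring, av_eta] at this
    refine zpow_three_mul_ne (x := q) ?_ (a := 9) (n := 2) (by norm_num) (by norm_num) (by linarith)
    rintro rfl
    simp [av_zero] at hqpos
  · have hdiff : av (eta - m ^ 3) ≤ av m ^ 3 / 9 := by
      rw [← h, show (q + m) ^ 3 + 3 * (q + m) ^ 2 * q + 6 * (q + m) * q ^ 2 + 2 * q ^ 3 - m ^ 3 =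
        3 * ((2 * (m ^ 2 * q)) + (5 * (m * q ^ 2) + 4 * q ^ 3)) by ring, av_mul, av_three]
      have : av ((2 * (m ^ 2 * q)) + (5 * (m * q ^ 2) + 4 * q ^ 3)) ≤ av m ^ 3 := by
        refine av_add_le ?_ (av_add_le ?_ ?_)
        · refine (av_natCast_mul_le 2 _).trans ?_
          rw [av_mul, av_pow]
          calc av m ^ 2 * av q ≤ av m ^ 2 * av m := by gcongr
              _ = _ := by ring
        · refine (av_natCast_mul_le 5 _).trans ?_
          rw [av_mul, av_pow]
          calc av m * av q ^ 2 ≤ av m * av m ^ 2 := by gcongr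
              _ = _ := by ring
        · refine (av_natCast_mul_le 4 _).trans ?_
          rw [av_pow]
          gcongr
      linarith
    have hm1 : av m ^ 3 = 1 := by
      rcases hm0.eq_or_lt with h0 | hpos
      · rw [← h0] at hdiff hle
        have : q = 0 := av_eq_zero_iff.1 (le_antisymm hle hq0)
        have : m = 0 := av_eq_zero_iff.1 h0.symm
        subst_vars
        exact absurd h.symm (by simpa using eta_ne_zero)
      · have : 0 < av m ^ 3 := by positivity
        rw [← av_pow, ← av_eta]
        refine (av_eq_of_av_sub_lt ?_).symm
        rw [av_pow, av_sub_comm]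
        linarith
    have hm1 : av m = 1 := (pow_eq_one_iff_of_nonneg hm0 (by norm_num)).1 hm1
    rw [hm1] at hdiff
    have him := (av_im_le _).trans (mul_le_mul_of_nonneg_left hdiff (by norm_num : (0 : ℚ) ≤ 3))
    have hcube := av_im_cube_le hm1.le
    have h2 : ((((eta - m ^ 3).im : ℚ) : RatSqrtSix) + ((m ^ 3).im : ℚ)) = 2 := by
      rw [QuadraticAlgebra.im_sub]; push_cast; simp [eta, sqrtSix]
    have := av_add_lt (c := 1) (him.trans_lt (by norm_num)) (hcube.trans_lt (by norm_num))
    rw [h2, av_two] at this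
    exact lt_irrefl _ this

end RatSqrtSix

namespace WeierstrassCurve.Affine

variable {F : Type*} [Field F] [CharZero F] [DecidableEq F]

/-- The triple of the point `(u, u * m)` on `y² = x³ + 2 * (n * u)²`, where `u = m² - 2 * n²`. -/
theorem mordell_three_nsmul {D m n u w p q x y : F} (hu : u = m ^ 2 - 2 * n ^ 2)
    (hw : w = m ^ 2 + 6 * n ^ 2) (hm : m ≠ 0) (hu0 : u ≠ 0) (hw0 : w ≠ 0)
    (hp : p = m * (m ^ 2 - 18 * n ^ 2) / (3 * w))
    (hq : q = 3 * n * u / w)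
    (hx : x = p ^ 2 - 2 * q ^ 2) (hy : y = p ^ 3 + 6 * p * q ^ 2)
    (hR : (mordell D).Nonsingular u (u * m)) (hT : (mordell D).Nonsingular x y) :
    Point.some x y hT = 3 • Point.some u (u * m) hR := by
  have hneg : ∀ a b, (mordell D).negY a b = -b := fun a b => by simp [negY]
  have hne : u * m ≠ (mordell D).negY u (u * m) := by
    rw [hneg, Ne, eq_neg_iff_add_eq_zero, ← two_mul]
    simp [hu0, hm]
  have hslope : (mordell D).slope u u (u * m) (u * m) = 3 * u / (2 * m) := by
    rw [slope_of_Y_ne rfl hne, hneg]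
    field_simp
    simp
    ring
  set x₂ : F := 9 * u ^ 2 / (4 * m ^ 2) - 2 * u with hx₂
  have h2 : ∃ h₂, Point.some u (u * m) hR + Point.some u (u * m) hR =
      Point.some x₂ (-(3 * u / (2 * m) * (x₂ - u) + u * m)) h₂ := by
    have hs := Point.add_some (h₁ := hR) (h₂ := hR) fun h => hne h.2
    have hadd : (mordell D).addX u u (3 * u / (2 * m)) = x₂ := by
      simp only [addX, x₂]; field_simp; ring
    simp only [hslope, hadd, addY, negAddY, hneg] at hs
    exact ⟨_, hs⟩
  obtain ⟨h₂, h2⟩ := h2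
  have hsub : x₂ - u = -3 * u * w / (4 * m ^ 2) := by
    rw [hx₂]; field_simp; rw [hu, hw]; ring
  have hx2u : x₂ ≠ u := by
    rw [← sub_ne_zero, hsub]
    simp [hu0, hm, hw0]
  rw [show (3 : ℕ) = 2 + 1 from rfl, add_nsmul, two_nsmul, one_nsmul, h2,
    Point.add_some fun h => hx2u h.1, Point.some.injEq]
  have hslope' : (mordell D).slope x₂ u (-(3 * u / (2 * m) * (x₂ - u) + u * m)) (u * m) =
      -(3 * u / (2 * m)) + 8 * m ^ 3 / (3 * w) := by
    rw [slope_of_X_ne hx2u, hsub]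
    field_simp
    rw [hu, hw]
    ring
  have hX : x = (mordell D).addX x₂ u
      ((mordell D).slope x₂ u (-(3 * u / (2 * m) * (x₂ - u) + u * m)) (u * m)) := by
    rw [hslope']
    simp only [addX, x₂, hx, hp, hq]
    field_simp
    rw [hu, hw]
    ring
  refine ⟨hX, ?_⟩
  simp only [addY, negAddY, hneg]
  rw [← hX, hslope', hy, hx, hp, hq, hx₂]
  field_simp
  rw [hu, hw]
  ring

end WeierstrassCurve.Affine

namespace WeierstrassCurve.Affine

variable {F K : Type*} [Field F] [Field K]

/-- The function `y + c * t` on the points of `y² = x³ + c² * t²`. -/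
def mordellMap {D : F} (φ : F →+* K) (c t : K) : (mordell D).Point → K
  | .zero => 1
  | .some _ y _ => φ y + c * t

theorem mordellMap_ne_zero {D : F} {φ : F →+* K} {c t : K} (hc : ∀ y, φ y + c * t ≠ 0) (T : (mordell D).Point) :
    mordellMap φ c t T ≠ 0 := by
  rcases T with _ | ⟨x, y, h⟩
  · exact one_ne_zero
  · exact hc y

variable [CharZero F] [DecidableEq F] {D : F} {φ : F →+* K} {c t : K}

/-- The function `y + c * t` is a homomorphism modulo cubes. -/
theorem exists_mordellMap_add (hD : D ≠ 0) (hφ : φ D = c ^ 2 * t ^ 2) (hc : ∀ y, φ y + c * t ≠ 0)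
    (S T : (mordell D).Point) :
    ∃ z : K, z ≠ 0 ∧ mordellMap φ c t (S + T) * z ^ 3 =
      mordellMap φ c t S * mordellMap φ c t T := by
  have hneg : ∀ x y, (mordell D).Nonsingular x y →
      (φ y + c * t) * (φ (-y) + c * t) = (-φ x) ^ 3 := by
    intro x y h
    have := congrArg φ ((mordell_nonsingular_iff hD).1 h)
    rw [map_pow, map_add, map_pow, hφ] at this
    rw [map_neg]
    linear_combination -this
  have hX : ∀ x y, (mordell D).Nonsingular x y → -φ x ≠ 0 := fun x y h h0 => by
    have := hneg x y h
    rw [h0, zero_pow three_ne_zero] at this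
    exact mul_ne_zero (hc _) (hc _) this
  rcases S with _ | ⟨x₁, y₁, h₁⟩
  · exact ⟨1, one_ne_zero, by simp [← Point.zero_def, mordellMap]⟩
  rcases T with _ | ⟨x₂, y₂, h₂⟩
  · exact ⟨1, one_ne_zero, by simp [← Point.zero_def, mordellMap]⟩
  by_cases h : Point.some x₁ y₁ h₁ + Point.some x₂ y₂ h₂ = 0
  · refine ⟨-φ x₁, hX _ _ h₁, ?_⟩
    have h' := eq_neg_of_add_eq_zero_right h
    rw [Point.neg_some, Point.some.injEq] at h'
    rw [h]
    have hy : y₂ = -y₁ := by rw [h'.2]; simp [negY]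
    change 1 * _ = (φ y₁ + c * t) * (φ y₂ + c * t)
    rw [hy, hneg _ _ h₁, one_mul]
  · obtain ⟨ℓ, m, x₃, y₃, h₃, hsum, ⟨hl₁, hl₂, hl₃⟩, he₁, he₂, he₃⟩ := mordell_exists_line h
    have hy : (mordell D).negY x₃ y₃ = -y₃ := by simp [negY]
    have hprod : (φ y₁ + c * t) * (φ y₂ + c * t) * (φ y₃ + c * t) = (φ m + c * t) ^ 3 := by
      have he₁ := congrArg φ he₁
      have he₂ := congrArg φ he₂
      have he₃ := congrArg φ he₃
      simp only [map_add, map_mul, map_neg, map_sub, map_pow, map_ofNat, hφ] at he₁ he₂ he₃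
      rw [hl₁, hl₂, hl₃]
      simp only [map_add, map_mul]
      linear_combination φ ℓ ^ 3 * he₃ + φ ℓ ^ 2 * (φ m + c * t) * he₂ +
        φ ℓ * (φ m + c * t) ^ 2 * he₁
    have hM : φ m + c * t ≠ 0 := by
      intro h0
      rw [h0, zero_pow three_ne_zero] at hprod
      exact mul_ne_zero (mul_ne_zero (hc _) (hc _)) (hc _) hprod
    refine ⟨(φ m + c * t) / -φ x₃, div_ne_zero hM (hX _ _ h₃), ?_⟩
    rw [hsum, Point.neg_some]
    change (φ ((mordell D).negY x₃ y₃) + c * t) * _ = (φ y₁ + c * t) * (φ y₂ + c * t)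
    rw [hy, div_pow, ← hneg _ _ h₃, ← hprod]
    have := hc (-y₃)
    have := hc y₃
    field_simp

end WeierstrassCurve.Affine

open WeierstrassCurve.Affine

/-- A presentation of `K` as the quadratic extension `F(t)` of `F`. -/
structure IsQuadraticBasis {F K : Type*} [Field F] [Field K] (φ : F →+* K) (t : K) : Prop where
  exists_eq : ∀ z, ∃ p q, z = φ p + φ q * t
  eq_zero : ∀ {p q}, φ p + φ q * t = 0 → p = 0 ∧ q = 0

namespace IsQuadraticBasis

variable {F K : Type*} [Field F] [Field K] {φ : F →+* K} {t : K}

theorem eq_of_eq (H : IsQuadraticBasis φ t) {a b p q : F}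
    (h : φ a + φ b * t = φ p + φ q * t) : a = p ∧ b = q := by
  have := H.eq_zero (p := a - p) (q := b - q) (by rw [map_sub, map_sub]; linear_combination h)
  rwa [sub_eq_zero, sub_eq_zero] at this

theorem add_ne_zero (H : IsQuadraticBasis φ t) {c : F} (hc : c ≠ 0) (y : F) : φ y + φ c * t ≠ 0 :=
  fun h => hc (H.eq_zero h).2

theorem exists_eq_of_cube (H : IsQuadraticBasis φ t) {d a b : F} {z : K} (ht : t ^ 2 = φ d)
    (h : φ a + φ b * t = z ^ 3) :
    ∃ p q, a = p ^ 3 + 3 * d * p * q ^ 2 ∧ b = 3 * p ^ 2 * q + d * q ^ 3 := by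
  obtain ⟨p, q, rfl⟩ := H.exists_eq z
  refine ⟨p, q, H.eq_of_eq (h.trans ?_)⟩
  simp only [map_add, map_mul, map_pow, map_ofNat]
  linear_combination (3 * φ p * φ q ^ 2 + φ q ^ 3 * t) * ht

theorem of_quadraticAlgebra (d : F) [Fact (∀ r : F, r ^ 2 ≠ d + 0 * r)] :
    IsQuadraticBasis (algebraMap F (QuadraticAlgebra F d 0)) ⟨0, 1⟩ where
  exists_eq z := ⟨z.re, z.im, by ext <;> simp⟩
  eq_zero {p q} h := by
    have h1 := congrArg QuadraticAlgebra.re h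
    have h2 := congrArg QuadraticAlgebra.im h
    simp at h1 h2
    exact ⟨h1, h2⟩

theorem sq_eq (d : F) : (⟨0, 1⟩ : QuadraticAlgebra F d 0) ^ 2 = algebraMap F _ d := by
  ext <;> simp [pow_two]

end IsQuadraticBasis

namespace RatSqrtSix

theorem exists_ringHom_real : Nonempty (RatSqrtSix →+* ℝ) :=
  ⟨embed (σ := √6) (Real.sq_sqrt (by norm_num))⟩

theorem cube_injective {a b : RatSqrtSix} (h : a ^ 3 = b ^ 3) : a = b := by
  obtain ⟨f⟩ := exists_ringHom_real
  refine f.injective ((Odd.strictMono_pow (by decide : Odd 3)).injective ?_)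
  change f a ^ 3 = f b ^ 3
  rw [← map_pow, h, map_pow]

theorem sq_add_six_mul_sq_ne_zero {m n : RatSqrtSix} (hn : n ≠ 0) : m ^ 2 + 6 * n ^ 2 ≠ 0 := by
  obtain ⟨f⟩ := exists_ringHom_real
  intro h
  have h := congrArg f h
  simp only [map_add, map_mul, map_pow, map_ofNat, map_zero] at h
  have : 0 < f n ^ 2 := by
    have := (map_ne_zero f).2 hn
    positivity
  nlinarith [sq_nonneg (f m)]

theorem two_mul_eta_sq_ne_zero : 2 * eta ^ 2 ≠ 0 :=
  mul_ne_zero two_ne_zero (pow_ne_zero 2 eta_ne_zero)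

theorem isQuadraticBasis_sqrt_neg_six : IsQuadraticBasis
    (algebraMap RatSqrtSix (QuadraticAlgebra RatSqrtSix (-6) 0)) ⟨0, 1⟩ :=
  IsQuadraticBasis.of_quadraticAlgebra (-6)

/-- If `y + √2 * eta` is a cube then `(x, y)` is divisible by `3`. -/
theorem exists_eq_three_nsmul {x y p q : RatSqrtSix}
    (hT : (mordell (2 * eta ^ 2)).Nonsingular x y) (hy : y = p ^ 3 + 6 * p * q ^ 2)
    (hq : eta = 3 * p ^ 2 * q + 2 * q ^ 3) :
    ∃ R : (mordell (2 * eta ^ 2)).Point, Point.some x y hT = 3 • R := by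
  have hxy := (mordell_nonsingular_iff two_mul_eta_sq_ne_zero).1 hT
  have hx : x = p ^ 2 - 2 * q ^ 2 := cube_injective (by
    linear_combination -hxy + (y + p ^ 3 + 6 * p * q ^ 2) * hy -
      2 * (eta + 3 * p ^ 2 * q + 2 * q ^ 3) * hq)
  have hq0 : q ≠ 0 := by
    rintro rfl
    exact eta_ne_zero (by rw [hq]; ring)
  rcases eq_or_ne p 0 with rfl | hp0
  · refine ⟨Point.some x y hT, ?_⟩
    rw [show (3 : ℕ) = 2 + 1 from rfl, add_nsmul, two_nsmul, one_nsmul,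
      Point.add_self_of_Y_eq (by rw [hy]; simp [negY]), zero_add]
  have hv : (3 * p / q) ^ 2 + 6 = 3 * eta * q⁻¹ ^ 3 := by
    rw [hq]; field_simp; ring
  have H := isQuadraticBasis_sqrt_neg_six
  have ht := IsQuadraticBasis.sq_eq (-6 : RatSqrtSix)
  generalize algebraMap RatSqrtSix (QuadraticAlgebra RatSqrtSix (-6) 0) = φ at H ht
  generalize (⟨0, 1⟩ : QuadraticAlgebra RatSqrtSix (-6) 0) = t at H ht
  obtain ⟨z, hz⟩ := exists_three_mul_eta_mul_eq_cube φ (by rw [ht, map_neg, map_ofNat]) hq0 hv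
    (by simpa using H.add_ne_zero one_ne_zero (3 * p / q))
  obtain ⟨m, n, hm, hn⟩ := H.exists_eq_of_cube (a := 3 * eta * (3 * p / q)) (b := 3 * eta) ht
    (by rw [← hz, map_mul, map_mul, map_ofNat]; ring)
  have hnu : n * (m ^ 2 - 2 * n ^ 2) = eta := by linear_combination -hn / 3
  have hn0 : n ≠ 0 := left_ne_zero_of_mul (hnu.trans_ne eta_ne_zero)
  have hu0 := right_ne_zero_of_mul (hnu.trans_ne eta_ne_zero)
  have hw0 := sq_add_six_mul_sq_ne_zero (m := m) hn0
  have hqw : q * (m ^ 2 + 6 * n ^ 2) = 3 * eta := cube_injective (by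
    have h1 : (m ^ 2 + 6 * n ^ 2) ^ 3 = (3 * eta) ^ 2 * ((3 * p / q) ^ 2 + 6) := by
      linear_combination -(3 * eta * (3 * p / q) + m ^ 3 - 18 * m * n ^ 2) * hm -
        6 * (3 * eta + 3 * m ^ 2 * n - 6 * n ^ 3) * hn
    rw [mul_pow, h1, hv]
    field_simp)
  have hpm : p = m * (m ^ 2 - 18 * n ^ 2) / (3 * (m ^ 2 + 6 * n ^ 2)) := by
    have hw : m ^ 2 + 6 * n ^ 2 = 3 * eta / q := by rw [← hqw]; field_simp
    rw [eq_div_iff (mul_ne_zero three_ne_zero hw0)]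
    linear_combination 3 * p * hw + hm
  have hm0 : m ≠ 0 := by
    rintro rfl
    exact hp0 (by rw [hpm]; ring)
  have hR : (mordell (2 * eta ^ 2)).Nonsingular (m ^ 2 - 2 * n ^ 2) ((m ^ 2 - 2 * n ^ 2) * m) := by
    rw [mordell_nonsingular_iff two_mul_eta_sq_ne_zero, ← hnu]; ring
  exact ⟨_, mordell_three_nsmul rfl rfl hm0 hu0 hw0 hpm
    (by rw [eq_div_iff hw0, hqw, ← hnu]; ring) hx hy hR hT⟩


/-- The curve `y² = x³ + 2 * eta²` over `ℚ(√6)`. -/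
abbrev curve : WeierstrassCurve.Affine RatSqrtSix := mordell (2 * eta ^ 2)

theorem nonsingular_gen : curve.Nonsingular eta (-eta * (1 + sqrtSix)) := by
  rw [mordell_nonsingular_iff two_mul_eta_sq_ne_zero]
  have h : (1 + sqrtSix) ^ 2 = eta + 2 := by rw [eta]; linear_combination sqrtSix_sq
  linear_combination eta ^ 2 * h

/-- A generator of the group of points modulo `3`. -/
def gen : curve.Point := .some _ _ nonsingular_gen

section descent

variable {K : Type} [Field K] [CharZero K] {φ : RatSqrtSix →+* K} {t : K}

theorem exists_mordellMap_nsmul (H : IsQuadraticBasis φ t) (ht : t ^ 2 = 2) (T : curve.Point)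
    (n : ℕ) : ∃ z : K, z ≠ 0 ∧
      mordellMap φ (φ eta) t (n • T) * z ^ 3 = mordellMap φ (φ eta) t T ^ n := by
  have hD : φ (2 * eta ^ 2) = φ eta ^ 2 * t ^ 2 := by
    rw [ht, map_mul, map_pow, map_ofNat, mul_comm]
  induction n with
  | zero =>
    refine ⟨1, one_ne_zero, ?_⟩
    rw [zero_nsmul, pow_zero, one_pow, mul_one]
    rfl
  | succ n ih =>
    obtain ⟨z, hz, h⟩ := ih
    obtain ⟨w, hw, h'⟩ := exists_mordellMap_add two_mul_eta_sq_ne_zero hD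
      (H.add_ne_zero eta_ne_zero) (n • T) T
    refine ⟨z * w, mul_ne_zero hz hw, ?_⟩
    rw [add_nsmul, one_nsmul, pow_succ (mordellMap φ (φ eta) t T), ← h]
    linear_combination z ^ 3 * h'

theorem mordellMap_gen (ht : t ^ 2 = 2) : (3 + 2 * t) * (2 + φ sqrtSix * t / 2) *
    mordellMap φ (φ eta) t gen = (-(2 + φ sqrtSix + t + φ sqrtSix * t / 2)) ^ 3 := by
  have hs : φ sqrtSix ^ 2 = 6 := by rw [← map_pow, sqrtSix_sq, map_ofNat]
  change _ * (φ (-eta * (1 + sqrtSix)) + φ eta * t) = _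
  simp only [eta, map_mul, map_neg, map_add, map_one, map_ofNat]
  generalize φ sqrtSix = s at hs
  have hs3 : s ^ 3 = 6 * s := by linear_combination s * hs
  have ht3 : t ^ 3 = 2 * t := by linear_combination t * ht
  ring_nf
  simp only [hs, ht, hs3, ht3]
  ring_nf

theorem mordellMap_ne_unit_mul_cube (H : IsQuadraticBasis φ t) (ht : t ^ 2 = 2) {T : curve.Point}
    (hT : T ≠ 0) (z : K) : mordellMap φ (φ eta) t T ≠ (1 + t) * z ^ 3 := by
  intro h
  rcases T with _ | ⟨x, y, hxy⟩
  · exact hT rfl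
  obtain ⟨a, b, hab⟩ := H.exists_eq (z ^ 3)
  obtain ⟨p, q, hp, hq⟩ := H.exists_eq_of_cube (d := 2) (by rw [ht, map_ofNat]) hab.symm
  have h' : φ y + φ eta * t = φ (a + 2 * b) + φ (a + b) * t := by
    refine h.trans ?_
    rw [hab]
    simp only [map_add, map_mul, map_ofNat]
    linear_combination φ b * ht
  refine cubic_form_ne_eta p q ?_
  rw [(H.eq_of_eq h').2, hp, hq]
  ring

theorem three_dvd_of_mordellMap_eq (H : IsQuadraticBasis φ t) (ht : t ^ 2 = 2) {T : curve.Point}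
    (hT : T ≠ 0) {k : ℕ} {z : K} (h : mordellMap φ (φ eta) t T = (1 + t) ^ k * z ^ 3) : 3 ∣ k := by
  have hD : φ (2 * eta ^ 2) = φ eta ^ 2 * t ^ 2 := by
    rw [ht, map_mul, map_pow, map_ofNat, mul_comm]
  obtain ⟨w, hw, h'⟩ := exists_mordellMap_add two_mul_eta_sq_ne_zero hD
    (H.add_ne_zero eta_ne_zero) T (-T)
  rw [add_neg_cancel, show mordellMap φ (φ eta) t (0 : curve.Point) = 1 from rfl, one_mul] at h'
  have hne := mordellMap_ne_zero (H.add_ne_zero eta_ne_zero) T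
  rw [h] at hne
  by_contra h3
  obtain ⟨m, rfl | rfl⟩ : ∃ m, k = 3 * m + 1 ∨ k = 3 * m + 2 := ⟨k / 3, by omega⟩
  · refine mordellMap_ne_unit_mul_cube H ht hT ((1 + t) ^ m * z) ?_
    rw [h]; ring
  · refine mordellMap_ne_unit_mul_cube H ht (neg_ne_zero.2 hT) (w / ((1 + t) ^ (m + 1) * z)) ?_
    have hz : z ≠ 0 := by rintro rfl; simp at hne
    have h1 : 1 + t ≠ 0 := by intro h0; rw [h0] at hne; simp at hne
    rw [h] at h'
    rw [div_pow, h']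
    field_simp
    ring

theorem exists_mordellMap_add_nsmul_eq (H : IsQuadraticBasis φ t) (ht : t ^ 2 = 2)
    (T : curve.Point) : ∃ (n k : ℕ) (z : K),
      mordellMap φ (φ eta) t (T + n • gen) = (1 + t) ^ k * z ^ 3 := by
  have hD : φ (2 * eta ^ 2) = φ eta ^ 2 * t ^ 2 := by
    rw [ht, map_mul, map_pow, map_ofNat, mul_comm]
  obtain ⟨i, j, z, hz⟩ : ∃ (i j : ℕ) (z : K), mordellMap φ (φ eta) t T =
      (3 + 2 * t) ^ i * (2 + φ sqrtSix * t / 2) ^ j * z ^ 3 := by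
    rcases T with _ | ⟨x, y, h⟩
    · exact ⟨0, 0, 1, by simp [mordellMap]⟩
    have hxy := (mordell_nonsingular_iff two_mul_eta_sq_ne_zero).1 h
    refine exists_eq_unit_mul_cube φ ht ?_ hxy (H.add_ne_zero eta_ne_zero y)
    rintro rfl
    exact fact_sq_ne_two.out (y / eta) (by
      rw [div_pow, hxy, div_eq_iff (pow_ne_zero 2 eta_ne_zero)]; ring)
  obtain ⟨w, hw, h1⟩ := exists_mordellMap_add two_mul_eta_sq_ne_zero hD
    (H.add_ne_zero eta_ne_zero) T (j • gen)
  obtain ⟨v, hv, h2⟩ := exists_mordellMap_nsmul H ht gen j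
  have h3 := congrArg (· ^ j) (mordellMap_gen (φ := φ) ht)
  simp only [mul_pow] at h3
  have hth : 3 + 2 * t = (1 + t) ^ 2 := by linear_combination -ht
  rw [hth] at h3 hz
  rw [hz] at h1
  have h0 : 1 + t ≠ 0 := by
    simpa using H.add_ne_zero one_ne_zero 1
  refine ⟨j, 2 * (i + 2 * j),
    (-(2 + φ sqrtSix + t + φ sqrtSix * t / 2)) ^ j * z / ((1 + t) ^ (2 * j) * v * w), ?_⟩
  generalize mordellMap φ (φ eta) t (T + j • gen) = A at *
  generalize mordellMap φ (φ eta) t (j • gen) = B at *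
  generalize mordellMap φ (φ eta) t gen ^ j = C at *
  generalize -(2 + φ sqrtSix + t + φ sqrtSix * t / 2) = d at *
  generalize (2 + φ sqrtSix * t / 2) ^ j = e at *
  generalize 1 + t = a at *
  rw [div_pow, mul_div_assoc', eq_div_iff (by simp [h0, hv, hw])]
  linear_combination a ^ (6 * j) * v ^ 3 * h1 + a ^ (6 * j + 2 * i) * e * z ^ 3 * h2 +
    a ^ (4 * j + 2 * i) * z ^ 3 * h3

end descent

/-- Every point is congruent to a multiple of `gen` modulo `3`. -/
theorem exists_eq_zsmul_gen_add (T : curve.Point) :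
    ∃ (n : ℤ) (R : curve.Point), |n| ≤ 1 ∧ T = n • gen + 3 • R := by
  have H : IsQuadraticBasis (algebraMap RatSqrtSix (QuadraticAlgebra RatSqrtSix 2 0)) ⟨0, 1⟩ :=
    IsQuadraticBasis.of_quadraticAlgebra 2
  have ht := IsQuadraticBasis.sq_eq (2 : RatSqrtSix)
  have : CharZero (QuadraticAlgebra RatSqrtSix 2 0) :=
    charZero_of_injective_algebraMap (algebraMap RatSqrtSix _).injective
  generalize algebraMap RatSqrtSix (QuadraticAlgebra RatSqrtSix 2 0) = φ at H ht
  generalize (⟨0, 1⟩ : QuadraticAlgebra RatSqrtSix 2 0) = t at H ht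
  rw [map_ofNat] at ht
  have key : ∃ (n : ℕ) (R : curve.Point), T + n • gen = 3 • R := by
    obtain ⟨n, k, z, hz⟩ := exists_mordellMap_add_nsmul_eq H ht T
    refine ⟨n, ?_⟩
    by_cases h0 : T + n • gen = 0
    · exact ⟨0, by rw [h0, nsmul_zero]⟩
    obtain ⟨m, rfl⟩ := three_dvd_of_mordellMap_eq H ht h0 hz
    generalize T + n • gen = S at *
    rcases S with _ | ⟨x, y, h⟩
    · exact absurd rfl h0
    obtain ⟨p, q, hp, hq⟩ := H.exists_eq_of_cube (d := 2) (a := y) (b := eta)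
      (z := (1 + t) ^ m * z) (by rw [ht, map_ofNat]) (by
        refine (Eq.trans ?_ hz).trans ?_
        · rfl
        · ring)
    exact exists_eq_three_nsmul h (by rw [hp]; ring) hq
  obtain ⟨n, R, hR⟩ := key
  rw [← eq_sub_iff_add_eq] at hR
  obtain ⟨a, rfl | rfl | rfl⟩ : ∃ a, n = 3 * a ∨ n = 3 * a + 1 ∨ n = 3 * a + 2 :=
    ⟨n / 3, by omega⟩
  · exact ⟨0, R - a • gen, by simp, by rw [hR]; module⟩
  · exact ⟨-1, R - a • gen, by simp, by rw [hR]; module⟩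
  · exact ⟨1, R - (a + 1) • gen, by simp, by rw [hR]; module⟩


theorem av_one_add_two_mul_eta_sq : av (1 + 2 * eta ^ 2) = 1 / 3 := by
  have h : 1 + 2 * eta ^ 2 = sqrtSix * ((40 : ℤ) + (33 / 2 : ℚ) * sqrtSix) := by
    rw [eta]; push_cast; linear_combination (8 - 33 / 2) * sqrtSix_sq
  have h2 : (2 : RatSqrtSix) * ((40 : ℤ) + (33 / 2 : ℚ) * sqrtSix) =
      (80 : ℤ) + (33 : ℤ) * sqrtSix := by push_cast; ring
  have h3 := congrArg av h2
  rw [av_mul, av_two, one_mul, av_int_add_mul_eq_one (by norm_num)] at h3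
  rw [h, av_mul, h3, av_sqrtSix, mul_one]

/-- The reduction of `curve` at the prime above `3`, moved to the cusp. -/
theorem av_y_sq {x y : RatSqrtSix} (h : y ^ 2 = x ^ 3 + 2 * eta ^ 2) :
    1 ≤ av (x - 1) ∧ av y ^ 2 = av (x - 1) ^ 3 := by
  obtain ⟨e, rfl⟩ : ∃ e, x = e + 1 := ⟨x - 1, by ring⟩
  rw [add_sub_cancel_right]
  have he0 := av_nonneg e
  have hy : av y ^ 2 = av (e ^ 3 + (3 * (e * (e + 1)) + (1 + 2 * eta ^ 2))) := by
    rw [← av_pow, h]; ring_nf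
  have hδ := av_one_add_two_mul_eta_sq
  rcases lt_or_ge (av e) 1 with hlt | hge
  · exfalso
    have hlt' : av e ≤ 1 / 3 := by simpa [av_one] using av_le_div_three_of_lt (y := 1) (by rwa [av_one])
    have h1 : av (e ^ 3 + 3 * (e * (e + 1))) < 1 / 3 := by
      refine av_add_lt ?_ ?_
      · rw [av_pow]
        calc av e ^ 3 ≤ (1 / 3) ^ 3 := by gcongr
          _ < _ := by norm_num
      · rw [av_mul, av_mul, av_three]
        have h1 : av (e + 1) ≤ 1 := av_add_le hlt.le av_one.le
        have := mul_le_one₀ hlt.le (av_nonneg _) h1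
        linarith
    have h2 := av_add_eq_left (hδ ▸ h1)
    rw [show e ^ 3 + (3 * (e * (e + 1)) + (1 + 2 * eta ^ 2)) =
      (1 + 2 * eta ^ 2) + (e ^ 3 + 3 * (e * (e + 1))) by ring, h2, hδ] at hy
    have hy0 : y ≠ 0 := by rintro rfl; norm_num [av_zero] at hy
    obtain ⟨k, hk⟩ := exists_av_eq_zpow hy0
    rw [hk, ← zpow_natCast, ← zpow_mul, show (1 / 3 : ℚ) = 3 ^ (-1 : ℤ) by norm_num] at hy
    have := zpow_right_injective₀ (by norm_num : (0 : ℚ) < 3) (by norm_num) hy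
    push_cast at this
    omega
  · refine ⟨hge, ?_⟩
    have h3 : (1 : ℚ) ≤ av e ^ 3 := one_le_pow₀ hge
    rw [hy, ← av_pow]
    refine av_add_eq_left (av_add_lt ?_ ?_)
    · rw [av_mul, av_mul, av_three, av_pow]
      have h1 : av (e + 1) ≤ av e := av_add_le le_rfl (av_one.trans_le hge)
      have : av e * av (e + 1) ≤ av e ^ 3 := by
        calc av e * av (e + 1) ≤ av e * av e := by gcongr
          _ ≤ av e * av e * av e := le_mul_of_one_le_right (by positivity) hge
          _ = _ := by ring
      linarith
    · rw [hδ, av_pow]; linarith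

/-- A local parameter at infinity, adapted to the cusp of the reduction at `3`. -/
def zParam : curve.Point → RatSqrtSix
  | .zero => 0
  | .some x y _ => (x - 1) / y

theorem zParam_zero : zParam 0 = 0 := rfl

theorem zParam_neg (T : curve.Point) : zParam (-T) = -zParam T := by
  rcases T with _ | ⟨x, y, h⟩
  · exact neg_zero.symm
  · rw [Point.neg_some]
    change (x - 1) / (curve.negY x y) = -((x - 1) / y)
    rw [show curve.negY x y = -y by simp [negY], div_neg]

theorem av_zParam_some {x y : RatSqrtSix} (h : curve.Nonsingular x y) :
    av (zParam (.some x y h)) ^ 3 * av y = 1 ∧ 1 ≤ av y := by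
  obtain ⟨h1, h2⟩ := av_y_sq ((mordell_nonsingular_iff two_mul_eta_sq_ne_zero).1 h)
  have hy : 1 ≤ av y := by
    refine le_of_pow_le_pow_left₀ two_ne_zero (av_nonneg y) ?_
    rw [h2, one_pow]
    exact one_le_pow₀ h1
  have hy0 : 0 < av y := by linarith
  refine ⟨?_, hy⟩
  change av ((x - 1) / y) ^ 3 * av y = 1
  rw [av_div, div_pow, ← h2]
  field_simp

theorem av_zParam_le_one (T : curve.Point) : av (zParam T) ≤ 1 := by
  rcases T with _ | ⟨x, y, h⟩
  · exact av_zero.trans_le zero_le_one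
  · obtain ⟨h1, h2⟩ := av_zParam_some h
    rw [← pow_le_one_iff_of_nonneg (av_nonneg _) three_ne_zero]
    nlinarith [pow_nonneg (av_nonneg (zParam (.some x y h))) 3]

theorem zParam_ne_zero {T : curve.Point} (hT : T ≠ 0) : zParam T ≠ 0 := by
  rcases T with _ | ⟨x, y, h⟩
  · exact absurd rfl hT
  · intro h0
    have := (av_zParam_some h).1
    rw [h0, av_zero] at this
    norm_num at this

theorem av_zParam_line {x₁ y₁ x₂ y₂ x₃ y₃ ℓ m : RatSqrtSix} (h₁ : curve.Nonsingular x₁ y₁)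
    (h₂ : curve.Nonsingular x₂ y₂) (h₃ : curve.Nonsingular x₃ y₃) (hl₁ : y₁ = ℓ * x₁ + m)
    (hl₂ : y₂ = ℓ * x₂ + m) (hl₃ : y₃ = ℓ * x₃ + m) (he₁ : x₁ + x₂ + x₃ = ℓ ^ 2)
    (he₂ : x₁ * x₂ + x₁ * x₃ + x₂ * x₃ = -2 * ℓ * m) (he₃ : x₁ * x₂ * x₃ = m ^ 2 - 2 * eta ^ 2) :
    av (zParam (.some x₁ y₁ h₁) + zParam (.some x₂ y₂ h₂) + zParam (.some x₃ y₃ h₃)) ≤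
      av (zParam (.some x₁ y₁ h₁)) * av (zParam (.some x₂ y₂ h₂)) *
        av (zParam (.some x₃ y₃ h₃)) / 9 := by
  obtain ⟨n, rfl⟩ : ∃ n, m = n - ℓ := ⟨m + ℓ, by ring⟩
  obtain ⟨δ, hδ⟩ : ∃ δ, δ = 1 + 2 * eta ^ 2 := ⟨_, rfl⟩
  have havδ : av δ = 1 / 3 := by rw [hδ, av_one_add_two_mul_eta_sq]
  have hprod : y₁ * y₂ * y₃ = n ^ 3 + (3 * (n * ℓ * (ℓ - n)) - δ * ℓ ^ 3) := by
    rw [hl₁, hl₂, hl₃, hδ]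
    linear_combination ℓ ^ 3 * he₃ + ℓ ^ 2 * (n - ℓ) * he₂ + ℓ * (n - ℓ) ^ 2 * he₁
  have hsum : (x₁ - 1) * y₂ * y₃ + (x₂ - 1) * y₁ * y₃ + (x₃ - 1) * y₁ * y₂ =
      -(3 * (n * (n - 2 * ℓ) + δ * ℓ ^ 2)) := by
    rw [hl₁, hl₂, hl₃, hδ]
    linear_combination 3 * ℓ ^ 2 * (he₃ - he₂ + he₁) + 2 * ℓ * n * (he₂ - 2 * he₁) + n ^ 2 * he₁
  obtain ⟨hz₁, hy₁⟩ := av_zParam_some h₁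
  obtain ⟨hz₂, hy₂⟩ := av_zParam_some h₂
  obtain ⟨hz₃, hy₃⟩ := av_zParam_some h₃
  have hy₁' : y₁ ≠ 0 := by rintro rfl; norm_num [av_zero] at hy₁
  have hy₂' : y₂ ≠ 0 := by rintro rfl; norm_num [av_zero] at hy₂
  have hy₃' : y₃ ≠ 0 := by rintro rfl; norm_num [av_zero] at hy₃
  have hzsum : zParam (.some x₁ y₁ h₁) + zParam (.some x₂ y₂ h₂) + zParam (.some x₃ y₃ h₃) =
      -(3 * (n * (n - 2 * ℓ) + δ * ℓ ^ 2)) / (y₁ * y₂ * y₃) := by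
    rw [← hsum]
    change (x₁ - 1) / y₁ + (x₂ - 1) / y₂ + (x₃ - 1) / y₃ = _
    field_simp
  rw [hzsum, av_div, av_neg, av_mul, av_three]
  generalize hz₁' : zParam (.some x₁ y₁ h₁) = z₁ at *
  generalize hz₂' : zParam (.some x₂ y₂ h₂) = z₂ at *
  generalize hz₃' : zParam (.some x₃ y₃ h₃) = z₃ at *
  obtain ⟨d, hd⟩ : ∃ d, d = y₁ * y₂ * y₃ := ⟨_, rfl⟩
  rw [← hd] at hprod ⊢
  have hzd : av (z₁ * z₂ * z₃) ^ 3 * av d = 1 := by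
    rw [hd]
    simp only [av_mul]
    rw [mul_pow, mul_pow]
    calc _ = av z₁ ^ 3 * av y₁ * (av z₂ ^ 3 * av y₂) * (av z₃ ^ 3 * av y₃) := by ring
      _ = 1 := by rw [hz₁, hz₂, hz₃]; norm_num
  rw [← av_mul z₁, ← av_mul]
  generalize z₁ * z₂ * z₃ = z at *
  have hn0 := av_nonneg n
  have hℓ0 := av_nonneg ℓ
  have hle : av ℓ ≤ av n := by
    by_contra! hlt
    have hle := av_le_div_three_of_lt hlt
    have hℓ : 0 < av ℓ := hn0.trans_lt hlt
    have hℓ3 : 0 < av ℓ ^ 3 := by positivity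
    have hδℓ : av (-(δ * ℓ ^ 3)) = av ℓ ^ 3 / 3 := by rw [av_neg, av_mul, av_pow, havδ]; ring
    have hrest : av (n ^ 3 + 3 * (n * ℓ * (ℓ - n))) < av ℓ ^ 3 / 3 := by
      refine av_add_lt ?_ ?_
      · rw [av_pow]
        calc av n ^ 3 ≤ (av ℓ / 3) ^ 3 := by gcongr
          _ < _ := by linarith
      · rw [av_mul, av_mul, av_mul, av_three]
        have h0 := av_nonneg (ℓ - n)
        have h1 : av (ℓ - n) ≤ av ℓ := av_sub_le le_rfl hlt.le
        have : av n * av ℓ * av (ℓ - n) ≤ av ℓ / 3 * av ℓ * av ℓ := by gcongr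
        linarith
    have hd' := av_add_eq_left (hδℓ ▸ hrest)
    rw [hδℓ, show -(δ * ℓ ^ 3) + (n ^ 3 + 3 * (n * ℓ * (ℓ - n))) = d by rw [hprod]; ring] at hd'
    rw [hd'] at hzd
    have hz : z * ℓ ≠ 0 := by
      intro h0
      have := congrArg av h0
      rw [av_mul, av_zero] at this
      rcases mul_eq_zero.1 this with h | h
      · rw [h] at hzd; norm_num at hzd
      · exact hℓ.ne' h
    refine zpow_three_mul_ne hz (a := 3) (n := 1) (by norm_num) (by norm_num) ?_
    rw [av_mul, mul_pow]
    linear_combination 3 * hzd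
  have hn : 0 < av n := by
    refine lt_of_le_of_ne hn0 fun h0 => ?_
    have h1 : n = 0 := av_eq_zero_iff.1 h0.symm
    have h2 : ℓ = 0 := av_eq_zero_iff.1 (le_antisymm (hle.trans_eq h0.symm) hℓ0)
    rw [hprod, h1, h2] at hzd
    simp [av_zero] at hzd
  have hn3 : 0 < av n ^ 3 := by positivity
  have hsub : ∀ {w}, av w ≤ av n → av (n - w) ≤ av n := av_sub_le le_rfl
  have hd3 : av d = av n ^ 3 := by
    rw [hprod, av_add_eq_left, av_pow]
    rw [av_pow]
    refine av_sub_lt ?_ ?_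
    · rw [av_mul, av_mul, av_mul, av_three, av_sub_comm]
      have := av_nonneg (n - ℓ)
      have := hsub hle
      have : av n * av ℓ * av (n - ℓ) ≤ av n * av n * av n := by gcongr
      linarith
    · rw [av_mul, av_pow, havδ]
      have : av ℓ ^ 3 ≤ av n ^ 3 := by gcongr
      linarith
  have hzn : av z * av n = 1 := by
    rw [← pow_eq_one_iff_of_nonneg (mul_nonneg (av_nonneg z) hn0) three_ne_zero, mul_pow, ← hd3, hzd]
  have hnum : av (n * (n - 2 * ℓ) + δ * ℓ ^ 2) ≤ av n ^ 2 := by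
    refine av_add_le ?_ ?_
    · rw [av_mul, pow_two]
      gcongr
      exact hsub (by rwa [av_mul, av_two, one_mul])
    · rw [av_mul, av_pow, havδ]
      have : av ℓ ^ 2 ≤ av n ^ 2 := by gcongr
      nlinarith [sq_nonneg (av n)]
  rw [hd3, div_le_iff₀ hn3]
  calc 1 / 9 * av (n * (n - 2 * ℓ) + δ * ℓ ^ 2) ≤ 1 / 9 * av n ^ 2 := by gcongr
    _ = (av z * av n) * av n ^ 2 / 9 := by rw [hzn]; ring
    _ = _ := by ring

theorem av_zParam_add (S T : curve.Point) :
    av (zParam (S + T) - zParam S - zParam T) ≤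
      av (zParam S) * av (zParam T) * av (zParam (S + T)) / 9 := by
  by_cases h : S + T = 0
  · rw [h, eq_neg_of_add_eq_zero_left h, zParam_neg, zParam_zero, av_zero]
    simp [av_zero]
  rcases S with _ | ⟨x₁, y₁, h₁⟩
  · rw [← Point.zero_def]; simp [zParam_zero, av_zero]
  rcases T with _ | ⟨x₂, y₂, h₂⟩
  · rw [← Point.zero_def]; simp [zParam_zero, av_zero]
  obtain ⟨ℓ, m, x₃, y₃, h₃, hsum, ⟨hl₁, hl₂, hl₃⟩, he₁, he₂, he₃⟩ := mordell_exists_line h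
  have := av_zParam_line h₁ h₂ h₃ hl₁ hl₂ hl₃ he₁ he₂ he₃
  rw [hsum, zParam_neg, av_neg, sub_sub, ← neg_add', av_neg]
  convert this using 2
  ring

theorem av_zParam_add_le {S T : curve.Point} {c : ℚ} (hS : av (zParam S) ≤ c)
    (hT : av (zParam T) ≤ c) : av (zParam (S + T)) ≤ c := by
  have h := av_zParam_add S T
  have h0 := av_nonneg (zParam S)
  have h1 := mul_le_mul_of_nonneg_left (av_zParam_le_one T) h0
  have h2 := mul_le_mul_of_nonneg_left (av_zParam_le_one (S + T))
    (mul_nonneg h0 (av_nonneg (zParam T)))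
  have h3 : av (zParam (S + T) - zParam S - zParam T) ≤ c := by linarith
  rw [show zParam (S + T) = (zParam (S + T) - zParam S - zParam T) + (zParam S + zParam T) by ring]
  exact av_add_le h3 (av_add_le hS hT)

theorem av_zParam_three_nsmul_sub (T : curve.Point) :
    av (zParam (3 • T) - 3 * zParam T) ≤ av (zParam T) ^ 3 / 9 := by
  have h0 := av_nonneg (zParam T)
  have h2 := av_zParam_add_le le_rfl (le_refl (av (zParam T)))
  have h3 := av_zParam_add_le h2 le_rfl
  have h1 := av_nonneg (zParam (T + T + T))
  have h4 := av_zParam_add T T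
  have h5 := av_zParam_add (T + T) T
  rw [show 3 • T = T + T + T by module]
  rw [show zParam (T + T + T) - 3 * zParam T = (zParam (T + T + T) - zParam (T + T) - zParam T) +
    (zParam (T + T) - zParam T - zParam T) by ring]
  refine av_add_le (h5.trans ?_) (h4.trans ?_)
  · calc _ ≤ av (zParam T) * av (zParam T) * av (zParam T) / 9 := by gcongr
      _ = _ := by ring
  · calc _ ≤ av (zParam T) * av (zParam T) * av (zParam T) / 9 := by gcongr
      _ = _ := by ring

theorem av_zParam_three_nsmul_le (T : curve.Point) : av (zParam (3 • T)) ≤ av (zParam T) / 9 := by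
  have h := av_zParam_three_nsmul_sub T
  have h0 := av_nonneg (zParam T)
  have h1 := pow_le_of_le_one h0 (av_zParam_le_one T) three_ne_zero
  rw [show zParam (3 • T) = (zParam (3 • T) - 3 * zParam T) + 3 * zParam T by ring]
  refine av_add_le (by linarith) ?_
  rw [av_mul, av_three]
  linarith


theorem ne_zero_of_av_eq_one {x : RatSqrtSix} (h : av x = 1) : x ≠ 0 := by
  rintro rfl
  exact zero_ne_one (av_zero.symm.trans h)

theorem av_one_add_sqrtSix : av (1 + sqrtSix) = 1 := by
  simpa using av_int_add_mul_eq_one (a := 1) (by norm_num) 1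

theorem av_zParam_gen : av (zParam gen) = 1 := by
  have h := (av_zParam_some nonsingular_gen).1
  rw [av_mul, av_neg, av_eta, av_one_add_sqrtSix, one_mul, mul_one] at h
  exact (pow_eq_one_iff_of_nonneg (av_nonneg _) three_ne_zero).1 h

theorem av_thirteen_add_two_mul : av (13 + 2 * sqrtSix) = 1 := by
  have := av_int_add_mul_eq_one (a := 13) (by norm_num) 2
  exact_mod_cast this

theorem av_denom_three_nsmul_gen : av (499607 + 209007 * sqrtSix) = 1 := by
  have := av_int_add_mul_eq_one (a := 499607) (by norm_num) 209007
  exact_mod_cast this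

theorem zParam_three_nsmul_gen : zParam (3 • gen) + 3 * (13 + 2 * sqrtSix) =
    27 * (13 + 2 * sqrtSix) * (54491 + 22809 * sqrtSix) / (499607 + 209007 * sqrtSix) := by
  have hs := sqrtSix_sq
  have hη : eta = 5 + 2 * sqrtSix := rfl
  have hB : 499607 + 209007 * sqrtSix ≠ 0 := ne_zero_of_av_eq_one av_denom_three_nsmul_gen
  have hw : 13 + 2 * sqrtSix ≠ 0 := ne_zero_of_av_eq_one av_thirteen_add_two_mul
  have hηm : eta = (-(1 + sqrtSix)) ^ 2 - 2 * 1 ^ 2 := by rw [hη]; linear_combination -hs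
  have hwm : 13 + 2 * sqrtSix = (-(1 + sqrtSix)) ^ 2 + 6 * 1 ^ 2 := by linear_combination -hs
  have hw3 : (13 + 2 * sqrtSix) ^ 3 = (9 * sqrtSix - 1) ^ 2 + 54 * eta ^ 2 := by
    rw [hη]; linear_combination (-141 + 8 * sqrtSix) * hs
  have hm : -(1 + sqrtSix) * ((-(1 + sqrtSix)) ^ 2 - 18 * 1 ^ 2) = 9 * sqrtSix - 1 := by
    linear_combination -(sqrtSix + 3) * hs
  obtain ⟨w, hwdef⟩ : ∃ w, w = 13 + 2 * sqrtSix := ⟨_, rfl⟩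
  rw [← hwdef] at hw hwm hw3 ⊢
  obtain ⟨p, hp⟩ : ∃ p, p = (9 * sqrtSix - 1) / (3 * w) := ⟨_, rfl⟩
  obtain ⟨q, hq⟩ : ∃ q, q = 3 * 1 * eta / w := ⟨_, rfl⟩
  have hpq : 3 * p ^ 2 * q + 2 * q ^ 3 = eta := by
    rw [hp, hq]
    field_simp
    linear_combination -eta * hw3
  have hT : curve.Nonsingular (p ^ 2 - 2 * q ^ 2) (p ^ 3 + 6 * p * q ^ 2) := by
    rw [mordell_nonsingular_iff two_mul_eta_sq_ne_zero, ← hpq]; ring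
  have hR : curve.Nonsingular eta (eta * -(1 + sqrtSix)) := by
    convert nonsingular_gen using 1; ring
  have h3 := mordell_three_nsmul hηm hwm
    (neg_ne_zero.2 (ne_zero_of_av_eq_one av_one_add_sqrtSix)) eta_ne_zero hw (by rw [hm, hp]) hq rfl rfl hR hT
  have hgen : gen = .some _ _ hR := by
    rw [gen, Point.some.injEq]; exact ⟨rfl, by ring⟩
  rw [hgen, ← h3]
  change (p ^ 2 - 2 * q ^ 2 - 1) / (p ^ 3 + 6 * p * q ^ 2) + _ = _
  have hA : p ^ 2 - 2 * q ^ 2 - 1 = (-9188 - 3726 * sqrtSix) / (9 * w ^ 2) := by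
    rw [hp, hq, eq_div_iff (by simp [hw])]
    field_simp
    rw [hη, hwdef]
    linear_combination (-5427) * hs
  have hB' : p ^ 3 + 6 * p * q ^ 2 = (499607 + 209007 * sqrtSix) / (27 * w ^ 3) := by
    rw [hp, hq, eq_div_iff (by simp [hw])]
    field_simp
    rw [hη]
    linear_combination (2302911 + 492075 * sqrtSix) * hs
  rw [hA, hB']
  obtain ⟨B, hBdef⟩ : ∃ B, B = 499607 + 209007 * sqrtSix := ⟨_, rfl⟩
  rw [← hBdef] at hB ⊢
  field_simp
  rw [hBdef]
  ring

theorem av_zParam_three_nsmul_gen_add_le :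
    av (zParam (3 • gen) + 3 * (13 + 2 * sqrtSix)) ≤ 1 / 729 := by
  have h : av (54491 + 22809 * sqrtSix) ≤ 1 := by
    have := av_int_add_mul_le_one 54491 22809
    exact_mod_cast this
  rw [zParam_three_nsmul_gen, av_div, av_mul, av_mul, av_thirteen_add_two_mul,
    av_denom_three_nsmul_gen, show (27 : RatSqrtSix) = 3 ^ 3 by norm_num, av_pow, av_three]
  linarith

theorem av_zParam_three_nsmul_gen : av (zParam (3 • gen)) = 1 / 9 := by
  have h := av_zParam_three_nsmul_gen_add_le
  have h1 : av (-(3 * (13 + 2 * sqrtSix))) = 1 / 9 := by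
    rw [av_neg, av_mul, av_three, av_thirteen_add_two_mul, mul_one]
  rw [← h1]
  refine av_eq_of_av_sub_lt ?_
  rw [av_sub_comm, sub_neg_eq_add, h1]
  linarith

theorem av_im_zParam_three_nsmul_gen : av (zParam (3 • gen)).im = 1 / 9 := by
  have h := (av_im_le _).trans (mul_le_mul_of_nonneg_left av_zParam_three_nsmul_gen_add_le
    zero_le_three)
  have h1 : (zParam (3 • gen) + 3 * (13 + 2 * sqrtSix)).im = (zParam (3 • gen)).im + 6 := by
    rw [QuadraticAlgebra.im_add]
    congr 1
    simp [sqrtSix]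
    norm_num
  have h2 : av (-6) = 1 / 9 := by
    rw [av_neg, ← sqrtSix_sq, av_pow, av_sqrtSix]; norm_num
  rw [h1] at h
  rw [← h2]
  refine av_eq_of_av_sub_lt ?_
  rw [av_sub_comm, h2, sub_neg_eq_add]
  refine lt_of_le_of_lt ?_ (lt_of_le_of_lt h (by norm_num))
  push_cast
  exact le_rfl


theorem zParam_zsmul_of_abs_le_one {n : ℤ} (hn : |n| ≤ 1) (T : curve.Point) :
    zParam (n • T) = n * zParam T := by
  obtain ⟨h1, h2⟩ := abs_le.1 hn
  interval_cases n
  · rw [neg_one_zsmul, zParam_neg]; push_cast; ring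
  · rw [zero_zsmul, zParam_zero]; push_cast; ring
  · rw [one_zsmul]; push_cast; ring

theorem av_zParam_add_sub_le (S R : curve.Point) :
    av (zParam (S + R) - zParam S) ≤ av (zParam R) := by
  have h := av_zParam_add S R
  have h0 := av_nonneg (zParam R)
  have h1 : av (zParam S) * av (zParam R) * av (zParam (S + R)) ≤ 1 * av (zParam R) * 1 := by
    gcongr
    exacts [av_nonneg _, av_zParam_le_one S, av_zParam_le_one _]
  rw [show zParam (S + R) - zParam S = (zParam (S + R) - zParam S - zParam R) + zParam R by ring]
  exact av_add_le (by linarith) le_rfl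

theorem av_zParam_three_nsmul_le_ninth (T : curve.Point) : av (zParam (3 • T)) ≤ 1 / 9 := by
  have h := av_zParam_three_nsmul_le T
  have h1 := av_zParam_le_one T
  linarith

theorem av_intCast_of_abs_le_one {n : ℤ} (hn : |n| ≤ 1) (h0 : n ≠ 0) : av n = 1 := by
  refine av_intCast_eq_one fun h => ?_
  have := Int.le_of_dvd (abs_pos.2 h0) ((dvd_abs _ _).2 h)
  omega

theorem exists_eq_three_nsmul_of_av_zParam_lt {T : curve.Point} (hT : av (zParam T) < 1) :
    ∃ R, T = 3 • R := by
  obtain ⟨n, R, hn, rfl⟩ := exists_eq_zsmul_gen_add T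
  rcases eq_or_ne n 0 with rfl | h0
  · exact ⟨R, by rw [zero_zsmul, zero_add]⟩
  exfalso
  have h1 : av (zParam (n • gen)) = 1 := by
    rw [zParam_zsmul_of_abs_le_one hn, av_mul, av_intCast_of_abs_le_one hn h0, av_zParam_gen, one_mul]
  have h2 := (av_zParam_add_sub_le (n • gen) (3 • R)).trans (av_zParam_three_nsmul_le_ninth R)
  refine hT.ne (Eq.trans ?_ h1)
  refine av_eq_of_av_sub_lt ?_
  rw [av_sub_comm, h1]
  linarith

/-- Near infinity the parameter of a point is, to first order, a rational multiple of the
parameter of `3 • gen`. -/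
theorem exists_rat_av_zParam_sub_le {T : curve.Point} (hT0 : T ≠ 0) (hT : av (zParam T) < 1) :
    ∃ q : ℚ, av (zParam T - q * zParam (3 • gen)) ≤ av (zParam T) / 9 := by
  obtain ⟨k, hk⟩ := exists_pow_lt_of_lt_one (av_pos (zParam_ne_zero hT0))
    (by norm_num : (1 / 3 : ℚ) < 1)
  induction k generalizing T with
  | zero => rw [pow_zero] at hk; linarith
  | succ k ih =>
    obtain ⟨R, rfl⟩ := exists_eq_three_nsmul_of_av_zParam_lt hT
    have hR0 : R ≠ 0 := by rintro rfl; exact hT0 (nsmul_zero 3)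
    have hRpos := av_pos (zParam_ne_zero hR0)
    have h3 := av_zParam_three_nsmul_sub R
    have h3R : av (3 * zParam R) = av (zParam R) / 9 := by rw [av_mul, av_three]; ring
    rcases (av_zParam_le_one R).lt_or_eq with hR | hR
    · have hR3 : av (zParam R) ≤ 1 / 3 := by
        simpa [av_one] using av_le_div_three_of_lt (y := 1) (by rwa [av_one])
      have hcube : av (zParam R) ^ 3 ≤ av (zParam R) / 9 := by
        calc _ = av (zParam R) * av (zParam R) * av (zParam R) := by ring
          _ ≤ av (zParam R) * (1 / 3) * (1 / 3) := by gcongr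
          _ = _ := by ring
      have h3T : av (zParam (3 • R)) = av (zParam R) / 9 := by
        rw [← h3R]
        refine av_eq_of_av_sub_lt ?_
        rw [av_sub_comm, h3R]
        linarith
      have hk0 : (0 : ℚ) < (1 / 3) ^ k := by positivity
      obtain ⟨q, hq⟩ := ih hR0 hR (by rw [h3T, pow_succ] at hk; linarith)
      refine ⟨3 * q, ?_⟩
      rw [show zParam (3 • R) - ((3 * q : ℚ) : RatSqrtSix) * zParam (3 • gen) =
        (zParam (3 • R) - 3 * zParam R) + 3 * (zParam R - q * zParam (3 • gen)) by push_cast; ring,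
        h3T]
      refine av_add_le (by linarith) ?_
      rw [av_mul, av_three]
      linarith
    · obtain ⟨n, R', hn, hRR⟩ := exists_eq_zsmul_gen_add R
      have h0 : n ≠ 0 := by
        rintro rfl
        rw [zero_zsmul, zero_add] at hRR
        rw [hRR] at hR
        have := av_zParam_three_nsmul_le_ninth R'
        rw [hR] at this
        norm_num at this
      have hsum : 3 • R = n • (3 • gen) + 3 • (3 • R') := by rw [hRR]; module
      have h9 : av (zParam (3 • (3 • R'))) ≤ 1 / 81 := by
        have h1 := av_zParam_three_nsmul_le (3 • R')
        have h2 := av_zParam_three_nsmul_le_ninth R'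
        linarith
      have hsub := (av_zParam_add_sub_le (n • (3 • gen)) (3 • (3 • R'))).trans h9
      rw [← hsum, zParam_zsmul_of_abs_le_one hn] at hsub
      have hn0 : av (n * zParam (3 • gen)) = 1 / 9 := by
        rw [av_mul, av_intCast_of_abs_le_one hn h0, av_zParam_three_nsmul_gen, one_mul]
      have hT9 : av (zParam (3 • R)) = 1 / 9 := by
        rw [← hn0]
        refine av_eq_of_av_sub_lt ?_
        rw [av_sub_comm, hn0]
        linarith
      refine ⟨n, ?_⟩
      rw [hT9]
      push_cast
      linarith

theorem not_av_zParam_sub_ratCast_le {T : curve.Point} (hT0 : T ≠ 0) (hT : av (zParam T) < 1)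
    (r : ℚ) : av r / 9 < av (zParam T - r) := by
  by_contra! h
  have hTpos := av_pos (zParam_ne_zero hT0)
  obtain ⟨q, hq⟩ := exists_rat_av_zParam_sub_le hT0 hT
  have hr : av r = av (zParam T) := by
    rcases eq_or_ne r 0 with rfl | hr
    · rw [Rat.cast_zero, sub_zero, av_zero] at h
      linarith
    · refine (av_eq_of_av_sub_lt ?_).symm
      rw [av_sub_comm]
      have := av_pos (Rat.cast_ne_zero.2 hr : (r : RatSqrtSix) ≠ 0)
      linarith
  have hqz : av (q * zParam (3 • gen)) = av (zParam T) := av_eq_of_av_sub_lt (by linarith)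
  have hd : av (q * zParam (3 • gen) - r) ≤ av (zParam T) / 9 := by
    rw [show q * zParam (3 • gen) - r = (zParam T - r) - (zParam T - q * zParam (3 • gen)) by ring]
    exact av_sub_le (by rwa [hr] at h) hq
  have him := (av_im_le _).trans (mul_le_mul_of_nonneg_left hd zero_le_three)
  have h1 : ((q : RatSqrtSix) * zParam (3 • gen) - r).im = q * (zParam (3 • gen)).im := by
    simp
  rw [h1, Rat.cast_mul, av_mul, av_im_zParam_three_nsmul_gen] at him
  rw [av_mul, av_zParam_three_nsmul_gen] at hqz
  linarith

theorem exists_av_zParam_eq_zpow {T : curve.Point} (hT0 : T ≠ 0) (hT : av (zParam T) < 1) :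
    ∃ k : ℤ, av (zParam T) = 9 ^ k := by
  have hTpos := av_pos (zParam_ne_zero hT0)
  obtain ⟨q, hq⟩ := exists_rat_av_zParam_sub_le hT0 hT
  have hqz : av (q * zParam (3 • gen)) = av (zParam T) := av_eq_of_av_sub_lt (by linarith)
  rw [av_mul, av_zParam_three_nsmul_gen] at hqz
  have hq0 : q ≠ 0 := by
    rintro rfl
    rw [Rat.cast_zero, av_zero] at hqz
    linarith
  obtain ⟨k, hk⟩ := exists_av_ratCast_eq_zpow hq0
  refine ⟨k - 1, ?_⟩
  rw [← hqz, hk, zpow_sub_one₀ (by norm_num)]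
  norm_num


theorem av_ratCast_eq_av_cube_sub_one {ρ : ℚ} {V : RatSqrtSix} (hρ : av ρ ≤ 1 / 9)
    (hV : V ^ 3 * (1 + ρ * sqrtSix) ^ 2 = 1 - 2 * ρ - ρ ^ 2) :
    av (V ^ 3 - 1) = av ρ ∧ av (V ^ 3 - 1 + 2 * (1 + sqrtSix) * ρ) ≤ av ρ ^ 2 := by
  have h0 := av_nonneg (ρ : RatSqrtSix)
  have hW : av (1 + ρ * sqrtSix) = 1 := by
    rw [av_add_eq_left, av_one]
    rw [av_mul, av_sqrtSix, av_one]; linarith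
  have hfac : (V ^ 3 - 1) * (1 + ρ * sqrtSix) ^ 2 = -(ρ * (2 * (1 + sqrtSix) + (7 : ℤ) * ρ)) := by
    push_cast
    linear_combination hV - ρ ^ 2 * sqrtSix_sq
  have h7 : av ((7 : ℤ) * ρ) ≤ av ρ := by
    rw [av_mul]
    exact mul_le_of_le_one_left h0 (av_intCast_le_one 7)
  have h2 : av (2 * (1 + sqrtSix)) = 1 := by rw [av_mul, av_two, av_one_add_sqrtSix, one_mul]
  have h1 : av (V ^ 3 - 1) = av ρ := by
    have := congrArg av hfac
    rw [av_mul, av_pow, hW, av_neg, av_mul, av_add_eq_left (by rw [h2]; linarith), h2] at this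
    linarith
  refine ⟨h1, ?_⟩
  rw [show V ^ 3 - 1 + 2 * (1 + sqrtSix) * ρ =
    -((V ^ 3 - 1) * (ρ * (2 * sqrtSix + (6 : ℤ) * ρ))) - ρ * ((7 : ℤ) * ρ) by
      push_cast at hfac ⊢
      linear_combination hfac - (V ^ 3 - 1) * ρ ^ 2 * sqrtSix_sq]
  refine av_sub_le ?_ ?_
  · have h6 : av (2 * sqrtSix + (6 : ℤ) * ρ) ≤ 1 := by
      refine av_add_le ?_ ?_
      · rw [av_mul, av_two, av_sqrtSix]; norm_num
      · rw [av_mul]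
        exact mul_le_one₀ (av_intCast_le_one 6) h0 (by linarith)
    rw [av_neg, av_mul, av_mul, h1, pow_two]
    exact mul_le_mul_of_nonneg_left (mul_le_of_le_one_right h0 h6) h0
  · rw [av_mul, pow_two]
    gcongr

theorem av_sub_one_of_cube {ρ : ℚ} (hρ0 : ρ ≠ 0) {V : RatSqrtSix} (hρ : av ρ ≤ 1 / 9)
    (hV : V ^ 3 * (1 + ρ * sqrtSix) ^ 2 = 1 - 2 * ρ - ρ ^ 2) :
    av ρ ≤ 1 / 81 ∧ (av (V - 1) = 1 / 3 ∨ av ((V - 1) / (1 + sqrtSix) + 2 * ρ / 3) ≤ av ρ) := by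
  obtain ⟨h1, h2⟩ := av_ratCast_eq_av_cube_sub_one hρ hV
  obtain ⟨ν, rfl⟩ : ∃ ν, V = ν + 1 := ⟨V - 1, by ring⟩
  rw [add_sub_cancel_right]
  have hν0 := av_nonneg ν
  have hρpos := av_pos (Rat.cast_ne_zero.2 hρ0 : (ρ : RatSqrtSix) ≠ 0)
  have hcube : (ν + 1) ^ 3 - 1 = ν ^ 3 + 3 * (ν * (ν + 1)) := by ring
  have hν1 : av ν ≤ 1 / 3 := by
    by_contra! hlt
    have hge : 1 ≤ av ν := by
      by_contra! h
      exact hlt.not_ge (by simpa [av_one] using av_le_div_three_of_lt (y := 1) (by rwa [av_one]))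
    have hp : av ν ≤ av ν ^ 2 := by nlinarith
    have hp1 : av ν ^ 2 ≤ av ν ^ 3 := by nlinarith
    have hsmall : av (3 * (ν * (ν + 1))) < av (ν ^ 3) := by
      rw [av_mul, av_mul, av_three, av_pow]
      have : av (ν + 1) ≤ av ν := av_add_le le_rfl (av_one.trans_le hge)
      have : av ν * av (ν + 1) ≤ av ν * av ν := by gcongr
      nlinarith
    have := av_add_eq_left hsmall
    rw [← hcube, h1, av_pow] at this
    linarith
  have hν3 : av ν ^ 3 ≤ av ν / 9 := by
    calc _ = av ν * av ν * av ν := by ring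
      _ ≤ av ν * (1 / 3) * (1 / 3) := by gcongr
      _ = _ := by ring
  have hν1' : av (ν + 1) = 1 := by
    rw [add_comm, av_add_eq_left, av_one]
    rw [av_one]; linarith
  have hmid : av (3 * (ν * (ν + 1))) = av ν / 9 := by
    rw [av_mul, av_mul, av_three, hν1']; ring
  have hρν : av ρ ≤ av ν / 9 := by
    rw [← h1, hcube]
    exact av_add_le (by rwa [av_pow]) hmid.le
  have hρ81 : av ρ ≤ 1 / 81 := by
    have : av ρ < 9 ^ (-2 + 1 : ℤ) := by norm_num; linarith
    refine (av_ratCast_le_of_lt this).trans_eq ?_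
    norm_num
  refine ⟨hρ81, hν1.eq_or_lt.imp_right fun hlt => ?_⟩
  have hν9 : av ν ≤ 1 / 9 := by
    have : av ν < 3 ^ (-2 + 1 : ℤ) := by norm_num; linarith
    refine (av_le_of_lt this).trans_eq ?_
    norm_num
  have hν3' : av ν ^ 3 ≤ av ν / 81 := by
    calc _ = av ν * av ν * av ν := by ring
      _ ≤ av ν * (1 / 9) * (1 / 9) := by gcongr
      _ = _ := by ring
  have hνpos : 0 < av ν := by linarith
  have hνρ : av ν = 9 * av ρ := by
    have hlt : av (ν ^ 3) < av (3 * (ν * (ν + 1))) := by rw [av_pow, hmid]; linarith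
    have := av_add_eq_left hlt
    rw [add_comm, ← hcube, h1, hmid] at this
    linarith
  have hc := ne_zero_of_av_eq_one av_one_add_sqrtSix
  have hkey : (ν / (1 + sqrtSix) + 2 * ρ / 3) * (3 * (1 + sqrtSix)) =
      ((ν + 1) ^ 3 - 1 + 2 * (1 + sqrtSix) * ρ) - (ν ^ 3 + 3 * ν ^ 2) := by
    field_simp
    ring
  have hkey' := congrArg av hkey
  rw [av_mul, av_mul, av_three, av_one_add_sqrtSix] at hkey'
  have hbound : av (((ν + 1) ^ 3 - 1 + 2 * (1 + sqrtSix) * ρ) - (ν ^ 3 + 3 * ν ^ 2)) ≤ av ρ / 9 := by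
    refine av_sub_le ?_ (av_add_le ?_ ?_)
    · nlinarith
    · rw [av_pow]; linarith
    · rw [av_mul, av_pow, av_three]; nlinarith
  linarith

/-- The covering condition forces the point at infinity. -/
theorem eq_zero_of_cube_mul_eq {ρ : ℚ} {V : RatSqrtSix} (hρ : av ρ ≤ 1 / 9)
    (hV : V ^ 3 * (1 + ρ * sqrtSix) ^ 2 = 1 - 2 * ρ - ρ ^ 2) : ρ = 0 := by
  by_contra hρ0
  obtain ⟨hρ81, hcase⟩ := av_sub_one_of_cube hρ0 hρ hV
  have hρpos := av_pos (Rat.cast_ne_zero.2 hρ0 : (ρ : RatSqrtSix) ≠ 0)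
  have hWav : av (1 + ρ * sqrtSix) = 1 := by
    rw [av_add_eq_left, av_one]
    rw [av_mul, av_sqrtSix, av_one]; linarith
  have hW := ne_zero_of_av_eq_one hWav
  obtain ⟨U, hU⟩ : ∃ U : RatSqrtSix, U = ρ / (1 + ρ * sqrtSix) := ⟨_, rfl⟩
  have hUav : av U = av ρ := by rw [hU, av_div, hWav, div_one]
  have hVU : V ^ 3 = 1 - 2 * (1 + sqrtSix) * U + eta * U ^ 2 := by
    have hUW : U * (1 + ρ * sqrtSix) = ρ := by rw [hU, div_mul_cancel₀ _ hW]
    refine mul_right_cancel₀ (pow_ne_zero 2 hW) ?_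
    rw [hV, eta]
    linear_combination (2 * (1 + sqrtSix) * (1 + ρ * sqrtSix) -
      (5 + 2 * sqrtSix) * (U * (1 + ρ * sqrtSix) + ρ)) * hUW + ρ ^ 2 * sqrtSix_sq
  have hc := ne_zero_of_av_eq_one av_one_add_sqrtSix
  have hcU : av (1 + sqrtSix - eta * U) = 1 := by
    rw [sub_eq_add_neg, av_add_eq_left, av_one_add_sqrtSix]
    rw [av_neg, av_mul, av_eta, av_one_add_sqrtSix, hUav]; linarith
  have hcU0 := ne_zero_of_av_eq_one hcU
  have hη0 := eta_ne_zero
  have hQ : curve.Nonsingular (eta * V) (-eta * (1 + sqrtSix - eta * U)) := by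
    rw [mordell_nonsingular_iff two_mul_eta_sq_ne_zero, mul_pow eta V, hVU]
    have hη : eta = 5 + 2 * sqrtSix := rfl
    linear_combination eta ^ 2 * sqrtSix_sq - eta ^ 2 * hη
  obtain ⟨Q, hQdef⟩ : ∃ Q : curve.Point, Q = .some _ _ hQ := ⟨_, rfl⟩
  have hzQ : zParam Q = (eta * V - 1) / (-eta * (1 + sqrtSix - eta * U)) := by rw [hQdef]; rfl
  have hzP : zParam (-gen) = -((eta - 1) / (-eta * (1 + sqrtSix))) := by rw [zParam_neg]; rfl
  have hT0 : Q + -gen ≠ 0 := by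
    rw [← sub_eq_add_neg, sub_ne_zero, hQdef, gen]
    intro h
    rw [Point.some.injEq] at h
    have hU0 : eta * eta * U = 0 := by linear_combination h.2
    have hU0' : U = 0 := by simpa [hη0] using hU0
    rw [hU0', av_zero] at hUav
    exact hρpos.ne hUav
  have hadd := av_zParam_add Q (-gen)
  have hD : zParam Q + zParam (-gen) + (V - 1) / (1 + sqrtSix) =
      -((eta * V - 1) * U) / ((1 + sqrtSix) * (1 + sqrtSix - eta * U)) := by
    rw [hzQ, hzP]
    generalize 1 + sqrtSix = c at *
    have : -eta * (c - eta * U) ≠ 0 := mul_ne_zero (neg_ne_zero.2 hη0) hcU0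
    field_simp
    ring
  have hηV : av (eta * V - 1) ≤ 1 := by
    have hV1 : av (V ^ 3) ≤ 1 := by
      rw [hVU]
      refine av_add_le (av_sub_le av_one.le ?_) ?_
      · rw [av_mul, av_mul, av_two, av_one_add_sqrtSix, hUav]; linarith
      · rw [av_mul, av_eta, av_pow, hUav, one_mul]
        exact pow_le_one₀ hρpos.le (by linarith)
    rw [av_pow, pow_le_one_iff_of_nonneg (av_nonneg V) three_ne_zero] at hV1
    exact av_sub_le (by rwa [av_mul, av_eta, one_mul]) av_one.le
  have hDav : av (zParam Q + zParam (-gen) + (V - 1) / (1 + sqrtSix)) ≤ av ρ := by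
    rw [hD, av_div, av_neg, av_mul, av_mul, hcU, av_one_add_sqrtSix, hUav, mul_one, div_one]
    exact mul_le_of_le_one_left hρpos.le hηV
  have hQ1 := av_zParam_le_one Q
  have hP1 := av_zParam_le_one (-gen)
  generalize zParam Q = zQ at *
  generalize zParam (-gen) = zP at *
  have hTpos := av_pos (zParam_ne_zero hT0)
  have hadd' : av (zParam (Q + -gen) - (zQ + zP)) ≤ av (zParam (Q + -gen)) / 9 := by
    rw [← sub_sub]
    refine hadd.trans ?_
    have := mul_le_one₀ hQ1 (av_nonneg zP) hP1
    have := mul_le_of_le_one_left hTpos.le this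
    linarith
  have hTD : av (zQ + zP) = av (zParam (Q + -gen)) := av_eq_of_av_sub_lt (by linarith)
  rcases hcase with h3 | hclose
  · have hneg : av (-((V - 1) / (1 + sqrtSix))) = 1 / 3 := by
      rw [av_neg, av_div, av_one_add_sqrtSix, h3, div_one]
    have hT3 : av (zParam (Q + -gen)) = 1 / 3 := by
      rw [← hTD, ← hneg]
      refine av_eq_of_av_sub_lt ?_
      rw [av_sub_comm, hneg, sub_neg_eq_add]
      linarith
    obtain ⟨k, hk⟩ := exists_av_zParam_eq_zpow hT0 (by rw [hT3]; norm_num)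
    rw [hT3, show (9 : ℚ) = 3 ^ (2 : ℤ) by norm_num, ← zpow_mul,
      show (1 / 3 : ℚ) = 3 ^ (-1 : ℤ) by norm_num] at hk
    have := zpow_right_injective₀ (by norm_num : (0 : ℚ) < 3) (by norm_num) hk
    omega
  · have hr : av ((2 * ρ / 3 : ℚ) : RatSqrtSix) = 9 * av ρ := by
      push_cast
      rw [av_div, av_mul, av_two, av_three]
      ring
    have hDr : av (zQ + zP - (2 * ρ / 3 : ℚ)) ≤ av ρ := by
      rw [show zQ + zP - ((2 * ρ / 3 : ℚ) : RatSqrtSix) = (zQ + zP + (V - 1) / (1 + sqrtSix)) -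
        ((V - 1) / (1 + sqrtSix) + 2 * ρ / 3) by push_cast; ring]
      exact av_sub_le hDav hclose
    have hDρ : av (zQ + zP) = 9 * av ρ := by
      rw [← hr]
      refine av_eq_of_av_sub_lt ?_
      rw [av_sub_comm, hr]
      linarith
    refine (not_av_zParam_sub_ratCast_le hT0 (by linarith) (2 * ρ / 3)).not_ge ?_
    rw [hr, show zParam (Q + -gen) - ((2 * ρ / 3 : ℚ) : RatSqrtSix) =
      (zParam (Q + -gen) - (zQ + zP)) + (zQ + zP - (2 * ρ / 3 : ℚ)) by ring]
    exact av_add_le (by linarith) (by linarith)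


theorem av_quadratic_form_eq_one {u v : ℤ} (huv : IsCoprime u v) :
    av (u ^ 2 - 2 * u * v - v ^ 2 : RatSqrtSix) = 1 := by
  have h : ¬(3 : ℤ) ∣ u ^ 2 - 2 * u * v - v ^ 2 := by
    intro h
    have key : ∀ a b : ZMod 3, a ^ 2 - 2 * a * b - b ^ 2 = 0 → a = 0 ∧ b = 0 := by decide
    have h' : ((u ^ 2 - 2 * u * v - v ^ 2 : ℤ) : ZMod 3) = 0 :=
      (ZMod.intCast_zmod_eq_zero_iff_dvd _ 3).2 h
    obtain ⟨h1, h2⟩ := key u v (by exact_mod_cast h')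
    have h3 := huv.isUnit_of_dvd' ((ZMod.intCast_zmod_eq_zero_iff_dvd u 3).1 h1)
      ((ZMod.intCast_zmod_eq_zero_iff_dvd v 3).1 h2)
    exact absurd (Int.isUnit_iff.1 h3) (by norm_num)
  exact_mod_cast av_intCast_eq_one h

theorem av_intCast_le_ninth {a : ℤ} (h : (3 : ℤ) ∣ a) : av a ≤ 1 / 9 := by
  obtain ⟨b, rfl⟩ := h
  push_cast
  rw [av_mul, av_three]
  linarith [av_intCast_le_one b]

theorem not_dvd_of_cube_mul_eq {u v : ℤ} (huv : IsCoprime u v) {V : RatSqrtSix}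
    (hV : V ^ 3 * (u + v * sqrtSix) ^ 2 = u ^ 2 - 2 * u * v - v ^ 2) : (3 : ℤ) ∣ v := by
  by_contra hv
  have hN := congrArg av hV
  rw [av_quadratic_form_eq_one huv, av_mul, av_pow, av_pow] at hN
  have hv1 := av_intCast_eq_one hv
  by_cases hu : (3 : ℤ) ∣ u
  · have hu9 := av_intCast_le_ninth hu
    have h3 : av (v * sqrtSix) = 1 / 3 := by rw [av_mul, hv1, av_sqrtSix, one_mul]
    rw [add_comm, av_add_eq_left (by rw [h3]; linarith), h3] at hN
    have hV0 : V ≠ 0 := by rintro rfl; norm_num [av_zero] at hN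
    exact zpow_three_mul_ne hV0 (a := 9) (n := 2) (by norm_num) (by norm_num) (by linarith)
  · have hu1 := av_intCast_eq_one hu
    rw [av_int_add_mul_eq_one hu, one_pow, mul_one,
      pow_eq_one_iff_of_nonneg (av_nonneg V) three_ne_zero] at hN
    have him := av_im_cube_le hN.le
    obtain ⟨a, b, hab⟩ : ∃ a b : ℚ, V ^ 3 = a + b * sqrtSix := ⟨_, _, eq_add_mul_sqrtSix _⟩
    have hb : (V ^ 3).im = b := by rw [hab]; simp [sqrtSix]
    rw [hb] at him
    have hrel : 2 * u * v * a + b * (u ^ 2 + 6 * v ^ 2) = 0 := by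
      have := congrArg QuadraticAlgebra.im hV
      rw [hab, show ((a : RatSqrtSix) + b * sqrtSix) * (u + v * sqrtSix) ^ 2 =
        ((a * (u ^ 2 + 6 * v ^ 2) + 12 * u * v * b : ℚ) : RatSqrtSix) +
        ((2 * u * v * a + b * (u ^ 2 + 6 * v ^ 2) : ℚ) : RatSqrtSix) * sqrtSix by
          push_cast
          linear_combination (a * v ^ 2 + 2 * u * v * b + b * v ^ 2 * sqrtSix) * sqrtSix_sq,
        show (u ^ 2 - 2 * u * v - v ^ 2 : RatSqrtSix) = ((u ^ 2 - 2 * u * v - v ^ 2 : ℚ) : RatSqrtSix)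
          by push_cast; ring] at this
      simpa only [QuadraticAlgebra.im_add, QuadraticAlgebra.im_ratCast, QuadraticAlgebra.im_mul,
        QuadraticAlgebra.re_ratCast, sqrtSix, mul_one, mul_zero, zero_mul, add_zero, zero_add,
        Rat.cast_id] using this
    have ha : av a ≤ 1 / 9 := by
      have h1 : av (2 * u * v * a) = av a := by rw [av_mul, av_mul, av_mul, av_two, hu1, hv1]; ring
      have hint := av_intCast_le_one (u ^ 2 + 6 * v ^ 2)
      have h2 : 2 * u * v * a = -(b * ((u ^ 2 + 6 * v ^ 2 : ℤ) : RatSqrtSix)) := by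
        have : ((2 * u * v * a + b * (u ^ 2 + 6 * v ^ 2) : ℚ) : RatSqrtSix) = 0 := by
          rw [hrel, Rat.cast_zero]
        push_cast at this ⊢
        linear_combination this
      rw [← h1, h2, av_neg, av_mul]
      exact (mul_le_of_le_one_right (av_nonneg _) hint).trans him
    have hfin : av (V ^ 3) ≤ 1 / 9 := by
      rw [hab]
      refine av_add_le ha ?_
      rw [av_mul, av_sqrtSix]
      linarith
    rw [av_pow, hN] at hfin
    norm_num at hfin

theorem eq_zero_of_cube_mul_int_eq {u v : ℤ} (huv : IsCoprime u v) {V : RatSqrtSix}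
    (hV : V ^ 3 * (u + v * sqrtSix) ^ 2 = u ^ 2 - 2 * u * v - v ^ 2) : v = 0 := by
  have hv := not_dvd_of_cube_mul_eq huv hV
  have hu : ¬(3 : ℤ) ∣ u := fun h =>
    absurd (Int.isUnit_iff.1 (huv.isUnit_of_dvd' h hv)) (by norm_num)
  have hu0 : (u : RatSqrtSix) ≠ 0 := ne_zero_of_av_eq_one (av_intCast_eq_one hu)
  have hρ := eq_zero_of_cube_mul_eq (ρ := v / u) (V := V) (by
    push_cast
    rw [av_div, av_intCast_eq_one hu, div_one]
    exact av_intCast_le_ninth hv) (by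
    push_cast
    field_simp
    linear_combination hV)
  have hu0' : (u : ℚ) ≠ 0 := by exact_mod_cast hu0
  rw [div_eq_zero_iff] at hρ
  exact_mod_cast hρ.resolve_right hu0'

end RatSqrtSix

theorem eq_zero_of_zsqrtd_six_cube {u v a : ℤ} (huv : IsCoprime u v) {β : ℤ√6}
    (hβ : (⟨u, v⟩ : ℤ√6) = β ^ 3) (ha : u ^ 2 - 2 * u * v - v ^ 2 = a ^ 3) : v = 0 := by
  have hs := RatSqrtSix.sqrtSix_sq
  obtain ⟨B, hB⟩ : ∃ B : RatSqrtSix, B = β.re + β.im * RatSqrtSix.sqrtSix := ⟨_, rfl⟩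
  have hB3 : (u + v * RatSqrtSix.sqrtSix : RatSqrtSix) = B ^ 3 := by
    have h1 := congrArg Zsqrtd.re hβ
    have h2 := congrArg Zsqrtd.im hβ
    simp only [pow_succ, pow_zero, one_mul, Zsqrtd.re_mul, Zsqrtd.im_mul] at h1 h2
    rw [hB, h1, h2]
    push_cast
    linear_combination (-3 * β.re * β.im ^ 2 - β.im ^ 3 * RatSqrtSix.sqrtSix) * hs
  have hB0 : B ≠ 0 := by
    rintro h0
    rw [h0] at hB3
    have h1 := congrArg QuadraticAlgebra.re hB3
    have h2 := congrArg QuadraticAlgebra.im hB3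
    simp [RatSqrtSix.sqrtSix] at h1 h2
    rw [h1, h2] at huv
    exact not_isCoprime_zero_zero huv
  refine RatSqrtSix.eq_zero_of_cube_mul_int_eq huv (V := a / B ^ 2) ?_
  rw [hB3, div_pow, show (u ^ 2 - 2 * u * v - v ^ 2 : RatSqrtSix) = (a : RatSqrtSix) ^ 3 by
    exact_mod_cast ha]
  field_simp

theorem Zsqrtd.exists_eq_mul_cube_of_eq_pow_mul {θ β h : ℤ√6} {i : ℕ} (hh : h = θ ^ i * β ^ 3) :
    ∃ γ : ℤ√6, h = γ ^ 3 ∨ h = θ * γ ^ 3 ∨ h = θ ^ 2 * γ ^ 3 := by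
  obtain ⟨m, r, rfl, hr⟩ : ∃ m r, i = 3 * m + r ∧ r < 3 :=
    ⟨i / 3, i % 3, (Nat.div_add_mod i 3).symm, Nat.mod_lt i three_pos⟩
  refine ⟨θ ^ m * β, ?_⟩
  rw [hh]
  interval_cases r
  · left; ring
  · right; left; ring
  · right; right; ring

theorem isCoprime_quadratic_forms {u v : ℤ} (huv : IsCoprime u v) :
    IsCoprime (u ^ 2 - 2 * u * v - v ^ 2) (u ^ 2 - 6 * v ^ 2) := by
  obtain ⟨α, β, h⟩ := huv.pow (m := 3) (n := 3)
  exact ⟨α * (30 * u + 72 * v) + β * (2 * u + 5 * v),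
    α * (-29 * u - 12 * v) + β * (-2 * u - v), by linear_combination h⟩

/-- The descent: the two coprime binary quadratic forms are both cubes only at trivial points. -/
theorem eq_of_quadratic_forms_cube {u v a b : ℤ} (huv : IsCoprime u v) (hv : v ≠ 0)
    (ha : u ^ 2 - 2 * u * v - v ^ 2 = a ^ 3) (hb : u ^ 2 - 6 * v ^ 2 = b ^ 3) (hb0 : b ≠ 0) :
    a ^ 3 = b ^ 3 := by
  obtain ⟨i, β, hβ⟩ := Zsqrtd.exists_eq_mul_cube_six (h := ⟨u, v⟩) hb0 huv
    (by rw [Zsqrtd.norm_def, ← hb]; ring)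
  obtain ⟨⟨e, f⟩, h | h | h⟩ := Zsqrtd.exists_eq_mul_cube_of_eq_pow_mul hβ
  · exact absurd (eq_zero_of_zsqrtd_six_cube huv h ha) hv
  · have h1 := congrArg Zsqrtd.re h
    have h2 := congrArg Zsqrtd.im h
    simp only [pow_succ, pow_zero, one_mul, Zsqrtd.re_mul, Zsqrtd.im_mul] at h1 h2
    have hcop : IsCoprime (5 * u - 12 * v) (2 * u - 5 * v) := by
      obtain ⟨α, β, h⟩ := huv
      exact ⟨5 * α + 2 * β, -12 * α - 5 * β, by linear_combination h⟩
    have h0 := eq_zero_of_zsqrtd_six_cube (β := ⟨e, -f⟩) hcop (by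
      ext
      · simp only [pow_succ, pow_zero, one_mul, Zsqrtd.re_mul, Zsqrtd.im_mul, h1, h2]; ring
      · simp only [pow_succ, pow_zero, one_mul, Zsqrtd.re_mul, Zsqrtd.im_mul, h1, h2]; ring)
      (a := a) (by rw [← ha]; ring)
    rw [← ha, ← hb]
    linear_combination -v * h0
  · exfalso
    have h1 := congrArg Zsqrtd.re h
    have h2 := congrArg Zsqrtd.im h
    simp only [pow_succ, pow_zero, one_mul, Zsqrtd.re_mul, Zsqrtd.im_mul] at h1 h2
    obtain ⟨c, hc⟩ : ∃ c, c = e ^ 3 + 18 * e * f ^ 2 := ⟨_, rfl⟩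
    obtain ⟨d, hd⟩ : ∃ d, d = 3 * e ^ 2 * f + 6 * f ^ 3 := ⟨_, rfl⟩
    have hu : u = 49 * c + 120 * d := by rw [h1, hc, hd]; ring
    have hv' : v = 20 * c + 49 * d := by rw [h2, hc, hd]; ring
    have key : ∀ e f a : ZMod 9, 41 * (e ^ 3 + 18 * e * f ^ 2) ^ 2 +
      198 * (e ^ 3 + 18 * e * f ^ 2) * (3 * e ^ 2 * f + 6 * f ^ 3) +
      239 * (3 * e ^ 2 * f + 6 * f ^ 3) ^ 2 = a ^ 3 → 3 * e = 0 := by decide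
    have hcd : 41 * c ^ 2 + 198 * c * d + 239 * d ^ 2 = a ^ 3 := by rw [← ha, hu, hv']; ring
    have he := key e f a (by rw [hc, hd] at hcd; exact_mod_cast congrArg (Int.cast (R := ZMod 9)) hcd)
    have he9 : ((9 : ℕ) : ℤ) ∣ 3 * e := by
      rw [← ZMod.intCast_zmod_eq_zero_iff_dvd]; exact_mod_cast he
    obtain ⟨g, rfl⟩ : (3 : ℤ) ∣ e := by omega
    refine absurd (Int.isUnit_iff.1 (huv.isUnit_of_dvd' (x := 3) ?_ ?_)) (by norm_num)
    · exact ⟨49 * (9 * g ^ 3 + 18 * g * f ^ 2) + 120 * (9 * g ^ 2 * f + 2 * f ^ 3), by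
        rw [hu, hc, hd]; ring⟩
    · exact ⟨20 * (9 * g ^ 3 + 18 * g * f ^ 2) + 49 * (9 * g ^ 2 * f + 2 * f ^ 3), by
        rw [hv', hc, hd]; ring⟩

/-- The only affine rational points of the curve `y² = 6x⁶ - 7x³ + 2` are
`(x, y) = (1, 1)` and `(1, -1)`. -/
theorem rational_points_six_x6 (x y : ℚ) (h : y ^ 2 = 6 * x ^ 6 - 7 * x ^ 3 + 2) :
    (x = 1 ∧ y = 1) ∨ (x = 1 ∧ y = -1) := by
  rcases eq_or_ne x 1 with rfl | hx
  · have : (y - 1) * (y + 1) = 0 := by linear_combination h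
    rcases mul_eq_zero.1 this with h | h
    · exact Or.inl ⟨rfl, by linarith⟩
    · exact Or.inr ⟨rfl, by linarith⟩
  exfalso
  have hx3 : x ^ 3 - 1 ≠ 0 := by
    intro h0
    have hpos : 0 < x ^ 2 + x + 1 := by nlinarith [sq_nonneg (x + 1), sq_nonneg x]
    have : (x - 1) * (x ^ 2 + x + 1) = 0 := by linear_combination h0
    exact (mul_ne_zero (sub_ne_zero.2 hx) hpos.ne') this
  obtain ⟨t, ht⟩ : ∃ t, t = (y - 1) / (x ^ 3 - 1) := ⟨_, rfl⟩
  have hy : y = 1 + t * (x ^ 3 - 1) := by rw [ht, div_mul_cancel₀ _ hx3]; ring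
  have hxt : x ^ 3 * (t ^ 2 - 6) = t ^ 2 - 2 * t - 1 := by
    refine mul_right_cancel₀ hx3 ?_
    rw [hy] at h
    linear_combination h
  have hv0 : (t.den : ℤ) ≠ 0 := by exact_mod_cast t.den_ne_zero
  have hb0 : (x.den : ℤ) ≠ 0 := by exact_mod_cast x.den_ne_zero
  have huv : IsCoprime t.num (t.den : ℤ) := Int.isCoprime_iff_nat_coprime.2 t.reduced
  have hab : IsCoprime x.num (x.den : ℤ) := Int.isCoprime_iff_nat_coprime.2 x.reduced
  have heq : x.num ^ 3 * (t.num ^ 2 - 6 * (t.den : ℤ) ^ 2) =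
      (x.den : ℤ) ^ 3 * (t.num ^ 2 - 2 * t.num * t.den - (t.den : ℤ) ^ 2) := by
    rw [← Rat.num_div_den x, ← Rat.num_div_den t] at hxt
    have h1 : (x.den : ℚ) ≠ 0 := by exact_mod_cast x.den_ne_zero
    have h2 : (t.den : ℚ) ≠ 0 := by exact_mod_cast t.den_ne_zero
    field_simp at hxt
    have : ((x.num : ℚ)) ^ 3 * (t.num ^ 2 - 6 * (t.den : ℚ) ^ 2) =
      (x.den : ℚ) ^ 3 * (t.num ^ 2 - 2 * t.num * t.den - (t.den : ℚ) ^ 2) := by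
      linear_combination hxt
    exact_mod_cast this
  obtain ⟨k, hk⟩ : (x.den : ℤ) ^ 3 ∣ t.num ^ 2 - 6 * (t.den : ℤ) ^ 2 :=
    (hab.symm.pow (m := 3) (n := 3)).dvd_of_dvd_mul_left ⟨_, heq⟩
  have hk' : t.num ^ 2 - 2 * t.num * t.den - (t.den : ℤ) ^ 2 = x.num ^ 3 * k := by
    refine mul_left_cancel₀ (pow_ne_zero 3 hb0) ?_
    rw [← heq, hk]; ring
  have hunit : IsUnit k := (isCoprime_quadratic_forms huv).isUnit_of_dvd'
    (hk' ▸ dvd_mul_left _ _) (hk ▸ dvd_mul_left _ _)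
  have hk3 : k = k ^ 3 := by
    rcases Int.isUnit_iff.1 hunit with rfl | rfl <;> norm_num
  have := eq_of_quadratic_forms_cube (a := x.num * k) (b := x.den * k) huv hv0
    (by rw [mul_pow, ← hk3, hk']) (by rw [mul_pow, ← hk3, hk]) (mul_ne_zero hb0 hunit.ne_zero)
  rw [mul_pow, mul_pow] at this
  have hcube := mul_right_cancel₀ (pow_ne_zero 3 hunit.ne_zero) this
  refine hx3 ?_
  rw [← Rat.num_div_den x, div_pow, show (x.num : ℚ) ^ 3 = (x.den : ℚ) ^ 3 by exact_mod_cast hcube,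
    div_self (by exact_mod_cast pow_ne_zero 3 hb0), sub_self]
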